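/- arXiv:1708.01211 — 4 statements merged into one kernel-verified Lean document; each statement's English description precedes it below -/
import Mathlib

section
/- Fix an integer r ≥ 2. For every ε > 0, with high probability as n → ∞ there exists an r-edge-coloring of the random r-out graph G_{n,r-out} such that every monochromatic component has at most εn vertices. -/
namespace KOut

open Finset Relation

open Classical in
/-- component of a vertex, as a finset -/
noncomputable def comp {V : Type*} [Fintype V] (G : SimpleGraph V) (x : V) : Finset V :=
  univ.filter (fun y => G.Reachable x y)

theorem mem_comp {V : Type*} [Fintype V] {G : SimpleGraph V} {x y : V} :
    y ∈ comp G x ↔ G.Reachable x y := by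
  simp [comp]

theorem reach_inv {V : Type*} {G : SimpleGraph V} (S : V → Prop)
    (hS : ∀ a b, G.Adj a b → S a → S b) {x y : V} (h : G.Reachable x y) (hx : S x) : S y := by
  obtain ⟨w⟩ := h
  induction w with
  | nil => exact hx
  | cons hadj _ ih => exact ih (hS _ _ hadj hx)

theorem comp_eq {V : Type*} [Fintype V] {G : SimpleGraph V} {x y : V} (h : G.Reachable x y) :
    comp G y = comp G x := by
  ext z
  rw [mem_comp, mem_comp]
  exact ⟨fun h' => h.trans h', fun h' => h.symm.trans h'⟩

/-- graph of `h` off `B` -/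
def gOff {V : Type*} (h : V → V) (B : Finset V) : SimpleGraph V :=
  SimpleGraph.fromRel (fun x y => (x ∉ B ∧ y ∉ B) ∧ h x = y)

theorem gOff_adj {V : Type*} {h : V → V} {B : Finset V} {x y : V} :
    (gOff h B).Adj x y ↔ x ≠ y ∧ (((x ∉ B ∧ y ∉ B) ∧ h x = y) ∨ ((y ∉ B ∧ x ∉ B) ∧ h y = x)) := by
  simp [gOff, SimpleGraph.fromRel_adj]

theorem gOff_mono {V : Type*} {h : V → V} {B B' : Finset V} (hB : B ⊆ B') :
    gOff h B' ≤ gOff h B := by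
  intro x y
  rw [gOff_adj, gOff_adj]
  rintro ⟨hne, h1 | h1⟩
  · exact ⟨hne, Or.inl ⟨⟨fun h => h1.1.1 (hB h), fun h => h1.1.2 (hB h)⟩, h1.2⟩⟩
  · exact ⟨hne, Or.inr ⟨⟨fun h => h1.1.1 (hB h), fun h => h1.1.2 (hB h)⟩, h1.2⟩⟩

theorem centroid {V : Type*} [Fintype V] [DecidableEq V] (h : V → V) (B : Finset V) (x0 : V)
    (hs : 2 ≤ (comp (gOff h B) x0).card) :
    ∃ c v : V, ∀ y ∈ comp (gOff h B) x0,
      2 * (comp (gOff h (insert c (insert v B))) y).card ≤ (comp (gOff h B) x0).card := by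
  classical
  set C := comp (gOff h B) x0 with hC
  let σ : V → V → Prop := fun x y => (x ∉ B ∧ y ∉ B) ∧ h x = y
  have σdet : ∀ {x y z}, σ x y → σ x z → y = z := fun h1 h2 => h1.2.symm.trans h2.2
  let D : V → Finset V := fun c => univ.filter (fun x => ReflTransGen σ x c)
  have hx0 : x0 ∈ C := mem_comp.2 (SimpleGraph.Reachable.refl _)
  have σC : ∀ {x y}, σ x y → (x ∈ C ↔ y ∈ C) := by
    intro x y hxy
    by_cases hne : x = y
    · rw [hne]
    have hadj : (gOff h B).Adj x y := gOff_adj.2 ⟨hne, Or.inl hxy⟩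
    rw [hC, mem_comp, mem_comp]
    exact ⟨fun h => h.trans hadj.reachable, fun h => h.trans hadj.symm.reachable⟩
  obtain ⟨c, hcC, hcmax⟩ := C.exists_max_image (fun c => (D c).card) ⟨x0, hx0⟩
  have hDc : ∀ x ∈ C, ReflTransGen σ x c := by
    have inv : ∀ a b, (gOff h B).Adj a b → ReflTransGen σ a c → ReflTransGen σ b c := by
      intro a b hab ha
      rw [gOff_adj] at hab
      rcases hab.2 with h1 | h1
      · have h1 : σ a b := h1
        rcases ReflTransGen.cases_head ha with rfl | ⟨d, had, hd⟩
        · have hbC : b ∈ C := (σC h1).1 hcC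
          have hsub : D a ⊆ D b := by
            intro z hz
            simp only [D, mem_filter, mem_univ, true_and] at hz ⊢
            exact hz.tail h1
          have heq := eq_of_subset_of_card_le hsub (hcmax b hbC)
          have : b ∈ D b := by simp [D, ReflTransGen.refl]
          rw [← heq] at this
          simpa [D] using this
        · rw [σdet h1 had]; exact hd
      · exact ReflTransGen.head h1 ha
    intro x hx
    have h1 : (gOff h B).Reachable c x := by
      rw [hC, mem_comp] at hx hcC
      exact hcC.symm.trans hx
    exact reach_inv (fun a => ReflTransGen σ a c) inv h1 ReflTransGen.refl
  let τ : V → V → Prop := fun x y => σ x y ∧ x ≠ c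
  have τdet : ∀ {x y z}, τ x y → τ x z → y = z := fun h1 h2 => σdet h1.1 h2.1
  have τc : ∀ x ∈ C, ReflTransGen τ x c := by
    intro x hx
    have := hDc x hx
    clear hx
    induction this using ReflTransGen.head_induction_on with
    | refl => exact ReflTransGen.refl
    | head h1 _ ih =>
      rename_i a b _
      by_cases hac : a = c
      · rw [hac]
      · exact ReflTransGen.head ⟨h1, hac⟩ ih
  have τC : ∀ {x y}, ReflTransGen τ x y → y ∈ C → x ∈ C := by
    intro x y hxy hy
    induction hxy using ReflTransGen.head_induction_on with
    | refl => exact hy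
    | head h1 _ ih => exact (σC h1.1).2 ih
  let T : V → Finset V := fun w => univ.filter (fun x => ReflTransGen τ x w)
  have memT : ∀ {x w}, x ∈ T w ↔ ReflTransGen τ x w := by intro x w; simp [T]
  have hTc : C ⊆ T c := fun x hx => memT.2 (τc x hx)
  obtain ⟨v, hv, hvmin⟩ := (C.filter (fun w => C.card ≤ 2 * (T w).card)).exists_min_image
    (fun w => (T w).card) ⟨c, by
      rw [mem_filter]; refine ⟨hcC, ?_⟩
      have := card_le_card hTc
      omega⟩
  rw [mem_filter] at hv
  refine ⟨c, v, ?_⟩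
  set B' := insert c (insert v B) with hB'
  have hBB : B ⊆ B' := fun z hz => by simp [hB', hz]
  have edge : ∀ a b, ((a ∉ B' ∧ b ∉ B') ∧ h a = b) → τ a b ∧ a ≠ v ∧ b ≠ v := by
    rintro a b ⟨⟨h1, h2⟩, h3⟩
    simp only [hB', mem_insert, not_or] at h1 h2
    exact ⟨⟨⟨⟨h1.2.2, h2.2.2⟩, h3⟩, h1.1⟩, h1.2.1, h2.2.1⟩
  have sub : ∀ y ∈ C, comp (gOff h B') y ⊆ C := by
    intro y hy z hz
    rw [mem_comp] at hz
    rw [hC, mem_comp] at hy ⊢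
    exact hy.trans (hz.mono (gOff_mono hBB))
  have iso : ∀ y ∈ B', comp (gOff h B') y ⊆ {y} := by
    intro y hy z hz
    rw [mem_comp] at hz
    rw [mem_singleton]
    refine reach_inv (fun a => a = y) ?_ hz rfl
    rintro a b hab rfl
    rw [gOff_adj] at hab
    tauto
  intro y hy
  by_cases hyB : y ∈ B'
  · have := card_le_card (iso y hyB)
    rw [card_singleton] at this
    omega
  have hyv : y ≠ v := by rintro rfl; exact hyB (by simp [hB'])
  by_cases hyT : y ∈ T v
  · rw [memT] at hyT
    rcases ReflTransGen.cases_tail hyT with h1 | ⟨u, hyu, huv⟩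
    · exact absurd h1.symm hyv
    have hsubu : comp (gOff h B') y ⊆ T u := by
      intro z hz
      rw [mem_comp] at hz
      rw [memT]
      refine reach_inv (fun a => ReflTransGen τ a u) ?_ hz hyu
      intro a b hab ha
      rw [gOff_adj] at hab
      rcases hab.2 with h1 | h1
      · obtain ⟨h2, h3, h4⟩ := edge _ _ h1
        rcases ReflTransGen.cases_head ha with rfl | ⟨d, had, hd⟩
        · exact absurd (τdet h2 huv) h4
        · rw [τdet h2 had]; exact hd
      · exact ReflTransGen.head (edge _ _ h1).1 ha
    have huC : u ∈ C := (σC huv.1).2 hv.1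
    have hTu : 2 * (T u).card < C.card := by
      by_contra hcon
      push Not at hcon
      have h1 := hvmin u (mem_filter.2 ⟨huC, hcon⟩)
      have h2 : T u ⊆ T v := fun z hz => memT.2 ((memT.1 hz).tail huv)
      have h3 := eq_of_subset_of_card_le h2 h1
      have h4 : v ∈ T u := by rw [h3, memT]
      have h5 : TransGen τ v v := TransGen.tail' (memT.1 h4) huv
      have h6 : ∀ w, ReflTransGen τ v w → TransGen τ w w := by
        intro w hw
        induction hw with
        | refl => exact h5
        | tail _ hab ih =>
          obtain ⟨d, hd1, hd2⟩ := TransGen.head'_iff.1 ih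
          rw [τdet hab hd1] at *
          exact TransGen.tail' hd2 hd1
      obtain ⟨d, hd1, _⟩ := TransGen.head'_iff.1 (h6 c (τc v hv.1))
      exact hd1.2 rfl
    have := card_le_card hsubu
    omega
  · have hsubT : comp (gOff h B') y ⊆ C \ T v := by
      intro z hz
      rw [mem_sdiff]
      refine ⟨sub y hy hz, ?_⟩
      rw [mem_comp] at hz
      refine reach_inv (fun a => a ∉ T v) ?_ hz hyT
      intro a b hab ha hb
      apply ha
      rw [memT] at hb ⊢
      rw [gOff_adj] at hab
      rcases hab.2 with h1 | h1
      · exact ReflTransGen.head (edge _ _ h1).1 hb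
      · obtain ⟨h2, h3, h4⟩ := edge _ _ h1
        rcases ReflTransGen.cases_head hb with h5 | ⟨d, had, hd⟩
        · exact absurd h5 h3
        · rw [τdet h2 had]; exact hd
    have h1 := card_le_card hsubT
    have hTC : T v ⊆ C := fun z hz => τC (memT.1 hz) hv.1
    rw [card_sdiff_of_subset hTC] at h1
    have := hv.2
    omega

theorem separator {V : Type*} [Fintype V] [DecidableEq V] (h : V → V) (M : ℕ) 
    (hn : 2 * M ≤ Fintype.card V) (hn0 : 0 < Fintype.card V) :
    ∃ B : Finset V, B.card ≤ 16 * M ^ 2 ∧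
      ∀ x, 2 * M * (comp (gOff h B) x).card ≤ Fintype.card V := by
  classical
  set n := Fintype.card V with hndef
  let pairs : Finset V → ℕ := fun B => ∑ y, (comp (gOff h B) y).card
  obtain ⟨B, -, hB⟩ := (univ : Finset (Finset V)).exists_min_image
    (fun B => n ^ 2 * B.card + 16 * M ^ 2 * pairs B) ⟨∅, mem_univ _⟩
  refine ⟨B, ?_, ?_⟩
  · have h0 := hB ∅ (mem_univ _)
    simp only [card_empty, mul_zero, zero_add] at h0
    have h1 : pairs ∅ ≤ n ^ 2 := by
      calc pairs ∅ ≤ ∑ y : V, n := sum_le_sum (fun y _ => card_le_univ _)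
        _ = n ^ 2 := by simp [sq, hndef]
    have h2 : n ^ 2 * B.card ≤ n ^ 2 * (16 * M ^ 2) := by nlinarith
    exact Nat.le_of_mul_le_mul_left h2 (by positivity)
  · intro x
    by_contra hcon
    push Not at hcon
    set s := (comp (gOff h B) x).card with hs
    have hs2 : 2 ≤ s := by
      by_contra h2
      have : s ≤ 1 := by omega
      have : 2 * M * s ≤ 2 * M * 1 := Nat.mul_le_mul_left _ this
      omega
    obtain ⟨c, v, hcv⟩ := centroid h B x hs2
    set B' := insert c (insert v B) with hB'
    have hcard : B'.card ≤ B.card + 2 := by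
      have h1 := card_insert_le c (insert v B)
      have h2 := card_insert_le v B
      rw [hB']
      omega
    have hsub : B ⊆ B' := fun z hz => by simp [hB', hz]
    have h0 := hB B' (mem_univ _)
    have key : 2 * pairs B' + s ^ 2 ≤ 2 * pairs B := by
      simp only [pairs]
      rw [← sum_filter_add_sum_filter_not univ (fun y => y ∈ comp (gOff h B) x)
        (fun y => (comp (gOff h B') y).card),
        ← sum_filter_add_sum_filter_not univ (fun y => y ∈ comp (gOff h B) x)
        (fun y => (comp (gOff h B) y).card)]
      have e1 : ∑ y ∈ univ.filter (fun y => y ∈ comp (gOff h B) x), (comp (gOff h B) y).card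
          = s * s := by
        rw [sum_congr rfl (g := fun _ => s)]
        · simp [hs]
        · intro y hy
          rw [comp_eq (mem_comp.1 (mem_filter.1 hy).2)]
      have e2 : 2 * ∑ y ∈ univ.filter (fun y => y ∈ comp (gOff h B) x),
          (comp (gOff h B') y).card ≤ s * s := by
        rw [mul_sum]
        calc _ ≤ ∑ y ∈ univ.filter (fun y => y ∈ comp (gOff h B) x), s :=
              sum_le_sum (fun y hy => hcv y (mem_filter.1 hy).2)
          _ = s * s := by simp [hs]
      have e3 : ∑ y ∈ univ.filter (fun y => ¬ y ∈ comp (gOff h B) x), (comp (gOff h B') y).card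
          ≤ ∑ y ∈ univ.filter (fun y => ¬ y ∈ comp (gOff h B) x), (comp (gOff h B) y).card := by
        refine sum_le_sum (fun y _ => card_le_card ?_)
        intro z hz
        rw [mem_comp] at hz ⊢
        exact hz.mono (gOff_mono hsub)
      rw [sq]
      omega
    have h3 : 16 * M ^ 2 * (2 * pairs B' + s ^ 2) ≤ 16 * M ^ 2 * (2 * pairs B) :=
      Nat.mul_le_mul_left _ key
    have h4 : n ^ 2 * B'.card ≤ n ^ 2 * (B.card + 2) := Nat.mul_le_mul_left _ hcard
    have h5 : (2 * M * s) ^ 2 ≤ n ^ 2 := by nlinarith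
    have h6 : n ^ 2 < (2 * M * s) ^ 2 := Nat.pow_lt_pow_left hcon (by norm_num)
    omega

theorem balance {V : Type*} [Fintype V] [DecidableEq V] (G : SimpleGraph V) (M : ℕ) (hM : 0 < M)
    (hG : ∀ x, 2 * M * (comp G x).card ≤ Fintype.card V) :
    ∃ l : V → Fin M, (∀ x y, G.Adj x y → l x = l y) ∧
      ∀ j, Fintype.card V ≤ 2 * M * (univ.filter (fun x => l x = j)).card ∧
        2 * M * (univ.filter (fun x => l x = j)).card ≤ 3 * Fintype.card V := by
  classical
  have : NeZero M := ⟨hM.ne'⟩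
  let cl : (V → Fin M) → Fin M → ℕ := fun l j => (univ.filter (fun x => l x = j)).card
  obtain ⟨l, hl, hmin⟩ := (univ.filter (fun l : V → Fin M => ∀ x y, G.Adj x y → l x = l y)).exists_min_image
    (fun l => ∑ j, ((cl l j : ℤ)) ^ 2) ⟨fun _ => 0, by simp⟩
  rw [mem_filter] at hl
  have hl := hl.2
  have hlr : ∀ x y, G.Reachable x y → l x = l y := fun x y h =>
    reach_inv (fun a => l x = l a) (fun a b hab h => h.trans (hl a b hab)) h rfl
  have key : ∀ i j, 2 * M * cl l i ≤ 2 * M * cl l j + Fintype.card V := by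
    intro i j
    by_cases hij : i = j
    · rw [hij]; omega
    by_cases hne : (univ.filter (fun x => l x = i)).Nonempty
    swap
    · rw [not_nonempty_iff_eq_empty] at hne
      simp [cl, hne]
    obtain ⟨x, hx⟩ := hne
    have hx : l x = i := by simpa using hx
    set t := (comp G x).card with ht
    have htpos : 0 < t := card_pos.2 ⟨x, mem_comp.2 (SimpleGraph.Reachable.refl _)⟩
    let l' : V → Fin M := fun y => if y ∈ comp G x then j else l y
    have hl' : l' ∈ univ.filter (fun l : V → Fin M => ∀ x y, G.Adj x y → l x = l y) := by
      rw [mem_filter]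
      refine ⟨mem_univ _, fun a b hab => ?_⟩
      have : a ∈ comp G x ↔ b ∈ comp G x := by
        rw [mem_comp, mem_comp]
        exact ⟨fun h => h.trans hab.reachable, fun h => h.trans hab.symm.reachable⟩
      simp only [l', this, hl a b hab]
    have hm := hmin l' hl'
    have hcl : ∀ m, (cl l' m : ℤ) = cl l m + t * ((if m = j then 1 else 0) - (if m = i then 1 else 0)) := by
      intro m
      by_cases hmj : m = j
      · have hmi : m ≠ i := fun h => hij (h.symm.trans hmj)
        have : univ.filter (fun y => l' y = m) = univ.filter (fun y => l y = m) ∪ comp G x := by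
          ext y
          by_cases hy : y ∈ comp G x <;> simp [l', hy, hmj]
        have hd : Disjoint (univ.filter (fun y => l y = m)) (comp G x) := by
          rw [disjoint_left]
          intro y hy hy2
          have h1 := hlr _ _ (mem_comp.1 hy2)
          simp at hy
          exact hmi (hy.symm.trans (h1.symm.trans hx))
        simp only [cl]
        rw [this, card_union_of_disjoint hd]
        simp [hmj, Ne.symm hij, ht]
      · by_cases hmi : m = i
        · have hs : comp G x ⊆ univ.filter (fun y => l y = m) := by
            intro y hy
            have h1 := hlr _ _ (mem_comp.1 hy)
            simp [hmi, ← h1, hx]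
          have : univ.filter (fun y => l' y = m) = univ.filter (fun y => l y = m) \ comp G x := by
            ext y
            by_cases hy : y ∈ comp G x
            · simp [l', hy, Ne.symm hmj]
            · simp [l', hy]
          have h2 := card_le_card hs
          simp only [cl]
          rw [this, card_sdiff_of_subset hs, Nat.cast_sub h2]
          simp [hmi, hij, ht, sub_eq_add_neg]
        · have : univ.filter (fun y => l' y = m) = univ.filter (fun y => l y = m) := by
            ext y
            by_cases hy : y ∈ comp G x
            · have h1 := hlr _ _ (mem_comp.1 hy)
              simp [l', hy, ← h1, hx, Ne.symm hmj, Ne.symm hmi]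
            · simp [l', hy]
          simp only [cl]
          rw [this]
          simp [hmi, hmj]
    have hsum : ∑ m, (cl l' m : ℤ) ^ 2 = ∑ m, (cl l m : ℤ) ^ 2 + 2 * t * (cl l j - cl l i) + 2 * t ^ 2 := by
      have : ∀ m, (cl l' m : ℤ) ^ 2 = (cl l m : ℤ) ^ 2 +
          (if m = j then 2 * t * (cl l m : ℤ) + t ^ 2 else 0) +
          (if m = i then - 2 * t * (cl l m : ℤ) + t ^ 2 else 0) := by
        intro m
        rw [hcl]
        by_cases hmj : m = j
        · have hmi : m ≠ i := fun h => hij (h.symm.trans hmj)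
          simp only [hmj, Ne.symm hij, if_true, if_false]; ring
        · by_cases hmi : m = i
          · simp only [hmi, hij, if_true, if_false]; ring
          · simp [hmj, hmi]
      rw [sum_congr rfl (fun m _ => this m), sum_add_distrib, sum_add_distrib]
      simp only [sum_ite_eq', mem_univ, if_true]
      ring
    rw [hsum] at hm
    have h1 : (0:ℤ) ≤ (2 * t) * (cl l j - cl l i + t) := by linarith
    have h2 : (0:ℤ) ≤ cl l j - cl l i + t := by
      by_contra hc
      push Not at hc
      have : (0:ℤ) < 2 * t := by positivity
      nlinarith
    have h3 : cl l i ≤ cl l j + t := by omega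
    have h4 := hG x
    rw [← ht] at h4
    calc 2 * M * cl l i ≤ 2 * M * (cl l j + t) := Nat.mul_le_mul_left _ h3
      _ ≤ _ := by rw [mul_add]; omega
  have htot : ∑ j, cl l j = Fintype.card V := by
    simp only [cl]
    rw [← card_univ, card_eq_sum_card_fiberwise (f := l) (t := univ) (fun _ _ => mem_univ _)]
  refine ⟨l, hl, fun j => ⟨?_, ?_⟩⟩
  · have h1 : ∑ i, 2 * M * cl l i ≤ ∑ i : Fin M, (2 * M * cl l j + Fintype.card V) :=
      sum_le_sum (fun i _ => key i j)
    rw [← mul_sum, htot] at h1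
    simp only [sum_const, card_univ, Fintype.card_fin, smul_eq_mul] at h1
    have h2 : M * Fintype.card V ≤ M * (2 * M * cl l j) := by nlinarith
    exact Nat.le_of_mul_le_mul_left h2 hM
  · have h1 : ∑ i : Fin M, 2 * M * cl l j ≤ ∑ i : Fin M, (2 * M * cl l i + Fintype.card V) :=
      sum_le_sum (fun i _ => key j i)
    rw [sum_add_distrib, ← mul_sum univ (fun i => cl l i), htot] at h1
    simp only [sum_const, card_univ, Fintype.card_fin, smul_eq_mul] at h1
    have h2 : M * (2 * M * cl l j) ≤ M * (3 * Fintype.card V) := by nlinarith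
    exact Nat.le_of_mul_le_mul_left h2 hM

/-- the deterministic partition lemma -/
theorem partition {V : Type*} [Fintype V] [DecidableEq V] (h : V → V) (M : ℕ) (hM : 0 < M)
    (hn : 2 * M ≤ Fintype.card V) :
    ∃ (B : Finset V) (l : V → Fin M), B.card ≤ 16 * M ^ 2 ∧
      (∀ x, x ∉ B → h x ∉ B → l x = l (h x)) ∧
      ∀ j, Fintype.card V ≤ 2 * M * (univ.filter (fun x => l x = j)).card ∧
        2 * M * (univ.filter (fun x => l x = j)).card ≤ 3 * Fintype.card V := by
  obtain ⟨B, hB, hB2⟩ := separator h M hn (by omega)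
  obtain ⟨l, hl, hl2⟩ := balance (gOff h B) M hM hB2
  refine ⟨B, l, hB, fun x hx hx2 => ?_, hl2⟩
  by_cases he : x = h x
  · rw [← he]
  · exact hl _ _ (gOff_adj.2 ⟨he, Or.inl ⟨⟨hx, hx2⟩, rfl⟩⟩)

end KOut
namespace KOut

open Finset Relation

/-- the crossing edges of `f` -/
def crossG {V L : Type*} (f : V → V) (l : V → L) : SimpleGraph V :=
  SimpleGraph.fromRel (fun x y => f x = y ∧ l x ≠ l y)

theorem coloring {V L : Type*} [Fintype V] [DecidableEq V] [DecidableEq L] (k : ℕ) (i0 : Fin k)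
    (g : V → Fin (k + 1) → V) (l : V → L) (Q : Finset V)
    (hQ : ∀ x, l x ≠ l (g x (Fin.last k)) → x ∈ Q ∧ g x (Fin.last k) ∈ Q) (K s : ℝ)
    (hcl : ∀ j, ((univ.filter (fun x => l x = j)).card : ℝ) ≤ K)
    (hs : ∀ (i : Fin k) x, ((comp (crossG (fun v => g v i.castSucc) l) x).card : ℝ) ≤ s)
    (hK : (1 + (Q.card : ℝ)) * s ≤ K) :
    ∃ c : Sym2 V → Fin (k + 1), ∀ j v,
      ((comp (SimpleGraph.fromRel (fun u w => w ∈ univ.image (g u) ∧ c s(u, w) = j)) v).card : ℝ)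
        ≤ K := by
  classical
  let P1 : Sym2 V → Prop := fun e => ∃ x y, e = s(x, y) ∧ l x = l y
  let P2 : Sym2 V → Prop := fun e => ∃ i : Fin k, ∃ x, e = s(x, g x i.castSucc)
  let c : Sym2 V → Fin (k + 1) := fun e =>
    if P1 e then Fin.last k else if h : P2 e then h.choose.castSucc else i0.castSucc
  have hP1 : ∀ u w, P1 s(u, w) ↔ l u = l w := by
    intro u w
    constructor
    · rintro ⟨x, y, hxy, hl⟩
      rw [Sym2.eq_iff] at hxy
      rcases hxy with ⟨rfl, rfl⟩ | ⟨rfl, rfl⟩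
      · exact hl
      · exact hl.symm
    · intro h
      exact ⟨u, w, rfl, h⟩
  refine ⟨c, fun j v => ?_⟩
  have key : ∀ u w, (w ∈ univ.image (g u) ∨ u ∈ univ.image (g w)) →
      (c s(u, w) = Fin.last k → l u = l w) ∧
      (∀ i : Fin k, c s(u, w) = i.castSucc →
        (crossG (fun v => g v i.castSucc) l).Adj u w ∨ (u ∈ Q ∧ w ∈ Q)) := by
    intro u w hadj
    by_cases h1 : P1 s(u, w)
    · refine ⟨fun _ => (hP1 u w).1 h1, fun i hi => ?_⟩
      simp only [c, h1, if_true] at hi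
      exact absurd hi.symm (Fin.castSucc_lt_last i).ne
    have hl : l u ≠ l w := fun h => h1 ((hP1 u w).2 h)
    have hne : u ≠ w := fun h => hl (by rw [h])
    by_cases h2 : P2 s(u, w)
    · simp only [c, h1, h2, if_false, dif_pos]
      refine ⟨fun h => absurd h (Fin.castSucc_lt_last _).ne, fun i hi => Or.inl ?_⟩
      have hi := Fin.castSucc_injective _ hi
      obtain ⟨x, hx⟩ := h2.choose_spec
      rw [hi] at hx
      rw [crossG, SimpleGraph.fromRel_adj]
      refine ⟨hne, ?_⟩
      rw [Sym2.eq_iff] at hx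
      rcases hx with ⟨rfl, hx⟩ | ⟨hx, rfl⟩
      · exact Or.inl ⟨hx.symm, hl⟩
      · exact Or.inr ⟨hx.symm, hl.symm⟩
    · simp only [c, h1, h2, if_false, dif_neg, not_false_eq_true]
      refine ⟨fun h => absurd h (Fin.castSucc_lt_last _).ne, fun i hi => Or.inr ?_⟩
      rcases hadj with hadj | hadj
      · obtain ⟨m, -, hm⟩ := mem_image.1 hadj
        rcases Fin.eq_castSucc_or_eq_last m with ⟨m', rfl⟩ | rfl
        · exact absurd ⟨m', u, by rw [hm]⟩ h2
        · have := hQ u (by rw [hm]; exact hl)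
          rwa [hm] at this
      · obtain ⟨m, -, hm⟩ := mem_image.1 hadj
        rcases Fin.eq_castSucc_or_eq_last m with ⟨m', rfl⟩ | rfl
        · exact absurd ⟨m', w, by rw [hm, Sym2.eq_swap]⟩ h2
        · have := hQ w (by rw [hm]; exact hl.symm)
          rw [hm] at this
          exact this.symm
  have adjkey : ∀ u w, (SimpleGraph.fromRel
      (fun u w => w ∈ univ.image (g u) ∧ c s(u, w) = j)).Adj u w →
      (w ∈ univ.image (g u) ∨ u ∈ univ.image (g w)) ∧ c s(u, w) = j := by
    intro u w h
    rw [SimpleGraph.fromRel_adj] at h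
    rcases h.2 with h | h
    · exact ⟨Or.inl h.1, h.2⟩
    · exact ⟨Or.inr h.1, by rw [Sym2.eq_swap]; exact h.2⟩
  rcases Fin.eq_castSucc_or_eq_last j with ⟨i, rfl⟩ | rfl
  · set H := crossG (fun v => g v i.castSucc) l with hH
    have hsub : comp (SimpleGraph.fromRel
        (fun u w => w ∈ univ.image (g u) ∧ c s(u, w) = i.castSucc)) v ⊆
        comp H v ∪ Q.biUnion (fun q => comp H q) := by
      intro z hz
      rw [mem_comp] at hz
      refine reach_inv (fun a => a ∈ comp H v ∪ Q.biUnion (fun q => comp H q)) ?_ hz ?_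
      · intro a b hab ha
        obtain ⟨h1, h2⟩ := adjkey a b hab
        rcases (key a b h1).2 i h2 with h3 | h3
        · rw [mem_union, mem_biUnion] at ha ⊢
          rcases ha with ha | ⟨q, hq, ha⟩
          · exact Or.inl (mem_comp.2 ((mem_comp.1 ha).trans h3.reachable))
          · exact Or.inr ⟨q, hq, mem_comp.2 ((mem_comp.1 ha).trans h3.reachable)⟩
        · rw [mem_union, mem_biUnion]
          exact Or.inr ⟨b, h3.2, mem_comp.2 (SimpleGraph.Reachable.refl _)⟩
      · exact mem_union_left _ (mem_comp.2 (SimpleGraph.Reachable.refl _))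
    have h1 := (card_le_card hsub).trans (card_union_le _ _)
    have h2 : ((Q.biUnion (fun q => comp H q)).card : ℝ) ≤ Q.card * s := by
      calc ((Q.biUnion (fun q => comp H q)).card : ℝ) ≤ ((∑ q ∈ Q, (comp H q).card : ℕ) : ℝ) := by
            exact_mod_cast card_biUnion_le
        _ = ∑ q ∈ Q, ((comp H q).card : ℝ) := by push_cast; rfl
        _ ≤ ∑ q ∈ Q, s := sum_le_sum (fun q _ => hs i q)
        _ = Q.card * s := by simp
    have h3 := hs i v
    rw [← hH] at h3
    have h1' : ((comp (SimpleGraph.fromRel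
        (fun u w => w ∈ univ.image (g u) ∧ c s(u, w) = i.castSucc)) v).card : ℝ) ≤
        (comp H v).card + (Q.biUnion (fun q => comp H q)).card := by exact_mod_cast h1
    linarith
  · refine le_trans ?_ (hcl (l v))
    norm_cast
    apply card_le_card
    intro z hz
    rw [mem_comp] at hz
    rw [mem_filter]
    refine ⟨mem_univ _, ?_⟩
    refine reach_inv (fun a => l a = l v) ?_ hz rfl
    intro a b hab ha
    obtain ⟨h1, h2⟩ := adjkey a b hab
    rw [← (key a b h1).1 h2, ha]

/-- V-shaped simple path witnessing connectivity of `x,y` in the crossing graph -/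
theorem vpath {V L : Type*} [Fintype V] (f : V → V) (l : V → L) (x y : V)
    (h : (crossG f l).Reachable x y) :
    ∃ a b : ℕ, ∃ z : Fin (a + b + 1) → V, z 0 = x ∧ z (Fin.last _) = y ∧ Function.Injective z ∧
      (∀ j : Fin (a + b), l (z j.castSucc) ≠ l (z j.succ)) ∧
      (∀ j : Fin (a + b), (j : ℕ) < a → f (z j.castSucc) = z j.succ) ∧
      (∀ j : Fin (a + b), a ≤ (j : ℕ) → f (z j.succ) = z j.castSucc) := by
  classical
  let W : ℕ → V → Prop := fun a x => ∀ j < a, l (f^[j] x) ≠ l (f^[j + 1] x)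
  let J : V → Prop := fun y => ∃ s a b : ℕ, s = a + b ∧ f^[a] x = f^[b] y ∧ W a x ∧ W b y
  have hJ : J y := by
    refine reach_inv J ?_ h ⟨0, 0, 0, rfl, rfl, by simp [W], by simp [W]⟩
    rintro u w huw ⟨_, a, b, -, hab, hWa, hWb⟩
    rw [crossG, SimpleGraph.fromRel_adj] at huw
    rcases huw.2 with ⟨h1, h2⟩ | ⟨h1, h2⟩
    · rcases b with _ | b
      · refine ⟨_, a + 1, 0, rfl, ?_, ?_, by simp [W]⟩
        · rw [Function.iterate_succ_apply', hab]; simpa using h1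
        · intro j hj
          by_cases hja : j < a
          · exact hWa j hja
          · have : j = a := by omega
            subst this
            rw [Function.iterate_succ_apply', hab]
            simp only [Function.iterate_zero, id]
            rwa [h1]
      · refine ⟨_, a, b, rfl, ?_, hWa, ?_⟩
        · rw [hab, Function.iterate_succ_apply, h1]
        · intro j hj
          have := hWb (j + 1) (by omega)
          rwa [Function.iterate_succ_apply, Function.iterate_succ_apply, h1] at this
    · refine ⟨_, a, b + 1, rfl, ?_, hWa, ?_⟩
      · rw [hab, Function.iterate_succ_apply, h1]
      · intro j hj
        rcases j with _ | j
        · simpa [h1] using h2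
        · have := hWb j (by omega)
          rwa [Function.iterate_succ_apply, Function.iterate_succ_apply, h1]
  have hmin := @Nat.find_min _ _ hJ
  obtain ⟨a, b, hs, hab, hWa, hWb⟩ := Nat.find_spec hJ
  rw [hs] at hmin
  have hmin : ∀ a' b', a' + b' < a + b → W a' x → W b' y → f^[a'] x ≠ f^[b'] y :=
    fun a' b' h1 h2 h3 h4 => hmin h1 ⟨a', b', rfl, h4, h2, h3⟩
  have Wle : ∀ {a a' x}, a' ≤ a → W a x → W a' x := fun h1 h2 j hj => h2 j (by omega)
  let z : Fin (a + b + 1) → V := fun j => if (j : ℕ) ≤ a then f^[j] x else f^[a + b - j] y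
  have z1 : ∀ j : Fin (a + b + 1), (j : ℕ) ≤ a → z j = f^[j] x := fun j hj => by simp [z, hj]
  have z2 : ∀ j : Fin (a + b + 1), a ≤ (j : ℕ) → z j = f^[a + b - j] y := by
    intro j hj
    by_cases h' : (j : ℕ) ≤ a
    · have : (j : ℕ) = a := by omega
      rw [z1 j h', this, hab]; congr 2; omega
    · simp [z, h']
  have selfx : ∀ i j : ℕ, i < j → j ≤ a → f^[i] x ≠ f^[j] x := by
    intro i j hij hja he
    refine hmin (i + (a - j)) b (by omega) (Wle (by omega) hWa) hWb ?_
    rw [← hab, add_comm, Function.iterate_add_apply, he, ← Function.iterate_add_apply]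
    congr 2; omega
  have selfy : ∀ i j : ℕ, i < j → j ≤ b → f^[i] y ≠ f^[j] y := by
    intro i j hij hja he
    refine hmin a (i + (b - j)) (by omega) hWa (Wle (by omega) hWb) ?_
    rw [hab, add_comm, Function.iterate_add_apply, he, ← Function.iterate_add_apply]
    congr 2; omega
  have hzlt : ∀ i j : Fin (a + b + 1), (i : ℕ) < j → z i ≠ z j := by
    intro i j hij
    by_cases hj : (j : ℕ) ≤ a
    · rw [z1 i (by omega), z1 j hj]; exact selfx _ _ hij hj
    · by_cases hi : (i : ℕ) ≤ a
      · rw [z1 i hi, z2 j (by omega)]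
        exact hmin _ _ (by omega) (Wle hi hWa) (Wle (by omega) hWb)
      · rw [z2 i (by omega), z2 j (by omega)]
        exact (selfy _ _ (by omega) (by omega)).symm
  refine ⟨a, b, z, ?_, ?_, ?_, ?_, ?_, ?_⟩
  · rw [z1 0 (by simp)]; simp
  · rw [z2 (Fin.last _) (by simp)]; simp
  · intro i j hij
    rcases lt_trichotomy (i : ℕ) j with h1 | h1 | h1
    · exact absurd hij (hzlt _ _ h1)
    · exact Fin.ext h1
    · exact absurd hij.symm (hzlt _ _ h1)
  · intro j
    by_cases hj : (j : ℕ) < a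
    · rw [z1 _ (by simp; omega), z1 _ (by simp; omega)]
      simpa using hWa j hj
    · rw [z2 _ (by simp; omega), z2 _ (by simp; omega)]
      have h1 := hWb (a + b - (j + 1)) (by omega)
      have e : a + b - ((j : ℕ) + 1) + 1 = a + b - j := by omega
      rw [e] at h1
      simpa using h1.symm
  · intro j hj
    rw [z1 _ (by simp; omega), z1 _ (by simp; omega)]
    simp [Function.iterate_succ_apply']
  · intro j hj
    rw [z2 _ (by simp; omega), z2 _ (by simp; omega)]
    rw [← Function.iterate_succ_apply' f]
    congr 2
    simp
    omega

end KOut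
namespace KOut

open Finset Relation

theorem pi_count {V α T : Type*} [Fintype V] [DecidableEq V] [DecidableEq α] (S : V → Finset α)
    (A : V → T → Finset α) (q : ℕ) (hq : ∀ v t, q * (A v t).card ≤ (S v).card) {m : ℕ}
    (src : Fin m → V) (hsrc : Function.Injective src) (tgt : Fin m → T) :
    q ^ m * ((Fintype.piFinset S).filter (fun g => ∀ j, g (src j) ∈ A (src j) (tgt j))).card
      ≤ (Fintype.piFinset S).card := by
  classical
  let S' : V → Finset α := fun v => if h : ∃ j, src j = v then A v (tgt h.choose) else S v
  have hsub : (Fintype.piFinset S).filter (fun g => ∀ j, g (src j) ∈ A (src j) (tgt j)) ⊆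
      Fintype.piFinset S' := by
    intro g hg
    rw [mem_filter, Fintype.mem_piFinset] at hg
    rw [Fintype.mem_piFinset]
    intro v
    by_cases h : ∃ j, src j = v
    · simp only [S', h, dif_pos]
      have := hg.2 h.choose
      rwa [h.choose_spec] at this
    · simp only [S', h, dif_neg, not_false_eq_true]
      exact hg.1 v
  refine (Nat.mul_le_mul_left _ (card_le_card hsub)).trans ?_
  rw [Fintype.card_piFinset, Fintype.card_piFinset]
  have h1 : q ^ m = ∏ v : V, (if v ∈ univ.image src then q else 1) := by
    rw [prod_ite, prod_const, prod_const_one, mul_one]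
    congr 1
    rw [filter_mem_eq_inter, univ_inter, card_image_of_injective _ hsrc, card_univ, Fintype.card_fin]
  rw [h1, ← prod_mul_distrib]
  refine prod_le_prod' (fun v _ => ?_)
  by_cases h : ∃ j, src j = v
  · have : v ∈ univ.image src := by simpa using h
    simp only [S', h, dif_pos, this, if_true]
    exact hq _ _
  · have : v ∉ univ.image src := by simpa using h
    simp only [S', h, dif_neg, not_false_eq_true, this, if_false, one_mul]
    exact le_rfl

theorem sym_count {V I : Type*} [Fintype V] [DecidableEq V] [DecidableEq I] [Fintype I]
    (S : Finset (I → V)) (F : Finset V)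
    (i : I) (hF : ∀ e ∈ S, e i ∉ F)
    (hinv : ∀ e ∈ S, ∀ t t', t ∉ F → t' ∉ F → (fun x => Equiv.swap t t' (e x)) ∈ S) (t : V) :
    (Fintype.card V - F.card) * (S.filter (fun e => e i = t)).card ≤ S.card := by
  classical
  by_cases ht : t ∈ F
  · have : S.filter (fun e => e i = t) = ∅ := by
      rw [filter_eq_empty_iff]
      rintro e he rfl
      exact hF e he ht
    simp [this]
  · have h1 : ∀ t' ∈ Fᶜ, (S.filter (fun e => e i = t)).card ≤ (S.filter (fun e => e i = t')).card := by
      intro t' ht'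
      rw [mem_compl] at ht'
      refine card_le_card_of_injOn (fun e x => Equiv.swap t t' (e x)) ?_ ?_
      · intro e he
        rw [mem_coe, mem_filter] at he ⊢
        exact ⟨hinv e he.1 t t' ht ht', by simp [he.2]⟩
      · intro e _ e' _ hee
        funext x
        exact (Equiv.swap t t').injective (congrFun hee x)
    have h2 : ∑ t' ∈ Fᶜ, (S.filter (fun e => e i = t')).card = S.card := by
      rw [card_eq_sum_card_fiberwise (f := fun e => e i) (t := Fᶜ)]
      intro e he
      simpa using hF e he
    rw [← card_compl, ← smul_eq_mul, ← sum_const, ← h2]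
    exact sum_le_sum h1

open Classical in
/-- ordered choices at a vertex -/
noncomputable def Om {V : Type*} [Fintype V] (k : ℕ) (v : V) : Finset (Fin (k + 1) → V) :=
  univ.filter (fun e => Function.Injective e ∧ ∀ i, e i ≠ v)

open Classical in
/-- ordered choices at a vertex with prescribed last choice -/
noncomputable def OmL {V : Type*} [Fintype V] (k : ℕ) (v w : V) : Finset (Fin (k + 1) → V) :=
  (Om k v).filter (fun e => e (Fin.last k) = w)

theorem mem_Om {V : Type*} [Fintype V] {k : ℕ} {v : V} {e : Fin (k + 1) → V} :
    e ∈ Om k v ↔ Function.Injective e ∧ ∀ i, e i ≠ v := by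
  simp [Om]

theorem mem_OmL {V : Type*} [Fintype V] {k : ℕ} {v w : V} {e : Fin (k + 1) → V} :
    e ∈ OmL k v w ↔ e ∈ Om k v ∧ e (Fin.last k) = w := by
  simp [OmL]

theorem Om_inv {V : Type*} [Fintype V] [DecidableEq V] {k : ℕ} {v : V} {e : Fin (k + 1) → V}
    (he : e ∈ Om k v) {t t' : V} (ht : t ≠ v) (ht' : t' ≠ v) :
    (fun x => Equiv.swap t t' (e x)) ∈ Om k v := by
  rw [mem_Om] at he ⊢
  refine ⟨(Equiv.swap t t').injective.comp he.1, fun i hi => he.2 i ?_⟩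
  have : Equiv.swap t t' v = v := Equiv.swap_apply_of_ne_of_ne ht.symm ht'.symm
  exact (Equiv.swap t t').injective (hi.trans this.symm)

theorem Om_count {V : Type*} [Fintype V] [DecidableEq V] (k : ℕ) (v t : V) :
    (Fintype.card V - 1) * (OmL k v t).card ≤ (Om k v).card := by
  have := sym_count (Om k v) {v} (Fin.last k)
    (fun e he => by rw [mem_singleton]; exact (mem_Om.1 he).2 _)
    (fun e he t t' ht ht' => Om_inv he (by simpa using ht) (by simpa using ht')) t
  rw [card_singleton] at this
  convert this using 3
  ext e
  rw [mem_OmL, mem_filter]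

theorem OmL_count {V : Type*} [Fintype V] [DecidableEq V] (k : ℕ) (i : Fin k) (v w t : V) :
    (Fintype.card V - 2) * ((OmL k v w).filter (fun e => e i.castSucc = t)).card
      ≤ (OmL k v w).card := by
  have := sym_count (OmL k v w) {v, w} i.castSucc
    (fun e he => by
      rw [mem_OmL, mem_Om] at he
      rw [mem_insert, mem_singleton]
      rintro (h | h)
      · exact he.1.2 _ h
      · exact (Fin.castSucc_lt_last i).ne (he.1.1 (h.trans he.2.symm)))
    (fun e he t t' ht ht' => by
      rw [mem_OmL] at he ⊢
      simp only [mem_insert, mem_singleton, not_or] at ht ht'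
      refine ⟨Om_inv he.1 ht.1 ht'.1, ?_⟩
      rw [he.2]
      exact Equiv.swap_apply_of_ne_of_ne (Ne.symm ht.2) (Ne.symm ht'.2)) t
  refine le_trans (Nat.mul_le_mul_right _ ?_) this
  have := card_le_two (a := v) (b := w)
  omega

theorem cross_count {V L : Type*} [Fintype V] [DecidableEq V] [DecidableEq L] (l : V → L) (d : ℝ)
    (hd : ∀ v, ((univ.filter (fun w => l v ≠ l w)).card : ℝ) ≤ d) (m : ℕ) :
    ((univ.filter (fun z : Fin (m + 1) → V => ∀ j : Fin m, l (z j.castSucc) ≠ l (z j.succ))).card : ℝ)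
      ≤ Fintype.card V * d ^ m := by
  classical
  induction m with
  | zero => simp
  | succ m ih =>
    let X := univ.filter (fun z : Fin (m + 1) → V => ∀ j : Fin m, l (z j.castSucc) ≠ l (z j.succ))
    have h1 : (univ.filter (fun z : Fin (m + 1 + 1) → V =>
        ∀ j : Fin (m + 1), l (z j.castSucc) ≠ l (z j.succ))).card ≤
        (X.sigma (fun z => univ.filter (fun w => l (z (Fin.last m)) ≠ l w))).card := by
      refine card_le_card_of_injOn (fun z => ⟨Fin.init z, z (Fin.last _)⟩) ?_ ?_
      · intro z hz
        rw [mem_coe, mem_filter] at hz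
        rw [mem_coe, mem_sigma, mem_filter, mem_filter]
        refine ⟨⟨mem_univ _, fun j => ?_⟩, mem_univ _, ?_⟩
        · exact hz.2 j.castSucc
        · exact hz.2 (Fin.last m)
      · intro z _ z' _ h
        simp only [Sigma.mk.injEq, heq_eq_eq] at h
        rw [← Fin.snoc_init_self z, ← Fin.snoc_init_self z', h.1, h.2]
    have h2 : ((X.sigma (fun z => univ.filter (fun w => l (z (Fin.last m)) ≠ l w))).card : ℝ)
        ≤ X.card * d := by
      rw [card_sigma]
      push_cast
      calc _ ≤ ∑ z ∈ X, d := sum_le_sum (fun z _ => hd _)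
        _ = X.card * d := by simp
    by_cases hV : IsEmpty V
    · have : (univ.filter (fun z : Fin (m + 1 + 1) → V =>
        ∀ j : Fin (m + 1), l (z j.castSucc) ≠ l (z j.succ))) = ∅ := by
        rw [eq_empty_iff_forall_notMem]
        intro z _
        exact hV.false (z 0)
      rw [this]
      simp
    rw [not_isEmpty_iff] at hV
    have hd0 : 0 ≤ d := le_trans (Nat.cast_nonneg _) (hd hV.some)
    calc _ ≤ (((X.sigma (fun z => univ.filter (fun w => l (z (Fin.last m)) ≠ l w))).card : ℕ) : ℝ) := by
          exact_mod_cast h1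
      _ ≤ X.card * d := h2
      _ ≤ (Fintype.card V * d ^ m) * d := mul_le_mul_of_nonneg_right ih hd0
      _ = _ := by ring

open Classical in
/-- V-shaped crossing paths consistent with `f` -/
noncomputable def Zset {V L : Type*} [Fintype V] (l : V → L) (a b : ℕ) (f : V → V) :
    Finset (Fin (a + b + 1) → V) :=
  univ.filter (fun z => Function.Injective z ∧
      (∀ j : Fin (a + b), l (z j.castSucc) ≠ l (z j.succ)) ∧
      (∀ j : Fin (a + b), (j : ℕ) < a → f (z j.castSucc) = z j.succ) ∧
      (∀ j : Fin (a + b), a ≤ (j : ℕ) → f (z j.succ) = z j.castSucc))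

theorem pairs_le {V L : Type*} [Fintype V] [DecidableEq V] (l : V → L) (f : V → V) :
    ∑ x, (comp (crossG f l) x).card ≤
      ∑ a ∈ range (Fintype.card V), ∑ b ∈ range (Fintype.card V), (Zset l a b f).card := by
  classical
  set n := Fintype.card V
  rw [← card_sigma]
  have hsub : univ.sigma (fun x => comp (crossG f l) x) ⊆
      (range n).biUnion (fun a => (range n).biUnion (fun b => (Zset l a b f).image
        (fun z => (⟨z 0, z (Fin.last _)⟩ : Σ _ : V, V)))) := by
    rintro ⟨x, y⟩ h
    rw [mem_sigma, mem_comp] at h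
    obtain ⟨a, b, z, h1, h2, h3, h4⟩ := vpath f l x y h.2
    have hc := Fintype.card_le_of_injective z h3
    rw [Fintype.card_fin] at hc
    rw [mem_biUnion]
    refine ⟨a, mem_range.2 (by omega), ?_⟩
    rw [mem_biUnion]
    refine ⟨b, mem_range.2 (by omega), ?_⟩
    rw [mem_image]
    refine ⟨z, ?_, by rw [h1, h2]⟩
    simp only [Zset, mem_filter, mem_univ, true_and]
    exact ⟨h3, h4⟩
  refine (card_le_card hsub).trans (card_biUnion_le.trans (sum_le_sum fun a _ => ?_))
  exact card_biUnion_le.trans (sum_le_sum fun b _ => card_image_le)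

theorem Z_count {V L : Type*} [Fintype V] [DecidableEq V] [DecidableEq L] (k : ℕ) (i : Fin k)
    (h : V → V) (l : V → L) (a b : ℕ) (z : Fin (a + b + 1) → V) :
    (Fintype.card V - 2) ^ (a + b) *
      ((Fintype.piFinset (fun v => OmL k v (h v))).filter
        (fun g => z ∈ Zset l a b (fun v => g v i.castSucc))).card ≤
      (Fintype.piFinset (fun v => OmL k v (h v))).card := by
  classical
  by_cases hz : Function.Injective z
  swap
  · have : (Fintype.piFinset (fun v => OmL k v (h v))).filter
        (fun g => z ∈ Zset l a b (fun v => g v i.castSucc)) = ∅ := by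
      rw [filter_eq_empty_iff]
      intro g _ hg
      simp only [Zset, mem_filter] at hg
      exact hz hg.2.1
    simp [this]
  let src : Fin (a + b) → V := fun j => if (j : ℕ) < a then z j.castSucc else z j.succ
  let tgt : Fin (a + b) → V := fun j => if (j : ℕ) < a then z j.succ else z j.castSucc
  have hsrc : Function.Injective src := by
    intro j j' hjj
    by_cases h1 : (j : ℕ) < a <;> by_cases h2 : (j' : ℕ) < a <;> simp only [src, h1, h2, if_true, if_false] at hjj
    · exact Fin.castSucc_injective _ (hz hjj)
    · have := congrArg Fin.val (hz hjj)
      simp at this; omega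
    · have := congrArg Fin.val (hz hjj)
      simp at this; omega
    · exact Fin.succ_injective _ (hz hjj)
  have key := pi_count (fun v => OmL k v (h v))
    (fun v t => (OmL k v (h v)).filter (fun e => e i.castSucc = t)) (Fintype.card V - 2)
    (fun v t => OmL_count k i v (h v) t) src hsrc tgt
  refine le_trans (Nat.mul_le_mul_left _ (card_le_card ?_)) key
  intro g hg
  rw [mem_filter] at hg ⊢
  refine ⟨hg.1, fun j => ?_⟩
  have hg1 := Fintype.mem_piFinset.1 hg.1
  rw [mem_filter]
  refine ⟨hg1 _, ?_⟩
  simp only [Zset, mem_filter] at hg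
  obtain ⟨-, -, -, -, h3, h4⟩ := hg
  by_cases hj : (j : ℕ) < a
  · simp only [src, tgt, hj, if_true]; exact h3 j hj
  · simp only [src, tgt, hj, if_false]; exact h4 j (by omega)

theorem pairs_count {V L : Type*} [Fintype V] [DecidableEq V] [DecidableEq L] (k : ℕ) (i : Fin k)
    (h : V → V) (l : V → L) (M : ℕ) (hM : 0 < M) (hn : 8 * M ≤ Fintype.card V)
    (hl : ∀ j, Fintype.card V ≤ 2 * M * (univ.filter (fun x => l x = l j)).card) :
    ∑ g ∈ Fintype.piFinset (fun v => OmL k v (h v)),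
      ((∑ x, (comp (crossG (fun v => g v i.castSucc) l) x).card : ℕ) : ℝ) ≤
      (Fintype.card V * (16 * M ^ 2)) * (Fintype.piFinset (fun v => OmL k v (h v))).card := by
  classical
  set n := Fintype.card V with hndef
  set G := Fintype.piFinset (fun v => OmL k v (h v)) with hG
  have hM' : (1:ℝ) ≤ M := by exact_mod_cast hM
  have hnR : (8:ℝ) * M ≤ n := by exact_mod_cast hn
  set ρ : ℝ := 1 - 1 / (4 * M) with hρ
  have hρ0 : 0 ≤ ρ := by
    rw [hρ, sub_nonneg, div_le_one (by positivity)]; linarith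
  have hρ1 : ρ < 1 := by
    rw [hρ]; have : (0:ℝ) < 1 / (4 * M) := by positivity
    linarith
  have hd : ∀ v, ((univ.filter (fun w => l v ≠ l w)).card : ℝ) ≤ ρ * (n - 2) := by
    intro v
    have h1 : (univ.filter (fun w => l w = l v)).card + (univ.filter (fun w => l v ≠ l w)).card = n := by
      rw [hndef, ← card_univ, ← card_filter_add_card_filter_not (s := univ) (fun w => l w = l v)]
      congr 3
      ext w
      exact ne_comm
    have h1' : ((univ.filter (fun w => l w = l v)).card : ℝ) +
      (univ.filter (fun w => l v ≠ l w)).card = n := by exact_mod_cast h1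
    have h2 : (n : ℝ) ≤ 2 * M * (univ.filter (fun x => l x = l v)).card := by exact_mod_cast hl v
    have h3 : (n : ℝ) / (2 * M) ≤ (univ.filter (fun x => l x = l v)).card := by
      rw [div_le_iff₀ (by positivity)]; linarith
    have h4 : (2:ℝ) ≤ n / (4 * M) := by
      rw [le_div_iff₀ (by positivity)]; linarith
    have h5 : (n : ℝ) / (2 * M) = 2 * (n / (4 * M)) := by field_simp; norm_num
    have h6 : ρ * (n - 2) = n - n / (4 * M) - 2 * ρ := by rw [hρ]; field_simp
    rw [h6]
    linarith
  have hn2 : (0:ℝ) < (n:ℝ) - 2 := by linarith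
  have hcast : ((n - 2 : ℕ) : ℝ) = (n:ℝ) - 2 := by
    rw [Nat.cast_sub (by omega)]; norm_num
  have step : ∀ a b, ∑ g ∈ G, ((Zset l a b (fun v => g v i.castSucc)).card : ℝ) ≤
      n * ρ ^ (a + b) * G.card := by
    intro a b
    set X := univ.filter (fun z : Fin (a + b + 1) → V =>
      ∀ j : Fin (a + b), l (z j.castSucc) ≠ l (z j.succ)) with hX
    have e1 : ∀ g : V → Fin (k + 1) → V, ((Zset l a b (fun v => g v i.castSucc)).card : ℝ) =
        ∑ z ∈ X, if z ∈ Zset l a b (fun v => g v i.castSucc) then (1:ℝ) else 0 := by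
      intro g
      rw [sum_boole, filter_mem_eq_inter]
      congr 2
      symm
      rw [inter_eq_right]
      intro z hz
      simp only [Zset, mem_filter] at hz
      rw [hX, mem_filter]
      exact ⟨mem_univ _, hz.2.2.1⟩
    rw [sum_congr rfl (fun g _ => e1 g), sum_comm]
    have e2 : ∀ z ∈ X, (∑ g ∈ G, if z ∈ Zset l a b (fun v => g v i.castSucc) then (1:ℝ) else 0) ≤
        G.card / ((n:ℝ) - 2) ^ (a + b) := by
      intro z _
      rw [sum_boole, le_div_iff₀ (by positivity), mul_comm, ← hcast]
      exact_mod_cast Z_count k i h l a b z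
    refine (sum_le_sum e2).trans ?_
    rw [sum_const, nsmul_eq_mul]
    have e3 := cross_count l _ hd (a + b)
    calc (X.card : ℝ) * (G.card / ((n:ℝ) - 2) ^ (a + b))
        ≤ (n * (ρ * (n - 2)) ^ (a + b)) * (G.card / ((n:ℝ) - 2) ^ (a + b)) :=
          mul_le_mul_of_nonneg_right e3 (by positivity)
      _ = n * ρ ^ (a + b) * G.card := by
          rw [mul_pow]; field_simp
  have geo : ∑ a ∈ range n, ρ ^ a ≤ 4 * M := by
    have h1 : ∑ a ∈ range n, ρ ^ a ≤ (1 - ρ)⁻¹ := by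
      rw [← tsum_geometric_of_lt_one hρ0 hρ1]
      exact (summable_geometric_of_lt_one hρ0 hρ1).sum_le_tsum _ (fun _ _ => by positivity)
    have h2 : (1 - ρ)⁻¹ = 4 * M := by rw [hρ]; simp
    linarith
  have geo0 : 0 ≤ ∑ a ∈ range n, ρ ^ a := sum_nonneg (fun _ _ => by positivity)
  calc ∑ g ∈ G, ((∑ x, (comp (crossG (fun v => g v i.castSucc) l) x).card : ℕ) : ℝ)
      ≤ ∑ g ∈ G, ∑ a ∈ range n, ∑ b ∈ range n, ((Zset l a b (fun v => g v i.castSucc)).card : ℝ) := by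
        refine sum_le_sum (fun g _ => ?_)
        exact_mod_cast pairs_le l (fun v => g v i.castSucc)
    _ = ∑ a ∈ range n, ∑ b ∈ range n, ∑ g ∈ G, ((Zset l a b (fun v => g v i.castSucc)).card : ℝ) := by
        rw [sum_comm]
        refine sum_congr rfl (fun a _ => ?_)
        rw [sum_comm]
    _ ≤ ∑ a ∈ range n, ∑ b ∈ range n, n * ρ ^ (a + b) * G.card :=
        sum_le_sum (fun a _ => sum_le_sum (fun b _ => step a b))
    _ = n * G.card * ((∑ a ∈ range n, ρ ^ a) * (∑ b ∈ range n, ρ ^ b)) := by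
        rw [sum_mul_sum, mul_sum]
        refine sum_congr rfl (fun a _ => ?_)
        rw [mul_sum]
        refine sum_congr rfl (fun b _ => ?_)
        rw [pow_add]; ring
    _ ≤ n * G.card * ((4 * M) * (4 * M)) := by
        gcongr
    _ = _ := by ring

theorem fiber_bad {V L : Type*} [Fintype V] [DecidableEq V] [DecidableEq L] (k : ℕ) (i : Fin k)
    (h : V → V) (l : V → L) (M : ℕ) (hM : 0 < M) (hn : 8 * M ≤ Fintype.card V)
    (hl : ∀ j, Fintype.card V ≤ 2 * M * (univ.filter (fun x => l x = l j)).card) (s : ℝ)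
    (hs : 0 ≤ s) (P : (V → Fin (k + 1) → V) → Prop) [DecidablePred P]
    (hP : ∀ g, P g → ∃ x, s < (comp (crossG (fun v => g v i.castSucc) l) x).card) :
    (((Fintype.piFinset (fun v => OmL k v (h v))).filter P).card : ℝ) * s ^ 2 ≤
      (Fintype.card V * (16 * M ^ 2)) * (Fintype.piFinset (fun v => OmL k v (h v))).card := by
  refine le_trans ?_ (pairs_count k i h l M hM hn hl)
  rw [← nsmul_eq_mul, ← sum_const]
  refine le_trans ?_ (sum_le_sum_of_subset_of_nonneg (filter_subset P _) (fun _ _ _ => Nat.cast_nonneg _))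
  refine sum_le_sum (fun g hg => ?_)
  obtain ⟨x, hx⟩ := hP g (mem_filter.1 hg).2
  set H := crossG (fun v => g v i.castSucc) l
  have h1 : (comp H x).card * (comp H x).card ≤ ∑ y, (comp H y).card := by
    calc (comp H x).card * (comp H x).card = ∑ y ∈ comp H x, (comp H y).card := by
          rw [sum_congr rfl (g := fun _ => (comp H x).card)]
          · simp
          · intro y hy; rw [comp_eq (mem_comp.1 hy)]
      _ ≤ _ := sum_le_sum_of_subset (subset_univ _)
  have h2 : ((comp H x).card : ℝ) * (comp H x).card ≤ ((∑ y, (comp H y).card : ℕ) : ℝ) := by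
    exact_mod_cast h1
  nlinarith

/-- bad event 2 -/
theorem bad2 {V L : Type*} [Fintype V] [DecidableEq V] [DecidableEq L] (k : ℕ)
    (lf : (V → V) → V → L) (M : ℕ) (hM : 0 < M) (hn : 8 * M ≤ Fintype.card V)
    (hl : ∀ h j, Fintype.card V ≤ 2 * M * (univ.filter (fun x => lf h x = lf h j)).card) (s : ℝ)
    (hs : 0 ≤ s) (i : Fin k) (P : (V → Fin (k + 1) → V) → Prop) [DecidablePred P]
    (hP : ∀ g, P g → ∃ x, s < (comp (crossG (fun v => g v i.castSucc)
      (lf (fun v => g v (Fin.last k)))) x).card) :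
    (((Fintype.piFinset (fun v : V => Om k v)).filter P).card : ℝ) * s ^ 2 ≤
      (Fintype.card V * (16 * M ^ 2)) * (Fintype.piFinset (fun v : V => Om k v)).card := by
  classical
  let lastf : (V → Fin (k + 1) → V) → (V → V) := fun g v => g v (Fin.last k)
  have hfib : ∀ h : V → V, (Fintype.piFinset (fun v : V => Om k v)).filter (fun g => lastf g = h) =
      Fintype.piFinset (fun v => OmL k v (h v)) := by
    intro h
    ext g
    simp only [mem_filter, Fintype.mem_piFinset, mem_OmL, lastf, funext_iff]
    exact ⟨fun h v => ⟨h.1 v, h.2 v⟩, fun h => ⟨fun v => (h v).1, fun v => (h v).2⟩⟩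
  rw [card_eq_sum_card_fiberwise (f := lastf) (t := univ) (fun _ _ => mem_univ _),
    card_eq_sum_card_fiberwise (s := Fintype.piFinset (fun v : V => Om k v))
      (f := lastf) (t := univ) (fun _ _ => mem_univ _)]
  push_cast
  rw [sum_mul, mul_sum]
  refine sum_le_sum (fun h _ => ?_)
  rw [filter_filter]
  have h1 := fiber_bad k i h (lf h) M hM hn (hl h) s hs (fun g => P g ∧ lastf g = h) (by
    rintro g ⟨h1, h2⟩
    have := hP g h1
    change lastf g = h at h2
    have h3 : (fun v => g v (Fin.last k)) = h := h2
    rwa [h3] at this)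
  rw [hfib]
  have e : (Fintype.piFinset (fun v : V => Om k v)).filter (fun g => P g ∧ lastf g = h) =
      (Fintype.piFinset (fun v => OmL k v (h v))).filter (fun g => P g ∧ lastf g = h) := by
    rw [← hfib, filter_filter]
    refine filter_congr (fun g _ => by tauto)
  rw [e]
  exact h1

/-- bad event 1 : large in-degree -/
theorem bad1 {V : Type*} [Fintype V] [DecidableEq V] (k : ℕ) (hn : 2 ≤ Fintype.card V) (d : ℕ)
    (P : (V → Fin (k + 1) → V) → Prop) [DecidablePred P]
    (hP : ∀ g, P g → ∃ w, d + 2 < (univ.filter (fun x => g x (Fin.last k) = w)).card) :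
    (((Fintype.piFinset (fun v : V => Om k v)).filter P).card : ℝ) * ((d:ℝ) + 1) ^ 3 ≤
      (8 * Fintype.card V) * (Fintype.piFinset (fun v : V => Om k v)).card := by
  classical
  set n := Fintype.card V with hndef
  set G := Fintype.piFinset (fun v : V => Om k v) with hG
  let A : (V → Fin (k + 1) → V) → (Fin 3 ↪ V) → V → Prop := fun g z w => ∀ j, g (z j) (Fin.last k) = w
  have h1 : ∀ g, P g → (d + 1) ^ 3 ≤ ∑ w, ∑ z, if A g z w then 1 else 0 := by
    intro g hg
    obtain ⟨w, hw⟩ := hP g hg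
    refine le_trans ?_ (single_le_sum (f := fun w => ∑ z, if A g z w then 1 else 0)
      (fun _ _ => Nat.zero_le _) (mem_univ w))
    rw [sum_boole, Nat.cast_id]
    set F := univ.filter (fun x => g x (Fin.last k) = w) with hF
    have h2 : Fintype.card (Fin 3 ↪ F) ≤ (univ.filter (fun z => A g z w)).card := by
      rw [← card_univ]
      refine card_le_card_of_injOn (fun z => z.trans (Function.Embedding.subtype _)) ?_ ?_
      · intro z _
        rw [mem_coe, mem_filter]
        refine ⟨mem_univ _, fun j => ?_⟩
        exact (mem_filter.1 (z j).2).2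
      · intro z _ z' _ hzz
        ext j
        have := DFunLike.congr_fun hzz j
        simpa using this
    rw [Fintype.card_embedding_eq, Fintype.card_coe, Fintype.card_fin] at h2
    refine le_trans ?_ h2
    refine le_trans ?_ (Nat.pow_sub_le_descFactorial _ _)
    exact Nat.pow_le_pow_left (by omega) 3
  have h2 : ∀ (z : Fin 3 ↪ V) (w : V), ((G.filter (fun g => A g z w)).card : ℝ) ≤
      G.card / ((n:ℝ) - 1) ^ 3 := by
    intro z w
    have hn2 : (2:ℝ) ≤ n := by exact_mod_cast hn
    have hn1 : (0:ℝ) < (n:ℝ) - 1 := by linarith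
    have := pi_count (fun v : V => Om k v) (fun v t => OmL k v t) (n - 1)
      (fun v t => Om_count k v t) z z.injective (fun _ => w)
    have hcast : ((n - 1 : ℕ) : ℝ) = (n:ℝ) - 1 := by
      rw [Nat.cast_sub (by omega)]; norm_num
    rw [le_div_iff₀ (by positivity), ← hcast, mul_comm]
    have e : G.filter (fun g => A g z w) = G.filter (fun g => ∀ j, g (z j) ∈ OmL k (z j) w) := by
      refine filter_congr (fun g hg => ?_)
      have hg := Fintype.mem_piFinset.1 hg
      simp only [A, mem_OmL]
      exact ⟨fun h j => ⟨hg _, h j⟩, fun h j => (h j).2⟩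
    rw [e]
    exact_mod_cast this
  have h3 : (Fintype.card (Fin 3 ↪ V) : ℝ) ≤ n ^ 3 := by
    rw [Fintype.card_embedding_eq, Fintype.card_fin]
    exact_mod_cast Nat.descFactorial_le_pow _ _
  have hn2 : (2:ℝ) ≤ n := by exact_mod_cast hn
  calc ((G.filter P).card : ℝ) * ((d:ℝ) + 1) ^ 3 = ∑ g ∈ G.filter P, ((d:ℝ) + 1) ^ 3 := by simp
    _ ≤ ∑ g ∈ G.filter P, ((∑ w, ∑ z, if A g z w then 1 else 0 : ℕ) : ℝ) :=
        sum_le_sum (fun g hg => by exact_mod_cast h1 g (mem_filter.1 hg).2)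
    _ ≤ ∑ g ∈ G, ((∑ w, ∑ z, if A g z w then 1 else 0 : ℕ) : ℝ) :=
        sum_le_sum_of_subset_of_nonneg (filter_subset P _) (fun _ _ _ => Nat.cast_nonneg _)
    _ = ∑ w, ∑ z, ((G.filter (fun g => A g z w)).card : ℝ) := by
        push_cast
        rw [sum_comm]
        refine sum_congr rfl (fun w _ => ?_)
        rw [sum_comm]
        refine sum_congr rfl (fun z _ => ?_)
        rw [sum_boole]
    _ ≤ ∑ w : V, ∑ z : Fin 3 ↪ V, G.card / ((n:ℝ) - 1) ^ 3 :=
        sum_le_sum (fun w _ => sum_le_sum (fun z _ => h2 z w))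
    _ = n * (Fintype.card (Fin 3 ↪ V) * (G.card / ((n:ℝ) - 1) ^ 3)) := by
        simp [hndef]
    _ ≤ n * (n ^ 3 * (G.card / ((n:ℝ) - 1) ^ 3)) := by
        have : (0:ℝ) ≤ G.card / ((n:ℝ) - 1) ^ 3 := by
          have : (0:ℝ) ≤ (n:ℝ) - 1 := by linarith
          positivity
        gcongr
    _ ≤ n * (8 * G.card) := by
        have h5 : (n:ℝ) ^ 3 ≤ 8 * ((n:ℝ) - 1) ^ 3 := by
          have : (n:ℝ) ≤ 2 * ((n:ℝ) - 1) := by linarith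
          calc (n:ℝ) ^ 3 ≤ (2 * ((n:ℝ) - 1)) ^ 3 := by gcongr
            _ = _ := by ring
        have h6 : (0:ℝ) < ((n:ℝ) - 1) ^ 3 := by
          have : (0:ℝ) < (n:ℝ) - 1 := by linarith
          positivity
        refine mul_le_mul_of_nonneg_left ?_ (by positivity)
        rw [← mul_div_assoc, div_le_iff₀ h6]
        nlinarith [Nat.cast_nonneg (α := ℝ) G.card]
    _ = _ := by ring

end KOut
namespace KOut

open Finset Relation

set_option maxHeartbeats 4000000 in
theorem main_g (k : ℕ) (hk : 0 < k) (ε : ℝ) (hε : 0 < ε) (η : ℝ) (hη : 0 < η) :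
    ∃ N₀ : ℕ, ∀ n : ℕ, N₀ ≤ n → ∀ (P : (Fin n → Fin (k + 1) → Fin n) → Prop) [DecidablePred P],
      (∀ g, P g → ¬ ∃ c : Sym2 (Fin n) → Fin (k + 1), ∀ j v,
        ((comp (SimpleGraph.fromRel (fun u w => w ∈ univ.image (g u) ∧ c s(u, w) = j)) v).card : ℝ)
          ≤ ε * n) →
      (((Fintype.piFinset (fun v : Fin n => Om k v)).filter P).card : ℝ) ≤
        η * (Fintype.piFinset (fun v : Fin n => Om k v)).card := by
  classical
  obtain ⟨M, hMε⟩ := exists_nat_ge (2 / ε + 1)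
  have h2ε : 0 < 2 / ε := by positivity
  have hM1 : (1:ℝ) ≤ M := by linarith
  have hM : 0 < M := by exact_mod_cast (by linarith : (0:ℝ) < M)
  have hMε' : 2 ≤ ε * M := by
    have : 2 / ε ≤ M := by linarith
    rw [div_le_iff₀ hε] at this; linarith
  have hkR : (0:ℝ) < k := by exact_mod_cast hk
  set L : ℝ := 32 * k * M ^ 2 / η + 1 with hL
  have hL1 : 1 ≤ L := by
    have : 0 ≤ 32 * k * (M:ℝ) ^ 2 / η := by positivity
    linarith
  have hLη : 32 * k * (M:ℝ) ^ 2 ≤ η * L ^ 2 := by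
    have h1 : 32 * k * (M:ℝ) ^ 2 / η ≤ L ^ 2 := by nlinarith
    rw [div_le_iff₀ hη] at h1; linarith
  set δ : ℝ := ε / (32 * M ^ 2 * L) with hδ
  have hδ0 : 0 < δ := by positivity
  have hδL : 16 * M ^ 2 * δ * L = ε / 2 := by rw [hδ]; field_simp; norm_num
  set R : ℝ := 8 * M + 2 + 16 / (δ ^ 3 * η) + 2 * L * (1 + 64 * M ^ 2) / ε with hR
  have hR1 : 0 ≤ 16 / (δ ^ 3 * η) := by positivity
  have hR2 : 0 ≤ 2 * L * (1 + 64 * (M:ℝ) ^ 2) / ε := by positivity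
  refine ⟨⌈R ^ 2⌉₊, fun n hn P _ hP => ?_⟩
  have hnR : R ^ 2 ≤ n := (Nat.le_ceil _).trans (by exact_mod_cast hn)
  set q : ℝ := Real.sqrt n with hq
  have hqR : R ≤ q := Real.le_sqrt_of_sq_le hnR
  have hqn : q ^ 2 = n := Real.sq_sqrt (Nat.cast_nonneg _)
  have hq1 : 1 ≤ q := by linarith
  have hqn' : q ≤ n := by nlinarith
  have hn8 : 8 * M ≤ n := by
    have : (8:ℝ) * M ≤ n := by linarith
    exact_mod_cast this
  have hn2 : 2 ≤ n := by
    have : (2:ℝ) ≤ n := by linarith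
    exact_mod_cast this
  have hqδ : 16 ≤ q * (δ ^ 3 * η) := by
    have : 16 / (δ ^ 3 * η) ≤ q := by linarith
    rwa [div_le_iff₀ (by positivity)] at this
  have hqL : 2 * L * (1 + 64 * M ^ 2) ≤ q * ε := by
    have : 2 * L * (1 + 64 * (M:ℝ) ^ 2) / ε ≤ q := by linarith
    rwa [div_le_iff₀ (by positivity)] at this
  set d : ℕ := ⌊δ * q⌋₊ with hd
  have hd1 : (d:ℝ) ≤ δ * q := Nat.floor_le (by positivity)
  have hd2 : δ * q < d + 1 := Nat.lt_floor_add_one _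
  have hcV : Fintype.card (Fin n) = n := Fintype.card_fin n
  have part := fun h : Fin n → Fin n => partition h M hM (by rw [hcV]; omega)
  choose B lf hB hlB hlc using part
  set G := Fintype.piFinset (fun v : Fin n => Om k v) with hG
  let P1 : (Fin n → Fin (k + 1) → Fin n) → Prop :=
    fun g => ∃ w, d + 2 < (univ.filter (fun x => g x (Fin.last k) = w)).card
  let P2 : Fin k → (Fin n → Fin (k + 1) → Fin n) → Prop :=
    fun i g => ∃ x, L * q < (comp (crossG (fun v => g v i.castSucc)
      (lf (fun v => g v (Fin.last k)))) x).card
  have hb1 := bad1 k (by rw [hcV]; exact hn2) d P1 (fun g h => h)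
  have hb2 : ∀ i, _ := fun i => bad2 k lf M hM (by rw [hcV]; exact hn8)
    (fun h j => (hlc h _).1) (L * q) (by positivity) i (P2 i) (fun g h => h)
  rw [hcV, ← hG, ← hqn] at hb1
  simp only [hcV, ← hG, ← hqn] at hb2
  have hG0 : (0:ℝ) ≤ G.card := Nat.cast_nonneg _
  have c1 : ((G.filter P1).card : ℝ) ≤ η / 2 * G.card := by
    set x : ℝ := ((G.filter P1).card : ℝ) with hx
    have hx0 : 0 ≤ x := Nat.cast_nonneg _
    have e1 : (δ * q) ^ 3 ≤ ((d:ℝ) + 1) ^ 3 := by gcongr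
    have e2 : x * (δ * q) ^ 3 ≤ 8 * q ^ 2 * G.card := (mul_le_mul_of_nonneg_left e1 hx0).trans hb1
    have e3 : q ^ 2 * (x * (δ ^ 3 * q)) ≤ q ^ 2 * (8 * G.card) := by nlinarith
    have e4 := le_of_mul_le_mul_left e3 (by positivity)
    have e5 : x * 16 ≤ x * (q * (δ ^ 3 * η)) := mul_le_mul_of_nonneg_left hqδ hx0
    have e6 : η * (x * (δ ^ 3 * q)) ≤ η * (8 * G.card) := mul_le_mul_of_nonneg_left e4 hη.le
    nlinarith
  have c2 : ∀ i, k * ((G.filter (P2 i)).card : ℝ) ≤ η / 2 * G.card := by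
    intro i
    have e0 := hb2 i
    set x : ℝ := ((G.filter (P2 i)).card : ℝ) with hx
    have hx0 : 0 ≤ x := Nat.cast_nonneg _
    have e3 : q ^ 2 * (x * L ^ 2) ≤ q ^ 2 * (16 * M ^ 2 * G.card) := by nlinarith
    have e4 := le_of_mul_le_mul_left e3 (by positivity)
    have e5 : x * (32 * k * (M:ℝ) ^ 2) ≤ x * (η * L ^ 2) := mul_le_mul_of_nonneg_left hLη hx0
    have e6 : η * (x * L ^ 2) ≤ η * (16 * M ^ 2 * G.card) := mul_le_mul_of_nonneg_left e4 hη.le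
    have e7 : (M:ℝ) ^ 2 * (k * x) ≤ (M:ℝ) ^ 2 * (η / 2 * G.card) := by nlinarith
    exact le_of_mul_le_mul_left e7 (by positivity)
  have hsub : G.filter P ⊆ G.filter P1 ∪ univ.biUnion (fun i => G.filter (P2 i)) := by
    intro g hg
    rw [mem_filter] at hg
    by_contra hcon
    rw [mem_union, mem_biUnion, mem_filter] at hcon
    push Not at hcon
    have n1 := hcon.1 hg.1
    have n2 : ∀ i, ¬ P2 i g := fun i h => hcon.2 i (mem_univ _) (mem_filter.2 ⟨hg.1, h⟩)
    simp only [P1, not_exists, not_lt] at n1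
    simp only [P2, not_exists, not_lt] at n2
    apply hP g hg.2
    set h : Fin n → Fin n := fun v => g v (Fin.last k) with hh
    let Q : Finset (Fin n) := (B h ∪ (B h).image h) ∪
      (B h).biUnion (fun w => univ.filter (fun x => h x = w))
    have hQc : Q.card ≤ (B h).card + (B h).card + (B h).card * (d + 2) := by
      refine (card_union_le _ _).trans (Nat.add_le_add ((card_union_le _ _).trans
        (Nat.add_le_add_left card_image_le _)) ?_)
      exact card_biUnion_le_card_mul _ _ _ (fun w _ => n1 w)
    refine coloring k ⟨0, hk⟩ g (lf h) Q ?_ (ε * n) (L * q) ?_ n2 ?_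
    · intro x hx
      change lf h x ≠ lf h (h x) at hx
      change x ∈ Q ∧ h x ∈ Q
      by_cases hxB : x ∈ B h
      · exact ⟨mem_union_left _ (mem_union_left _ hxB),
          mem_union_left _ (mem_union_right _ (mem_image_of_mem _ hxB))⟩
      · have hxB2 : h x ∈ B h := by
          by_contra hc
          exact hx (hlB h x hxB hc)
        exact ⟨mem_union_right _ (mem_biUnion.2 ⟨h x, hxB2, by simp⟩),
          mem_union_left _ (mem_union_left _ hxB2)⟩
    · intro j
      have := (hlc h j).2
      rw [hcV] at this
      have this : 2 * (M:ℝ) * ((univ.filter (fun x => lf h x = j)).card : ℝ) ≤ 3 * n := by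
        exact_mod_cast this
      have h3 : 2 * (M:ℝ) * ((univ.filter (fun x => lf h x = j)).card : ℝ) ≤ 2 * M * (ε * n) := by
        have : (0:ℝ) ≤ n := Nat.cast_nonneg _
        nlinarith
      exact le_of_mul_le_mul_left h3 (by positivity)
    · have hQ1 : (Q.card : ℝ) ≤ (B h).card * (d + 4) := by
        have : Q.card ≤ (B h).card * (d + 4) := by rw [show d + 4 = 1 + 1 + (d + 2) by ring]; linarith
        exact_mod_cast this
      have hB' : ((B h).card : ℝ) ≤ 16 * M ^ 2 := by exact_mod_cast hB h
      have hQ2 : (Q.card : ℝ) ≤ 16 * M ^ 2 * (δ * q + 4) := by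
        refine hQ1.trans ?_
        gcongr
      calc (1 + (Q.card : ℝ)) * (L * q) ≤ (1 + 16 * M ^ 2 * (δ * q + 4)) * (L * q) := by gcongr
        _ = (16 * M ^ 2 * δ * L) * q ^ 2 + L * (1 + 64 * M ^ 2) * q := by ring
        _ ≤ ε / 2 * q ^ 2 + (q * ε / 2) * q := by rw [hδL]; gcongr; linarith
        _ = ε * n := by rw [← hqn]; ring
  have hcard := (card_le_card hsub).trans ((card_union_le _ _).trans
    (Nat.add_le_add_left card_biUnion_le _))
  have hcard' : ((G.filter P).card : ℝ) ≤ (G.filter P1).card + ∑ i, ((G.filter (P2 i)).card : ℝ) := by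
    exact_mod_cast hcard
  have c3 : ∑ i, ((G.filter (P2 i)).card : ℝ) ≤ η / 2 * G.card := by
    have : ∑ i : Fin k, (k:ℝ) * ((G.filter (P2 i)).card : ℝ) ≤ ∑ i : Fin k, η / 2 * G.card :=
      sum_le_sum (fun i _ => c2 i)
    rw [← mul_sum, sum_const, card_univ, Fintype.card_fin, nsmul_eq_mul] at this
    exact le_of_mul_le_mul_left this hkR
  linarith

theorem fiber_card {V : Type*} [Fintype V] [DecidableEq V] (k : ℕ) (v : V) (s : Finset V)
    (hv : v ∉ s) (hs : s.card = k + 1) :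
    ((Om k v).filter (fun e => univ.image e = s)).card = (k + 1).factorial := by
  classical
  have h1 : Fintype.card (Fin (k + 1) ↪ s) = (k + 1).factorial := by
    rw [Fintype.card_embedding_eq, Fintype.card_coe, Fintype.card_fin, hs, Nat.descFactorial_self]
  rw [← h1, ← card_univ]
  symm
  refine card_bij (fun z _ => fun j => (z j : V)) ?_ ?_ ?_
  · intro z _
    have hinj : Function.Injective (fun j => (z j : V)) := Subtype.val_injective.comp z.injective
    rw [mem_filter, mem_Om]
    refine ⟨⟨hinj, fun i hi => hv (hi ▸ (z i).2)⟩, ?_⟩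
    apply eq_of_subset_of_card_le
    · intro x hx
      obtain ⟨j, -, rfl⟩ := mem_image.1 hx
      exact (z j).2
    · rw [card_image_of_injective _ hinj, card_univ, Fintype.card_fin, hs]
  · intro z _ z' _ h
    ext j
    exact congrFun h j
  · intro e he
    rw [mem_filter, mem_Om] at he
    refine ⟨⟨fun j => ⟨e j, he.2 ▸ mem_image_of_mem e (mem_univ j)⟩, ?_⟩, mem_univ _, rfl⟩
    intro a b hab
    exact he.1.1 (congrArg Subtype.val hab)

theorem transfer {V : Type*} [Fintype V] [DecidableEq V] (k : ℕ) (P : (V → Finset V) → Prop)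
    [DecidablePred P] :
    ((Fintype.piFinset (fun v : V => Om k v)).filter (fun g => P (fun v => univ.image (g v)))).card =
    ((univ.filter (fun N : V → Finset V => ∀ v, v ∉ N v ∧ (N v).card = k + 1)).filter P).card *
      (k + 1).factorial ^ Fintype.card V := by
  classical
  let im : (V → Fin (k + 1) → V) → V → Finset V := fun g v => univ.image (g v)
  rw [card_eq_sum_card_fiberwise (f := im)
    (t := (univ.filter (fun N : V → Finset V => ∀ v, v ∉ N v ∧ (N v).card = k + 1)).filter P)]
  · rw [← smul_eq_mul, ← sum_const]
    refine sum_congr rfl (fun N hN => ?_)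
    rw [mem_filter, mem_filter] at hN
    have e : ((Fintype.piFinset (fun v : V => Om k v)).filter
        (fun g => P (fun v => univ.image (g v)))).filter (fun g => im g = N) =
        Fintype.piFinset (fun v => (Om k v).filter (fun e => univ.image e = N v)) := by
      ext g
      simp only [mem_filter, Fintype.mem_piFinset, im]
      constructor
      · rintro ⟨⟨h1, h2⟩, h3⟩ v
        exact ⟨h1 v, congrFun h3 v⟩
      · intro h
        have h3 : (fun v => univ.image (g v)) = N := funext (fun v => (h v).2)
        exact ⟨⟨fun v => (h v).1, by rw [h3]; exact hN.2⟩, h3⟩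
    rw [e, Fintype.card_piFinset, prod_congr rfl
      (fun v _ => fiber_card k v (N v) (hN.1.2 v).1 (hN.1.2 v).2), prod_const, card_univ]
  · intro g hg
    rw [mem_coe, mem_filter, Fintype.mem_piFinset] at hg
    rw [mem_coe, mem_filter, mem_filter]
    refine ⟨⟨mem_univ _, fun v => ?_⟩, hg.2⟩
    have := mem_Om.1 (hg.1 v)
    refine ⟨fun h => ?_, ?_⟩
    · obtain ⟨j, -, hj⟩ := mem_image.1 h
      exact this.2 j hj
    · simp only [im]
      rw [card_image_of_injective _ this.1, card_univ, Fintype.card_fin]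

theorem supp_comp {V : Type*} [Fintype V] (G : SimpleGraph V) (v : V) :
    (G.connectedComponentMk v).supp.ncard = (comp G v).card := by
  have : (G.connectedComponentMk v).supp = (comp G v : Set V) := by
    ext w
    rw [SimpleGraph.ConnectedComponent.mem_supp_iff, SimpleGraph.ConnectedComponent.eq, mem_coe,
      mem_comp]
    exact SimpleGraph.reachable_comm
  rw [this, Set.ncard_coe_finset]

end KOut

/-- Fix an integer `r ≥ 2`. For every `ε > 0`, with high probability as `n → ∞`
there exists an `r`-edge-coloring of the random `r`-out graph `G_{n,r-out}` such that every
monochromatic component has at most `ε·n` vertices.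

The random `r`-out graph is modelled by a uniformly random choice function
`N : Fin n → Finset (Fin n)` with `v ∉ N v` and `(N v).card = r` for all `v`; the associated
simple graph is `SimpleGraph.fromRel (fun u w => w ∈ N u)` (joining `v` to each of its chosen
out-neighbors, ignoring orientation).  "With high probability" is expressed by counting:
for every `p < 1`, for all sufficiently large `n` (with `r ≤ n - 1`), the number of choice
functions admitting such a coloring is at least `p` times the total number of choice
functions. -/
theorem stmt_2 (r : ℕ) (hr : 2 ≤ r) (ε : ℝ) (hε : 0 < ε) :
    ∀ p : ℝ, p < 1 → ∃ N₀ : ℕ, ∀ n : ℕ, N₀ ≤ n → r + 1 ≤ n →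
      p * (Nat.card {N : Fin n → Finset (Fin n) //
              ∀ v : Fin n, v ∉ N v ∧ (N v).card = r} : ℝ) ≤
      (Nat.card {N : Fin n → Finset (Fin n) //
          (∀ v : Fin n, v ∉ N v ∧ (N v).card = r) ∧
          ∃ c : Sym2 (Fin n) → Fin r, ∀ (j : Fin r) (v : Fin n),
            ((((SimpleGraph.fromRel
                (fun u w => w ∈ N u ∧ c s(u, w) = j)).connectedComponentMk v).supp.ncard : ℝ))
              ≤ ε * n} : ℝ) := by
  classical
  intro p hp
  obtain ⟨k, rfl⟩ : ∃ k, r = k + 1 := ⟨r - 1, by omega⟩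
  obtain ⟨N₀, hN₀⟩ := KOut.main_g k (by omega) ε hε (1 - p) (by linarith)
  refine ⟨N₀, fun n hn _ => ?_⟩
  let A : (Fin n → Finset (Fin n)) → Prop := fun N => ∀ v : Fin n, v ∉ N v ∧ (N v).card = k + 1
  let Gd : (Fin n → Finset (Fin n)) → Prop := fun N =>
    ∃ c : Sym2 (Fin n) → Fin (k + 1), ∀ (j : Fin (k + 1)) (v : Fin n),
            ((((SimpleGraph.fromRel
                (fun u w => w ∈ N u ∧ c s(u, w) = j)).connectedComponentMk v).supp.ncard : ℝ))
              ≤ ε * n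
  have e1 : Nat.card {N : Fin n → Finset (Fin n) //
      ∀ v : Fin n, v ∉ N v ∧ (N v).card = k + 1} = (Finset.univ.filter A).card := by
    rw [Nat.card_eq_fintype_card, Fintype.card_subtype]
  have e2 : Nat.card {N : Fin n → Finset (Fin n) // A N ∧ Gd N} =
      ((Finset.univ.filter A).filter Gd).card := by
    rw [Nat.card_eq_fintype_card, Fintype.card_subtype, Finset.filter_filter]
  change p * _ ≤ ((Nat.card {N : Fin n → Finset (Fin n) // A N ∧ Gd N} : ℕ) : ℝ)
  rw [e1, e2]
  have t1 := KOut.transfer (V := Fin n) k (fun N => ¬ Gd N)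
  have t2 := KOut.transfer (V := Fin n) k (fun _ => True)
  rw [Finset.filter_true, Finset.filter_true] at t2
  have hb := hN₀ n hn (fun g => ¬ Gd (fun v => Finset.univ.image (g v))) (by
    intro g hg
    simpa only [Gd, KOut.supp_comp] using hg)
  rw [t1, t2] at hb
  push_cast at hb
  have hf : (0:ℝ) < ((k + 1).factorial : ℝ) ^ Fintype.card (Fin n) := by positivity
  rw [← mul_assoc] at hb
  have hb' := le_of_mul_le_mul_right hb hf
  have hs := Finset.card_filter_add_card_filter_not (s := Finset.univ.filter A) Gd
  have hs' : (((Finset.univ.filter A).filter Gd).card : ℝ) +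
    ((Finset.univ.filter A).filter (fun N => ¬ Gd N)).card = (Finset.univ.filter A).card := by
    exact_mod_cast hs
  have hb2 : (((Finset.univ.filter A).filter (fun N => ¬ Gd N)).card : ℝ) ≤
    (1 - p) * ((Finset.univ.filter A).card : ℝ) := by
    convert hb' <;> rfl
  linarith
end

section
/- Fix an integer r ≥ 2. There exists a constant γ > 0 such that, with high probability as n → ∞, every r-edge-coloring of the random (r+1)-out graph G_{n,(r+1)-out} contains a monochromatic cycle of length at least γn. -/
section KOut
open Finset

/-- Closed under adjacency inside `C`. -/
def KOutCl {V : Type*} (H : SimpleGraph V) (A C : Finset V) : Prop :=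
  A ⊆ C ∧ ∀ a ∈ A, ∀ b ∈ C, H.Adj a b → b ∈ A

lemma kout_step {V : Type*} [DecidableEq V] (H : SimpleGraph V) (k : ℕ)
    (C : Finset V) (hC : k ≤ 2 * C.card) :
    ∃ W, KOutCl H W C ∧ k ≤ 2 * W.card ∧
      (W.card ≤ k ∨ ∀ A : Finset V, A.Nonempty → KOutCl H A W → A = W) := by
  classical
  obtain ⟨W, hW, hmin⟩ := Finset.exists_min_image
    (C.powerset.filter (fun W => KOutCl H W C ∧ k ≤ 2 * W.card)) Finset.card
    ⟨C, by simp only [mem_filter, mem_powerset]; exact ⟨subset_rfl, ⟨subset_rfl, fun _ _ b hb _ => hb⟩, hC⟩⟩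
  simp only [mem_filter, mem_powerset] at hW hmin
  obtain ⟨hWC, hcl, hk⟩ := hW
  refine ⟨W, hcl, hk, ?_⟩
  by_cases hWk : W.card ≤ k
  · exact Or.inl hWk
  right
  intro A hA hAW
  by_contra hne
  have hss : A ⊂ W := hAW.1.ssubset_of_ne hne
  have hlt := card_lt_card hss
  have hA0 := hA.card_pos
  have hAC : KOutCl H A C := ⟨hAW.1.trans hWC, fun a ha b hb hab =>
    hAW.2 a ha b (hcl.2 a (hAW.1 ha) b hb hab) hab⟩
  have hBC : KOutCl H (W \ A) C := by
    refine ⟨sdiff_subset.trans hWC, fun a ha b hb hab => ?_⟩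
    rw [mem_sdiff] at ha ⊢
    refine ⟨hcl.2 a ha.1 b hb hab, fun hbA => ha.2 (hAW.2 b hbA a ha.1 hab.symm)⟩
  have hcard : (W \ A).card + A.card = W.card := card_sdiff_add_card_eq_card hAW.1
  by_cases h1 : k ≤ 2 * A.card
  · have := hmin A ⟨hAC.1, hAC, h1⟩
    omega
  · have := hmin (W \ A) ⟨hBC.1, hBC, by omega⟩
    omega

lemma kout_cycle {V : Type*} [DecidableEq V] (H : SimpleGraph V) {t x a b u : V}
    (P : H.Walk t x) (hP : P.IsPath) (Q : H.Walk a b) (hQ : Q.IsPath)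
    (hd : ∀ z ∈ Q.support, z ∉ P.support) (hbt : H.Adj b t) (hu : u ∈ P.support)
    (hua : H.Adj u a) (hut : u ≠ t) :
    ∃ w : H.Walk u u, w.IsCycle ∧ (P.takeUntil u hu).length ≤ w.length := by
  refine ⟨SimpleGraph.Walk.cons hua (Q.append (SimpleGraph.Walk.cons hbt (P.takeUntil u hu))), ?_, ?_⟩
  · rw [SimpleGraph.Walk.cons_isCycle_iff]
    have hsub := P.support_takeUntil_subset_support hu
    constructor
    · rw [SimpleGraph.Walk.isPath_def, SimpleGraph.Walk.support_append, List.nodup_append']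
      refine ⟨hQ.support_nodup, ?_, ?_⟩
      · simpa using (hP.takeUntil hu).support_nodup
      · intro z hz hz'
        simp only [SimpleGraph.Walk.support_cons, List.tail_cons] at hz'
        exact hd z hz (hsub hz')
    · intro he
      rw [SimpleGraph.Walk.edges_append, List.mem_append, SimpleGraph.Walk.edges_cons, List.mem_cons] at he
      rcases he with he | he | he
      · exact hd _ (Q.fst_mem_support_of_mem_edges he) hu
      · rw [Sym2.eq_iff] at he
        rcases he with ⟨h1, _⟩ | ⟨h1, _⟩
        · exact hd b Q.end_mem_support (h1 ▸ hu)
        · exact hut h1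
      · exact hd a Q.start_mem_support (hsub ((P.takeUntil u hu).snd_mem_support_of_mem_edges he))
  · simp only [SimpleGraph.Walk.length_cons, SimpleGraph.Walk.length_append]
    omega

lemma kout_near {V : Type*} [DecidableEq V] (H : SimpleGraph V) (L : ℕ) (hL : 1 ≤ L)
    (hno : ∀ (v : V) (w : H.Walk v v), w.IsCycle → w.length < L)
    {t x : V} (P : H.Walk t x) (hP : P.IsPath) (C : Finset V)
    (hd : ∀ z ∈ C, z ∉ P.support)
    (hadj : ∀ A : Finset V, A.Nonempty → KOutCl H A C → ∃ a ∈ A, H.Adj a t)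
    (a : V) (ha : a ∈ C) (u : V) (hu : u ∈ P.support) (hau : H.Adj a u) :
    u ∈ (Finset.range L).image P.getVert := by
  classical
  rw [mem_image]
  by_cases hut : u = t
  · exact ⟨0, by simp; omega, by simp [hut]⟩
  obtain ⟨b, hb, hbt⟩ := hadj (C.filter (fun z => ∃ p : H.Walk a z, ∀ y ∈ p.support, y ∈ C))
    ⟨a, by simp only [mem_filter]; exact ⟨ha, SimpleGraph.Walk.nil, by simpa using ha⟩⟩ (by
      refine ⟨filter_subset _ _, ?_⟩
      intro c hc d hdC hcd
      simp only [mem_filter] at hc ⊢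
      obtain ⟨_, p, hp⟩ := hc
      refine ⟨hdC, p.concat hcd, ?_⟩
      intro y hy
      rw [SimpleGraph.Walk.support_concat] at hy
      simp at hy
      rcases hy with hy | hy
      · exact hp y hy
      · exact hy ▸ hdC)
  simp only [mem_filter] at hb
  obtain ⟨_, p, hp⟩ := hb
  obtain ⟨w, hw, hlen⟩ := kout_cycle H P hP p.bypass p.bypass_isPath
    (fun z hz => hd z (hp z (p.support_bypass_subset_support hz))) hbt hu hau.symm hut
  refine ⟨(P.takeUntil u hu).length, ?_, P.getVert_length_takeUntil hu⟩
  have := hno u w hw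
  simp; omega

lemma kout_rec {V : Type*} [DecidableEq V] (H : SimpleGraph V) (L k : ℕ) (hL : 1 ≤ L)
    (hno : ∀ (v : V) (w : H.Walk v v), w.IsCycle → w.length < L) (m : ℕ) :
    ∀ (t x : V) (P : H.Walk t x) (_ : P.IsPath) (C : Finset V) (_ : C.card ≤ m)
    (_ : ∀ z ∈ C, z ∉ P.support)
    (_ : ∀ a ∈ C, ∀ b, H.Adj a b → b ∈ C ∨ b ∈ P.support)
    (_ : ∀ A : Finset V, A.Nonempty → KOutCl H A C → ∃ a ∈ A, H.Adj a t)
    (_ : k ≤ 2 * C.card),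
    ∃ W S : Finset V, W ⊆ C ∧ k ≤ 2 * W.card ∧ W.card ≤ k ∧ S.card ≤ L ∧
      ∀ a ∈ W, ∀ b, H.Adj a b → b ∈ W ∨ b ∈ S := by
  induction m with
  | zero =>
    intro t x P hP C hm hd hN hadj hk
    exact ⟨∅, ∅, by simp, by simp at hm ⊢; simpa [hm] using hk, by simp, by simp, by simp⟩
  | succ m ih =>
    intro t x P hP C hm hd hN hadj hk
    obtain ⟨W, hWC, hkW, hW⟩ := kout_step H k C hk
    by_cases hWk : W.card ≤ k
    · refine ⟨W, (Finset.range L).image P.getVert, hWC.1, hkW, hWk,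
        card_image_le.trans (by simp), ?_⟩
      intro a ha b hab
      rcases hN a (hWC.1 ha) b hab with h | h
      · exact Or.inl (hWC.2 a ha b h hab)
      · exact Or.inr (kout_near H L hL hno P hP C hd hadj a (hWC.1 ha) b h hab)
    have hcon := hW.resolve_left hWk
    have hWne : W.Nonempty := card_pos.mp (by omega)
    obtain ⟨v, hv, hvt⟩ := hadj W hWne hWC
    have hcard : (W.erase v).card + 1 = W.card := card_erase_add_one hv
    have hle := card_le_card hWC.1
    obtain ⟨W', S, h1, h2⟩ := ih v x (SimpleGraph.Walk.cons hvt P)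
      (by rw [SimpleGraph.Walk.cons_isPath_iff]; exact ⟨hP, hd v (hWC.1 hv)⟩) (W.erase v) (by omega)
      (by
        intro z hz
        rw [mem_erase] at hz
        rw [SimpleGraph.Walk.support_cons, List.mem_cons]
        rintro (h | h)
        · exact hz.1 h
        · exact hd z (hWC.1 hz.2) h)
      (by
        intro a ha b hab
        rw [mem_erase] at ha
        rw [SimpleGraph.Walk.support_cons, List.mem_cons, mem_erase]
        by_cases hbv : b = v
        · exact Or.inr (Or.inl hbv)
        rcases hN a (hWC.1 ha.2) b hab with h | h
        · exact Or.inl ⟨hbv, hWC.2 a ha.2 b h hab⟩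
        · exact Or.inr (Or.inr h))
      (by
        intro A hA hAW
        by_contra hcontra
        push Not at hcontra
        have : A = W := hcon A hA ⟨hAW.1.trans (erase_subset _ _), fun a ha b hb hab => by
          by_cases hbv : b = v
          · exact absurd (hbv ▸ hab) (hcontra a ha)
          · exact hAW.2 a ha b (mem_erase.mpr ⟨hbv, hb⟩) hab⟩
        exact notMem_erase v W (hAW.1 (this ▸ hv)))
      (by omega)
    exact ⟨W', S, h1.trans ((erase_subset _ _).trans hWC.1), h2⟩

lemma kout_sep {V : Type*} [DecidableEq V] (H : SimpleGraph V) (L k : ℕ) (hL : 1 ≤ L)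
    (hno : ∀ (v : V) (w : H.Walk v v), w.IsCycle → w.length < L) (U : Finset V)
    (hU : ∀ a ∈ U, ∀ b, H.Adj a b → b ∈ U) (hk : k ≤ 2 * U.card) :
    ∃ W S : Finset V, W ⊆ U ∧ k ≤ 2 * W.card ∧ W.card ≤ k ∧ S.card ≤ L ∧
      ∀ a ∈ W, ∀ b, H.Adj a b → b ∈ W ∨ b ∈ S := by
  obtain ⟨W, hWC, hkW, hW⟩ := kout_step H k U hk
  by_cases hWk : W.card ≤ k
  · exact ⟨W, ∅, hWC.1, hkW, hWk, by simp, fun a ha b hab =>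
      Or.inl (hWC.2 a ha b (hU a (hWC.1 ha) b hab) hab)⟩
  have hcon := hW.resolve_left hWk
  have hWne : W.Nonempty := card_pos.mp (by omega)
  obtain ⟨v, hv⟩ := hWne
  have hcard : (W.erase v).card + 1 = W.card := card_erase_add_one hv
  obtain ⟨W', S, h1, h2⟩ := kout_rec H L k hL hno _ v v SimpleGraph.Walk.nil
    SimpleGraph.Walk.IsPath.nil (W.erase v) le_rfl
    (by intro z hz; rw [mem_erase] at hz; simpa using hz.1)
    (by
      intro a ha b hab
      rw [mem_erase] at ha
      by_cases hbv : b = v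
      · exact Or.inr (by simp [hbv])
      · exact Or.inl (mem_erase.mpr ⟨hbv, hWC.2 a ha.2 b (hU a (hWC.1 ha.2) b hab) hab⟩))
    (by
        intro A hA hAW
        by_contra hcontra
        push Not at hcontra
        have : A = W := hcon A hA ⟨hAW.1.trans (erase_subset _ _), fun a ha b hb hab => by
          by_cases hbv : b = v
          · exact absurd (hbv ▸ hab) (hcontra a ha)
          · exact hAW.2 a ha b (mem_erase.mpr ⟨hbv, hb⟩) hab⟩
        exact notMem_erase v W (hAW.1 (this ▸ hv)))
    (by omega)
  exact ⟨W', S, h1.trans ((erase_subset _ _).trans hWC.1), h2⟩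

/-- Arcs of `A` inside `U`. -/
def koutArcs {V : Type*} [DecidableEq V] (A : Finset (V × V)) (U : Finset V) : Finset (V × V) :=
  A.filter (fun e => e.1 ∈ U ∧ e.2 ∈ U)

lemma kout_det {V : Type*} [DecidableEq V] (H : SimpleGraph V)
    (A : Finset (V × V)) (hA : ∀ e ∈ A, H.Adj e.1 e.2) (r L B : ℕ) (hr : 1 ≤ r) (hL : 1 ≤ L)
    (hB : 8 * r * L + L ≤ B)
    (hsp : ∀ U : Finset V, U.card ≤ B → 2 * r * (koutArcs A U).card ≤ (2 * r + 1) * U.card)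
    (hno : ∀ (v : V) (w : H.Walk v v), w.IsCycle → w.length < L) (m : ℕ) :
    ∀ U : Finset V, U.card ≤ m →
      8 * r ^ 2 * (koutArcs A U).card ≤ (2 * r + 1) * (4 * r + 1) * U.card := by
  induction m with
  | zero =>
    intro U hU
    have : U = ∅ := by simpa using hU
    subst this
    simp [koutArcs]
  | succ m ih =>
    intro U hU
    by_cases hUB : U.card ≤ B
    · have := hsp U hUB
      nlinarith
    have hUB' : 8 * r * L ≤ 2 * U.card := by omega
    set H' : SimpleGraph V := SimpleGraph.mk (fun a b => H.Adj a b ∧ a ∈ U ∧ b ∈ U)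
      ⟨fun a b h => ⟨h.1.symm, h.2.2, h.2.1⟩⟩ ⟨fun a h => H.loopless.irrefl a h.1⟩ with hH'
    have hle : H' ≤ H := fun a b h => h.1
    obtain ⟨W, S, hWU, h2, h3, h4, h5⟩ := kout_sep H' L (8 * r * L) hL
      (fun v w hw => by
        have := hno v (w.mapLe hle) (hw.mapLe hle)
        simpa using this) U (fun a ha b hab => hab.2.2) hUB'
    have hcard : (U \ W).card + W.card = U.card := card_sdiff_add_card_eq_card hWU
    have hrL : 8 ≤ 8 * r * L := by nlinarith [Nat.mul_le_mul hr hL]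
    have hih := ih (U \ W) (by omega)
    have hWS : (W ∪ S).card ≤ W.card + L := (card_union_le _ _).trans (by omega)
    have hs := hsp (W ∪ S) (by omega)
    have hsub : koutArcs A U ⊆ koutArcs A (W ∪ S) ∪ koutArcs A (U \ W) := by
      intro e he
      simp only [koutArcs, mem_filter, mem_union, mem_sdiff] at he ⊢
      obtain ⟨heA, he1, he2⟩ := he
      have hadj := hA e heA
      by_cases h1 : e.1 ∈ W
      · have := h5 _ h1 e.2 ⟨hadj, he1, he2⟩
        tauto
      · by_cases h2 : e.2 ∈ W
        · have := h5 _ h2 e.1 ⟨hadj.symm, he2, he1⟩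
          tauto
        · tauto
    have hc := (card_le_card hsub).trans (card_union_le _ _)
    have e1 : 2 * r * (koutArcs A (W ∪ S)).card ≤ (2 * r + 1) * (W.card + L) :=
      hs.trans (Nat.mul_le_mul_left _ hWS)
    have e2 : 4 * r * (2 * r * (koutArcs A (W ∪ S)).card) ≤ (2 * r + 1) * (4 * r + 1) * W.card := by
      have f1 := Nat.mul_le_mul_left (4 * r) e1
      have f2 : 4 * r * L ≤ W.card := by nlinarith
      have f3 := Nat.mul_le_mul_left (2 * r + 1) f2
      nlinarith
    have e3 := Nat.mul_le_mul_left (8 * r ^ 2) hc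
    rw [← hcard]
    nlinarith

end KOut

section KOutProb
open Finset

lemma kout_bern (S y : ℝ) (hS : 0 ≤ S) (hy : 0 ≤ y) (d : ℕ) :
    S ^ (d + 1) + (d + 1) * y * S ^ d ≤ (S + y) ^ (d + 1) := by
  induction d with
  | zero => simp
  | succ d ih =>
    have h1 : (S + y) ^ (d + 1 + 1) = (S + y) ^ (d + 1) * (S + y) := pow_succ _ _
    rw [h1]
    have h2 := mul_le_mul_of_nonneg_right ih (add_nonneg hS hy)
    refine le_trans ?_ h2
    push_cast
    have : 0 ≤ (d + 1 : ℝ) * y * S ^ d * y := by positivity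
    ring_nf at this ⊢
    nlinarith

lemma kout_esymm {α : Type*} [DecidableEq α] (y : α → ℝ) (hy : ∀ i, 0 ≤ y i) (s : Finset α) :
    ∀ d : ℕ, (d.factorial : ℝ) * ∑ T ∈ powersetCard d s, ∏ i ∈ T, y i ≤ (∑ i ∈ s, y i) ^ d := by
  induction s using Finset.induction_on with
  | empty =>
    intro d
    cases d with
    | zero => simp
    | succ d =>
      rw [powersetCard_eq_empty.mpr (by simp)]
      simp
  | insert a s ha ih =>
    intro d
    cases d with
    | zero => simp
    | succ d =>
      rw [powersetCard_succ_insert ha, sum_union, sum_image, sum_insert ha]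
      · have h1 : ∑ T ∈ powersetCard d s, ∏ i ∈ insert a T, y i
            = y a * ∑ T ∈ powersetCard d s, ∏ i ∈ T, y i := by
          rw [mul_sum]
          refine sum_congr rfl fun T hT => ?_
          rw [prod_insert]
          exact fun h => ha ((mem_powersetCard.mp hT).1 h)
        rw [h1]
        have h2 := ih (d + 1)
        have h3 := ih d
        have h4 := kout_bern (∑ i ∈ s, y i) (y a) (sum_nonneg fun i _ => hy i) (hy a) d
        rw [add_comm (y a)]
        refine le_trans ?_ h4
        have h5 := mul_le_mul_of_nonneg_left h3
          (show (0:ℝ) ≤ (d + 1) * y a from mul_nonneg (by positivity) (hy a))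
        rw [Nat.factorial_succ] at h2 ⊢
        push_cast at h2 ⊢
        nlinarith
      · intro T hT T' hT' h
        have hT := (mem_powersetCard.mp hT).1
        have hT' := (mem_powersetCard.mp hT').1
        rw [← erase_insert (fun h => ha (hT h)), ← erase_insert (fun h => ha (hT' h))]
        exact congrArg (fun X => X.erase a) h
      · rw [disjoint_left]
        intro T hT hT'
        obtain ⟨T', _, rfl⟩ := mem_image.mp hT'
        exact ha ((mem_powersetCard.mp hT).1 (mem_insert_self _ _))

lemma kout_vertex (n d : ℕ) (hn : 2 * d ≤ n) (v : Fin n) (W : Finset (Fin n)) (x : ℝ)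
    (hx : 1 ≤ x) (hxW : x * W.card = n) :
    ∑ T ∈ powersetCard d (univ.erase v), x ^ (T ∩ W).card ≤
      4 ^ d * ((powersetCard d (univ.erase v)).card : ℝ) := by
  have hcardM : (univ.erase v).card = n - 1 := by simp
  have hn1 : 1 ≤ n := by have := v.2; omega
  have h0 : ∀ T : Finset (Fin n), x ^ (T ∩ W).card = ∏ i ∈ T, (if i ∈ W then x else 1) := by
    intro T
    rw [prod_ite, prod_const, prod_const_one, mul_one, filter_mem_eq_inter]
  simp_rw [h0]
  have h1 := kout_esymm (fun i => if i ∈ W then x else 1)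
    (fun i => by split_ifs <;> linarith) (univ.erase v) d
  have h2 : ∑ i ∈ univ.erase v, (if i ∈ W then x else 1) ≤ 2 * (n : ℝ) := by
    calc ∑ i ∈ univ.erase v, (if i ∈ W then x else (1:ℝ))
        ≤ ∑ i ∈ (univ : Finset (Fin n)), (if i ∈ W then x else (1:ℝ)) :=
          sum_le_sum_of_subset_of_nonneg (erase_subset _ _)
            (fun i _ _ => by split_ifs <;> linarith)
      _ ≤ ∑ i ∈ (univ : Finset (Fin n)), ((if i ∈ W then x else 0) + 1) :=
          sum_le_sum (fun i _ => by split_ifs <;> linarith)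
      _ = 2 * (n : ℝ) := by
          rw [sum_add_distrib, sum_ite_mem]
          simp
          linarith
  have h2' : (0:ℝ) ≤ ∑ i ∈ univ.erase v, (if i ∈ W then x else (1:ℝ)) :=
    sum_nonneg (fun i _ => by split_ifs <;> linarith)
  have h3 := h1.trans (pow_le_pow_left₀ h2' h2 d)
  have h4 := Nat.pow_sub_le_descFactorial (n - 1) d
  rw [Nat.descFactorial_eq_factorial_mul_choose] at h4
  have h5 : n ≤ 2 * (n - 1 + 1 - d) := by omega
  have h6 : (n : ℝ) ^ d ≤ 2 ^ d * ((d.factorial : ℝ) * ((n - 1).choose d : ℝ)) := by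
    have := (Nat.pow_le_pow_left h5 d)
    rw [mul_pow] at this
    have := this.trans (Nat.mul_le_mul_left _ h4)
    exact_mod_cast this
  rw [card_powersetCard, hcardM]
  have hf : (0:ℝ) < d.factorial := by exact_mod_cast Nat.factorial_pos d
  refine le_of_mul_le_mul_left ?_ hf
  refine h3.trans ?_
  rw [mul_pow]
  calc (2:ℝ) ^ d * (n:ℝ) ^ d ≤ 2 ^ d * (2 ^ d * ((d.factorial : ℝ) * ((n - 1).choose d : ℝ))) := by
        gcongr
    _ = _ := by
        rw [show (4:ℝ) = 2 * 2 by norm_num, mul_pow]; ring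

/-- The sample space. -/
def koutΩ (n d : ℕ) : Finset (Fin n → Finset (Fin n)) :=
  Fintype.piFinset (fun v => powersetCard d (univ.erase v))

lemma kout_count (n d m : ℕ) (hn : 2 * d ≤ n) (W : Finset (Fin n)) (hW : 1 ≤ W.card) :
    (((koutΩ n d).filter (fun N => m ≤ ∑ v ∈ W, (N v ∩ W).card)).card : ℝ) ≤
      (koutΩ n d).card * ((4 ^ d) ^ W.card * ((W.card : ℝ) / n) ^ m) := by
  have hWn : W.card ≤ n := by simpa using card_le_univ W
  have hW0 : (0:ℝ) < W.card := by exact_mod_cast hW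
  have hn0 : (0:ℝ) < n := by exact_mod_cast (by omega : 0 < n)
  set x : ℝ := n / W.card with hx
  have hx1 : 1 ≤ x := by
    rw [hx, one_le_div hW0]; exact_mod_cast hWn
  have hxW : x * W.card = n := by rw [hx]; field_simp
  have hxi : (W.card : ℝ) / n = x⁻¹ := by rw [hx, inv_div]
  have hxm : 0 < x ^ m := by positivity
  have key : (((koutΩ n d).filter (fun N => m ≤ ∑ v ∈ W, (N v ∩ W).card)).card : ℝ) * x ^ m ≤
      (koutΩ n d).card * (4 ^ d) ^ W.card := by
    calc (((koutΩ n d).filter (fun N => m ≤ ∑ v ∈ W, (N v ∩ W).card)).card : ℝ) * x ^ m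
        = ∑ N ∈ (koutΩ n d).filter (fun N => m ≤ ∑ v ∈ W, (N v ∩ W).card), x ^ m := by simp
      _ ≤ ∑ N ∈ (koutΩ n d).filter (fun N => m ≤ ∑ v ∈ W, (N v ∩ W).card),
            x ^ (∑ v ∈ W, (N v ∩ W).card) := by
          refine sum_le_sum fun N hN => ?_
          exact pow_le_pow_right₀ hx1 (mem_filter.mp hN).2
      _ ≤ ∑ N ∈ koutΩ n d, x ^ (∑ v ∈ W, (N v ∩ W).card) :=
          sum_le_sum_of_subset_of_nonneg (filter_subset _ _) (fun _ _ _ => by positivity)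
      _ = ∑ N ∈ koutΩ n d, ∏ v, (if v ∈ W then x ^ (N v ∩ W).card else 1) := by
          refine sum_congr rfl fun N _ => ?_
          rw [prod_ite_mem, univ_inter, prod_pow_eq_pow_sum]
      _ = ∏ v, ∑ T ∈ powersetCard d (univ.erase v), (if v ∈ W then x ^ (T ∩ W).card else 1) := by
          rw [koutΩ, prod_univ_sum]
      _ ≤ ∏ v : Fin n, ((if v ∈ W then 4 ^ d else 1) *
            ((powersetCard d (univ.erase v)).card : ℝ)) := by
          refine prod_le_prod (fun v _ => sum_nonneg fun T _ => by split_ifs <;> positivity) ?_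
          intro v _
          split_ifs with h
          · exact kout_vertex n d hn v W x hx1 hxW
          · simp
      _ = _ := by
          rw [prod_mul_distrib, prod_ite_mem, univ_inter, prod_const, koutΩ, Fintype.card_piFinset]
          push_cast
          ring
  rw [hxi, inv_pow, ← mul_assoc]
  rw [← div_eq_mul_inv, le_div_iff₀ hxm]
  exact key

lemma kout_term (n d q s : ℕ) (hq : 1 ≤ q) (hs : 1 ≤ s) (hsn : (6 * 4 ^ d) ^ q * s ≤ n) :
    (n.choose s : ℝ) * ((4 ^ d) ^ s * ((s : ℝ) / n) ^ (s + (s / q + 1))) ≤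
      (6 * 4 ^ d) ^ q / n * (s / 2 ^ s) := by
  have hK1 : (1:ℝ) ≤ 6 * 4 ^ d := by
    have : (1:ℝ) ≤ 4 ^ d := one_le_pow₀ (by norm_num)
    linarith
  have hn0 : (0:ℝ) < n := by
    have : 0 < (6 * 4 ^ d) ^ q * s := by positivity
    exact_mod_cast (by omega : 0 < n)
  have hs0 : (0:ℝ) < s := by exact_mod_cast hs
  have h1 : (n.choose s : ℝ) * ((s : ℝ) / n) ^ s ≤ 3 ^ s := by
    have a1 : (n.choose s : ℝ) ≤ (n:ℝ) ^ s / s.factorial := Nat.choose_le_pow_div s n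
    have a2 : (s:ℝ) ^ s / s.factorial ≤ Real.exp s := Real.pow_div_factorial_le_exp _ hs0.le s
    have a3 : Real.exp s ≤ 3 ^ s := by
      rw [← Real.exp_one_pow]
      exact pow_le_pow_left₀ (Real.exp_pos 1).le (by linarith [Real.exp_one_lt_d9]) s
    calc (n.choose s : ℝ) * ((s : ℝ) / n) ^ s ≤ (n:ℝ) ^ s / s.factorial * ((s : ℝ) / n) ^ s := by
          gcongr
      _ = (s:ℝ) ^ s / s.factorial := by rw [div_pow]; field_simp
      _ ≤ _ := a2.trans a3
  have hj : s ≤ q * (s / q + 1) := by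
    have := Nat.lt_mul_div_succ s (by omega : 0 < q)
    omega
  set j := s / q + 1 with hjdef
  have h2 : ((6:ℝ) * 4 ^ d) ^ s * ((s : ℝ) / n) ^ j ≤ (6 * 4 ^ d) ^ q * ((s:ℝ) / n) := by
    calc ((6:ℝ) * 4 ^ d) ^ s * ((s : ℝ) / n) ^ j
        ≤ (6 * 4 ^ d) ^ (q * j) * ((s : ℝ) / n) ^ j := by
          gcongr
      _ = ((6 * 4 ^ d) ^ q * ((s:ℝ) / n)) ^ j := by rw [pow_mul, ← mul_pow]
      _ ≤ _ := by
          refine pow_le_of_le_one (by positivity) ?_ (Nat.succ_ne_zero _)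
          rw [← mul_div_assoc, div_le_one hn0]
          exact_mod_cast hsn
  calc (n.choose s : ℝ) * ((4 ^ d) ^ s * ((s : ℝ) / n) ^ (s + j))
      = ((n.choose s : ℝ) * ((s : ℝ) / n) ^ s) * ((4 ^ d) ^ s * ((s : ℝ) / n) ^ j) := by
        rw [pow_add]; ring
    _ ≤ 3 ^ s * ((4 ^ d) ^ s * ((s : ℝ) / n) ^ j) := by gcongr
    _ = (6 * 4 ^ d) ^ s * ((s : ℝ) / n) ^ j / 2 ^ s := by
        rw [mul_pow, show (6:ℝ) = 3 * 2 by norm_num, mul_pow 3 2]; field_simp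
    _ ≤ (6 * 4 ^ d) ^ q * ((s:ℝ) / n) / 2 ^ s := by gcongr
    _ = _ := by ring

lemma kout_geom (m : ℕ) : ∑ s ∈ range m, ((s:ℝ) / 2 ^ s) ≤ 2 := by
  have : ∑ s ∈ range m, ((s:ℝ) / 2 ^ s) = 2 - 2 * (m + 1) / 2 ^ m := by
    induction m with
    | zero => simp
    | succ m ih =>
      rw [sum_range_succ, ih, pow_succ]
      push_cast
      field_simp
      ring
  rw [this]
  have : (0:ℝ) ≤ 2 * (m + 1) / 2 ^ m := by positivity
  linarith

/-- Dense small set. -/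
def koutBad (n q B : ℕ) (N : Fin n → Finset (Fin n)) : Prop :=
  ∃ W : Finset (Fin n), W.card ≤ B ∧ (q + 1) * W.card < q * ∑ v ∈ W, (N v ∩ W).card

open Classical in
lemma kout_bad (n d q : ℕ) (hn : 2 * d ≤ n) (hq : 1 ≤ q) :
    (((koutΩ n d).filter (koutBad n q (n / (6 * 4 ^ d) ^ q))).card : ℝ) ≤
      (koutΩ n d).card * (2 * (6 * 4 ^ d) ^ q / n) := by
  set B := n / (6 * 4 ^ d) ^ q with hB
  set g : ℕ → ℝ := fun s => if 1 ≤ s ∧ s ≤ B then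
    (koutΩ n d).card * ((4 ^ d) ^ s * ((s : ℝ) / n) ^ (s + (s / q + 1))) else 0 with hg
  have hsub : (koutΩ n d).filter (koutBad n q B) ⊆
      (univ : Finset (Finset (Fin n))).biUnion (fun W => (koutΩ n d).filter (fun N =>
        W.card ≤ B ∧ (q + 1) * W.card < q * ∑ v ∈ W, (N v ∩ W).card)) := by
    intro N hN
    rw [mem_filter] at hN
    obtain ⟨h1, W, hW⟩ := hN
    rw [mem_biUnion]
    exact ⟨W, mem_univ _, mem_filter.mpr ⟨h1, hW⟩⟩
  have h1 : (((koutΩ n d).filter (koutBad n q B)).card : ℝ) ≤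
      ∑ W : Finset (Fin n), (((koutΩ n d).filter (fun N =>
        W.card ≤ B ∧ (q + 1) * W.card < q * ∑ v ∈ W, (N v ∩ W).card)).card : ℝ) := by
    exact_mod_cast (card_le_card hsub).trans card_biUnion_le
  have h2 : ∀ W : Finset (Fin n), (((koutΩ n d).filter (fun N =>
        W.card ≤ B ∧ (q + 1) * W.card < q * ∑ v ∈ W, (N v ∩ W).card)).card : ℝ) ≤ g W.card := by
    intro W
    by_cases hW : 1 ≤ W.card ∧ W.card ≤ B
    · simp only [hg, if_pos hW]
      refine le_trans ?_ (kout_count n d (W.card + (W.card / q + 1)) hn W hW.1)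
      refine Nat.cast_le.mpr (card_le_card ?_)
      intro N hN
      rw [mem_filter] at hN ⊢
      refine ⟨hN.1, ?_⟩
      have h := hN.2.2
      by_contra hcon
      have h3 : ∑ v ∈ W, (N v ∩ W).card ≤ W.card + W.card / q := by omega
      have h4 := Nat.mul_le_mul_left q h3
      have h5 := Nat.mul_div_le W.card q
      nlinarith
    · simp only [hg, if_neg hW]
      rw [filter_false_of_mem]
      · simp
      · intro N _ hN
        apply hW
        refine ⟨?_, hN.1⟩
        by_contra h0
        have : W = ∅ := by rw [← card_eq_zero]; omega
        simp [this] at hN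
  refine h1.trans ((sum_le_sum fun W _ => h2 W).trans ?_)
  rw [← powerset_univ, sum_powerset_apply_card, card_univ, Fintype.card_fin]
  calc ∑ s ∈ range (n + 1), n.choose s • g s
      ≤ ∑ s ∈ range (n + 1), ((koutΩ n d).card * ((6 * 4 ^ d) ^ q / n)) * ((s:ℝ) / 2 ^ s) := by
        refine sum_le_sum fun s _ => ?_
        rw [nsmul_eq_mul]
        by_cases hs : 1 ≤ s ∧ s ≤ B
        · simp only [hg, if_pos hs]
          have := kout_term n d q s hq hs.1
            ((Nat.mul_le_mul_left _ hs.2).trans (Nat.mul_div_le _ _))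
          have := mul_le_mul_of_nonneg_left this (Nat.cast_nonneg (α := ℝ) (koutΩ n d).card)
          calc _ = _ := by ring
            _ ≤ _ := this
            _ = _ := by ring
        · simp only [hg, if_neg hs, mul_zero]
          positivity
    _ ≤ ((koutΩ n d).card * ((6 * 4 ^ d) ^ q / n)) * 2 := by
        rw [← mul_sum]
        exact mul_le_mul_of_nonneg_left (kout_geom _) (by positivity)
    _ = _ := by ring

end KOutProb

section KOutMain
open Finset

lemma kout_arcs_le (n : ℕ) (N : Fin n → Finset (Fin n)) (A : Finset (Fin n × Fin n))
    (hA : ∀ e ∈ A, e.2 ∈ N e.1) (W : Finset (Fin n)) :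
    (koutArcs A W).card ≤ ∑ v ∈ W, (N v ∩ W).card := by
  rw [← card_sigma]
  refine card_le_card_of_injOn (fun e => ⟨e.1, e.2⟩) ?_ ?_
  · intro e he
    have he := mem_filter.mp (mem_coe.mp he)
    simp only [coe_sigma, Set.mem_sigma_iff, mem_coe, mem_inter]
    exact ⟨he.2.1, hA e he.1, he.2.2⟩
  · rintro ⟨a, b⟩ _ ⟨a', b'⟩ _ h
    simpa using h

lemma kout_pigeon (n r : ℕ) (hr : 1 ≤ r) (N : Fin n → Finset (Fin n))
    (hN : ∀ v, (N v).card = r + 1) (c : Sym2 (Fin n) → Fin r) :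
    ∃ j : Fin r, (r + 1) * n ≤ r * (univ.filter (fun e : Fin n × Fin n =>
      e.2 ∈ N e.1 ∧ c s(e.1, e.2) = j)).card := by
  by_contra hcon
  push Not at hcon
  have htot : (univ.filter (fun e : Fin n × Fin n => e.2 ∈ N e.1)).card = (r + 1) * n := by
    rw [card_filter, Fintype.sum_prod_type]
    simp [hN, mul_comm]
  have hsum := card_eq_sum_card_fiberwise (f := fun e : Fin n × Fin n => c s(e.1, e.2))
    (s := univ.filter (fun e : Fin n × Fin n => e.2 ∈ N e.1)) (t := univ) (by intro e _; simp)
  simp_rw [filter_filter] at hsum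
  rw [htot] at hsum
  have hlt : ∑ j : Fin r, r * (univ.filter (fun e : Fin n × Fin n =>
      e.2 ∈ N e.1 ∧ c s(e.1, e.2) = j)).card < ∑ _j : Fin r, (r + 1) * n :=
    sum_lt_sum_of_nonempty ⟨⟨0, hr⟩, mem_univ _⟩ (fun j _ => hcon j)
  rw [← mul_sum, ← hsum] at hlt
  simp at hlt

lemma kout_good (n r L B : ℕ) (hr : 1 ≤ r) (hn : 1 ≤ n) (hL : 1 ≤ L) (hB : 8 * r * L + L ≤ B)
    (N : Fin n → Finset (Fin n)) (hN : ∀ v, v ∉ N v ∧ (N v).card = r + 1)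
    (hgood : ¬ koutBad n (2 * r) B N) (c : Sym2 (Fin n) → Fin r) :
    ∃ (v : Fin n) (w : (SimpleGraph.fromRel (fun u w => w ∈ N u)).Walk v v),
      w.IsCycle ∧ L ≤ w.length ∧ ∃ j : Fin r, ∀ e ∈ w.edges, c e = j := by
  obtain ⟨j, hj⟩ := kout_pigeon n r hr N (fun v => (hN v).2) c
  set A := univ.filter (fun e : Fin n × Fin n => e.2 ∈ N e.1 ∧ c s(e.1, e.2) = j) with hA
  set G := SimpleGraph.fromRel (fun u w : Fin n => w ∈ N u) with hG
  set H : SimpleGraph (Fin n) := SimpleGraph.mk (fun a b => G.Adj a b ∧ c s(a, b) = j)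
    ⟨fun a b h => ⟨h.1.symm, by rw [Sym2.eq_swap]; exact h.2⟩⟩
    ⟨fun a h => G.loopless.irrefl a h.1⟩ with hH
  have hle : H ≤ G := fun a b h => h.1
  by_contra hcon
  have hno : ∀ (v : Fin n) (w : H.Walk v v), w.IsCycle → w.length < L := by
    intro v w hw
    by_contra hlen
    apply hcon
    refine ⟨v, w.mapLe hle, hw.mapLe hle, by simpa using hlen, j, ?_⟩
    intro e he
    rw [SimpleGraph.Walk.edges_mapLe_eq_edges] at he
    have := w.edges_subset_edgeSet he
    induction e using Sym2.ind with
    | _ a b => exact this.2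
  have hAH : ∀ e ∈ A, H.Adj e.1 e.2 := by
    intro e he
    have he := (mem_filter.mp he).2
    refine ⟨?_, he.2⟩
    rw [hG, SimpleGraph.fromRel_adj]
    refine ⟨fun h => (hN e.1).1 ?_, Or.inl he.1⟩
    have := he.1
    rwa [← h] at this
  have hsp : ∀ U : Finset (Fin n), U.card ≤ B →
      2 * r * (koutArcs A U).card ≤ (2 * r + 1) * U.card := by
    intro U hU
    by_contra h
    apply hgood
    refine ⟨U, hU, ?_⟩
    push Not at h
    exact h.trans_le (Nat.mul_le_mul_left _
      (kout_arcs_le n N A (fun e he => (mem_filter.mp he).2.1) U))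
  have hdet := kout_det H A hAH r L B hr hL hB hsp hno n univ (by simp)
  have hAu : koutArcs A univ = A := by simp [koutArcs]
  rw [hAu, card_univ, Fintype.card_fin] at hdet
  have h1 := Nat.mul_le_mul_left (8 * r) hj
  have h2 : 0 < r * n := by positivity
  have h3 : n ≤ r * n := Nat.le_mul_of_pos_left n hr
  nlinarith

end KOutMain


/-- Fix an integer `r ≥ 2`. There exists a constant `γ > 0` such that, with high
probability as `n → ∞`, every `r`-edge-coloring of the random `(r+1)`-out graph
`G_{n,(r+1)-out}` contains a monochromatic cycle of length at least `γ·n`.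

The random `(r+1)`-out graph is modelled by a uniformly random choice function
`N : Fin n → Finset (Fin n)` with `v ∉ N v` and `(N v).card = r + 1` for all `v`; the
associated simple graph is `SimpleGraph.fromRel (fun u w => w ∈ N u)`.  "With high
probability" is expressed by counting: for every `p < 1`, for all sufficiently large `n`
(with `r + 1 ≤ n - 1`), the number of choice functions whose graph has, for every coloring
`c : Sym2 (Fin n) → Fin r`, a cycle of length at least `γ·n` all of whose edges receive the
same color, is at least `p` times the total number of choice functions. -/
theorem stmt_3 (r : ℕ) (hr : 2 ≤ r) :
    ∃ γ : ℝ, 0 < γ ∧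
      ∀ p : ℝ, p < 1 → ∃ N₀ : ℕ, ∀ n : ℕ, N₀ ≤ n → r + 2 ≤ n →
        p * (Nat.card {N : Fin n → Finset (Fin n) //
                ∀ v : Fin n, v ∉ N v ∧ (N v).card = r + 1} : ℝ) ≤
        (Nat.card {N : Fin n → Finset (Fin n) //
            (∀ v : Fin n, v ∉ N v ∧ (N v).card = r + 1) ∧
            ∀ c : Sym2 (Fin n) → Fin r,
              ∃ (v : Fin n) (w : (SimpleGraph.fromRel (fun u w => w ∈ N u)).Walk v v),
                w.IsCycle ∧ γ * n ≤ (w.length : ℝ) ∧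
                ∃ j : Fin r, ∀ e ∈ w.edges, c e = j} : ℝ) := by
  classical
  set Q : ℕ := (6 * 4 ^ (r + 1)) ^ (2 * r) with hQ
  have hQ0 : 0 < Q := by positivity
  have hD0 : 0 < Q * (8 * r + 1) := by positivity
  refine ⟨1 / (2 * ((Q * (8 * r + 1) : ℕ) : ℝ)), by positivity, ?_⟩
  intro p hp
  obtain ⟨M, hM⟩ := exists_nat_ge (2 * (Q : ℝ) / (1 - p))
  refine ⟨M + 2 * (r + 1) + Q * (8 * r + 1), ?_⟩
  intro n hn hrn
  have hΩ : ∀ N : Fin n → Finset (Fin n), N ∈ koutΩ n (r + 1) ↔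
      ∀ v : Fin n, v ∉ N v ∧ (N v).card = r + 1 := by
    intro N
    simp only [koutΩ, Fintype.mem_piFinset, Finset.mem_powersetCard]
    refine forall_congr' fun v => and_congr_left fun _ => ?_
    constructor
    · intro h hv
      exact Finset.notMem_erase v _ (h hv)
    · intro h x hx
      exact Finset.mem_erase.mpr ⟨fun hxv => h (hxv ▸ hx), Finset.mem_univ _⟩
  rw [Nat.subtype_card (koutΩ n (r + 1)) hΩ]
  set L : ℕ := n / (Q * (8 * r + 1)) with hLdef
  have hL1 : 1 ≤ L := (Nat.one_le_div_iff hD0).mpr (by omega)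
  have hLB : 8 * r * L + L ≤ n / Q := by
    rw [Nat.le_div_iff_mul_le hQ0]
    have := Nat.div_mul_le_self n (Q * (8 * r + 1))
    rw [← hLdef] at this
    nlinarith
  have hLγ : 1 / (2 * ((Q * (8 * r + 1) : ℕ) : ℝ)) * n ≤ L := by
    have h1 : n < Q * (8 * r + 1) * (L + 1) := Nat.lt_mul_div_succ n hD0
    have h2 : n ≤ L * (2 * (Q * (8 * r + 1))) := by nlinarith
    have hDr : (0:ℝ) < 2 * ((Q * (8 * r + 1) : ℕ) : ℝ) := by positivity
    rw [one_div, inv_mul_eq_div, div_le_iff₀ hDr]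
    exact_mod_cast h2
  obtain ⟨F, hF⟩ : ∃ F, F = Finset.univ.filter (fun N : Fin n → Finset (Fin n) =>
            (∀ v : Fin n, v ∉ N v ∧ (N v).card = r + 1) ∧
            ∀ c : Sym2 (Fin n) → Fin r,
              ∃ (v : Fin n) (w : (SimpleGraph.fromRel (fun u w => w ∈ N u)).Walk v v),
                w.IsCycle ∧ 1 / (2 * ((Q * (8 * r + 1) : ℕ) : ℝ)) * n ≤ (w.length : ℝ) ∧
                ∃ j : Fin r, ∀ e ∈ w.edges, c e = j) := ⟨_, rfl⟩
  have hsubset : (koutΩ n (r + 1)).filter (fun N => ¬ koutBad n (2 * r) (n / Q) N) ⊆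
      F := by
    rw [hF]
    intro N hN
    rw [Finset.mem_filter] at hN
    rw [Finset.mem_filter]
    have hN1 := (hΩ N).mp hN.1
    refine ⟨Finset.mem_univ _, hN1, fun c => ?_⟩
    obtain ⟨v, w, hw, hlen, hj⟩ := kout_good n r L (n / Q) (by omega) (by omega) hL1 hLB N hN1 hN.2 c
    exact ⟨v, w, hw, hLγ.trans (by exact_mod_cast hlen), hj⟩
  rw [Nat.subtype_card F (fun N => by rw [hF, Finset.mem_filter]; exact and_iff_right (Finset.mem_univ _))]
  have hcard := Finset.card_le_card hsubset
  have hbad := kout_bad n (r + 1) (2 * r) (by omega) (by omega)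
  rw [← hQ] at hbad
  have hsplit := Finset.card_filter_add_card_filter_not (s := koutΩ n (r + 1))
    (koutBad n (2 * r) (n / Q))
  have hQr : (6 * 4 ^ (r + 1) : ℝ) ^ (2 * r) = (Q : ℝ) := by rw [hQ]; push_cast; rfl
  rw [hQr] at hbad
  have hn0 : (0:ℝ) < n := by exact_mod_cast (by omega : 0 < n)
  have hsmall : 2 * (Q : ℝ) / n ≤ 1 - p := by
    have hp' : 0 < 1 - p := by linarith
    rw [div_le_iff₀ hn0]
    rw [div_le_iff₀ hp'] at hM
    have : (M : ℝ) ≤ n := by exact_mod_cast (by omega : M ≤ n)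
    nlinarith
  have h1 := mul_le_mul_of_nonneg_left hsmall (Nat.cast_nonneg (α := ℝ) (koutΩ n (r + 1)).card)
  have h2 : ((koutΩ n (r + 1)).card : ℝ) = _ := (congrArg (Nat.cast (R := ℝ)) hsplit).symm
  push_cast at h2
  have h3 : ((_ : ℕ) : ℝ) ≤ ((_ : ℕ) : ℝ) := Nat.cast_le.mpr hcard
  refine le_trans ?_ h3
  linarith
end

section
/- Fix an integer r ≥ 2. There is a constant K > 0 such that the following holds with high probability as n → ∞. Let σ₁,…,σ_r be independent uniformly random n-cycles on [n], and for each i ∈ {1,…,r} let H_i be the Hamilton cycle with edges {v, σ_i(v)} for v ∈ [n]. Then there is a coloring c : {1,…,r} × [n] → {1,…,r} (where c(i,v) is the color of the edge {v, σ_i(v)} of H_i) such that for every color j ∈ {1,…,r}, every connected component of the graph on [n] whose edges are the pairs {v, σ_i(v)} with c(i,v) = j has at most K·n^{0.7} vertices. -/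
namespace HamCol
open Equiv
theorem card_fib {X Y : Type*} [Fintype X] [DecidableEq Y] (f : X → Y) (C B : Finset Y) (hB : B ⊆ C) (F : ℕ)
    (h : ∀ y ∈ C, (Finset.univ.filter (fun x => f x = y)).card = F) :
    (Finset.univ.filter (fun x => f x ∈ B)).card = B.card * F := by
  rw [Finset.card_eq_sum_card_fiberwise (f := f) (t := B) (by intro x; simp)]
  rw [Finset.sum_const_nat (m := F)]
  intro y hy
  rw [← h y (hB hy)]
  congr 1
  ext x
  simp only [Finset.mem_filter, Finset.mem_univ, true_and]
  constructor
  · rintro ⟨_, h⟩; exact h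
  · rintro rfl; exact ⟨hy, rfl⟩

open Classical in
theorem card_emb {n k : ℕ} (f : Fin k ↪ Fin n) (B : Finset (Fin k ↪ Fin n)) :
    (Finset.univ.filter (fun π : Perm (Fin n) => f.trans π.toEmbedding ∈ B)).card * n.descFactorial k
      = B.card * n.factorial := by
  set F := (Finset.univ.filter (fun π : Perm (Fin n) => f.trans π.toEmbedding = f)).card with hF
  have h : ∀ y ∈ (Finset.univ : Finset (Fin k ↪ Fin n)),
    (Finset.univ.filter (fun π : Perm (Fin n) => f.trans π.toEmbedding = y)).card = F := by
    intro y _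
    have ht := Equiv.Perm.isMultiplyPretransitive (Fin n) k
    obtain ⟨g, hg⟩ := ht.exists_smul_eq f y
    rw [hF]
    symm
    refine Finset.card_bij' (fun π _ => g * π) (fun π _ => g⁻¹ * π) ?_ ?_ ?_ ?_
    · intro π hπ
      simp only [Finset.mem_filter, Finset.mem_univ, true_and] at hπ ⊢
      rw [← hg]
      conv_rhs => rw [← hπ]
      ext i; simp
    · intro π hπ
      simp only [Finset.mem_filter, Finset.mem_univ, true_and] at hπ ⊢
      rw [← hg] at hπ
      ext i
      have := DFunLike.congr_fun hπ i
      simp at this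
      simp [this]
    · intro π _; simp
    · intro π _; simp
  have h1 := card_fib (fun π : Perm (Fin n) => f.trans π.toEmbedding) Finset.univ B (Finset.subset_univ _) F h
  have h2 := card_fib (fun π : Perm (Fin n) => f.trans π.toEmbedding) Finset.univ Finset.univ (Finset.subset_univ _) F h
  simp [Fintype.card_perm, Fintype.card_embedding_eq] at h2
  rw [h1, h2]; ring

open Classical in
theorem card_ratio {r n : ℕ} (i i' : Fin r) (hne : i' ≠ i) (B : Finset (Perm (Fin n))) :
    (Finset.univ.filter (fun τ : Fin r → Perm (Fin n) => (τ i')⁻¹ * τ i ∈ B)).card * n.factorial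
      = B.card * n.factorial ^ r := by
  set F := (Finset.univ.filter (fun τ : Fin r → Perm (Fin n) => (τ i')⁻¹ * τ i = 1)).card with hF
  have h : ∀ y ∈ (Finset.univ : Finset (Perm (Fin n))),
    (Finset.univ.filter (fun τ : Fin r → Perm (Fin n) => (τ i')⁻¹ * τ i = y)).card = F := by
    intro y _
    rw [hF]
    symm
    refine Finset.card_bij' (fun τ _ => Function.update τ i (τ i * y))
      (fun τ _ => Function.update τ i (τ i * y⁻¹)) ?_ ?_ ?_ ?_
    · intro π hπ
      simp only [Finset.mem_filter, Finset.mem_univ, true_and] at hπ ⊢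
      simp [hne, ← mul_assoc, hπ]
    · intro π hπ
      simp only [Finset.mem_filter, Finset.mem_univ, true_and] at hπ ⊢
      simp [hne, ← mul_assoc, hπ]
    · intro π _; simp
    · intro π _; simp
  have h1 := card_fib (fun τ : Fin r → Perm (Fin n) => (τ i')⁻¹ * τ i) Finset.univ B (Finset.subset_univ _) F h
  have h2 := card_fib (fun τ : Fin r → Perm (Fin n) => (τ i')⁻¹ * τ i) Finset.univ Finset.univ (Finset.subset_univ _) F h
  simp [Fintype.card_perm] at h2
  rw [h1, h2]; ring

open Classical in
/-- transfer to n-cycles -/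
theorem transfer {r n : ℕ} (hn : 2 ≤ n) (P : (Fin r → Perm (Fin n)) → Prop) (p : ℝ)
    (h : p * (n.factorial ^ r : ℕ) ≤ ((Finset.univ.filter (fun τ : Fin r → Perm (Fin n) =>
      P (fun i => τ i * finRotate n * (τ i)⁻¹))).card : ℝ)) :
    p * (Nat.card {σ : Fin r → Equiv.Perm (Fin n) //
                ∀ i : Fin r, (σ i).IsCycle ∧ (σ i).support = Finset.univ} : ℝ) ≤
     (Nat.card {σ : Fin r → Equiv.Perm (Fin n) //
            (∀ i : Fin r, (σ i).IsCycle ∧ (σ i).support = Finset.univ) ∧ P σ} : ℝ) := by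
  rw [Nat.card_eq_fintype_card, Nat.card_eq_fintype_card, Fintype.card_subtype, Fintype.card_subtype]
  set C := Finset.univ.filter (fun σ : Fin r → Equiv.Perm (Fin n) => ∀ i : Fin r, (σ i).IsCycle ∧ (σ i).support = Finset.univ) with hC
  set G := Finset.univ.filter (fun σ : Fin r → Equiv.Perm (Fin n) => (∀ i : Fin r, (σ i).IsCycle ∧ (σ i).support = Finset.univ) ∧ P σ) with hG
  have hGC : G ⊆ C := by
    intro σ; simp only [hC, hG, Finset.mem_filter]; tauto
  have hrot : (finRotate n).IsCycle ∧ (finRotate n).support = Finset.univ := by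
    obtain ⟨k, rfl⟩ := Nat.exists_eq_add_of_le' hn
    exact ⟨isCycle_finRotate, support_finRotate⟩
  let f : (Fin r → Perm (Fin n)) → (Fin r → Perm (Fin n)) := fun τ i => τ i * finRotate n * (τ i)⁻¹
  set F := (Finset.univ.filter (fun τ => f τ = fun _ => finRotate n)).card with hF
  have hfC : ∀ τ, f τ ∈ C := by
    intro τ
    simp only [hC, Finset.mem_filter, Finset.mem_univ, true_and, f]
    intro i
    refine ⟨hrot.1.conj, ?_⟩
    rw [Equiv.Perm.support_conj, hrot.2]
    simp
  have hfib : ∀ y ∈ C, (Finset.univ.filter (fun τ => f τ = y)).card = F := by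
    intro y hy
    simp only [hC, Finset.mem_filter, Finset.mem_univ, true_and] at hy
    have : ∀ i, ∃ g : Perm (Fin n), g * finRotate n * g⁻¹ = y i := by
      intro i
      have := hrot.1.isConj (hy i).1 (by rw [hrot.2, (hy i).2])
      exact isConj_iff.1 this
    choose g hg using this
    rw [hF]
    symm
    refine Finset.card_bij' (fun τ _ => g * τ) (fun τ _ => g⁻¹ * τ) ?_ ?_ ?_ ?_
    · intro π hπ
      simp only [Finset.mem_filter, Finset.mem_univ, true_and, f] at hπ ⊢
      ext1 i
      rw [← hg i]
      conv_rhs => rw [← congrFun hπ i]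
      simp [mul_assoc]
    · intro π hπ
      simp only [Finset.mem_filter, Finset.mem_univ, true_and, f] at hπ ⊢
      ext1 i
      have h1 := congrFun hπ i
      rw [← hg i] at h1
      have : finRotate n = (g i)⁻¹ * (g i * finRotate n * (g i)⁻¹) * g i := by group
      conv_rhs => rw [this, ← h1]
      simp [mul_assoc]
    · intro π _; simp
    · intro π _; simp
  have h1 := card_fib f C G hGC F hfib
  have h2 := card_fib f C C subset_rfl F hfib
  simp [hfC, Fintype.card_perm] at h2
  have h3 : (Finset.univ.filter (fun τ : Fin r → Perm (Fin n) =>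
      P (fun i => τ i * finRotate n * (τ i)⁻¹))) = Finset.univ.filter (fun x => f x ∈ G) := by
    ext τ
    have := hfC τ
    simp only [hC, hG, Finset.mem_filter, Finset.mem_univ, true_and] at this ⊢
    simp only [this, implies_true, true_and]
    tauto
  rw [h3, h1, h2] at h
  have hFpos : 0 < F := by
    rcases Nat.eq_zero_or_pos F with h0 | h0
    · rw [h0] at h2; simp [Nat.factorial_ne_zero] at h2
    · exact h0
  push_cast at h
  have : (0:ℝ) < F := by exact_mod_cast hFpos
  rw [← mul_assoc] at h
  exact le_of_mul_le_mul_right h this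

open Classical in
theorem card_A2 {n : ℕ} (S : Finset (Fin n × Fin n)) (hS : ∀ z ∈ S, z.1 ≠ z.2)
    (x y : Fin n) (hxy : x ≠ y) :
    (Finset.univ.filter (fun π : Perm (Fin n) => (π x, π y) ∈ S)).card * n.descFactorial 2
      = S.card * n.factorial := by
  let f : Fin 2 ↪ Fin n := ⟨![x, y], by
    intro i j; fin_cases i <;> fin_cases j <;> simp [hxy, hxy.symm]⟩
  let B : Finset (Fin 2 ↪ Fin n) := Finset.univ.filter (fun g => (g 0, g 1) ∈ S)
  have h := card_emb f B
  have h1 : B.card = S.card := by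
    refine Finset.card_bij (fun g _ => (g 0, g 1)) ?_ ?_ ?_
    · intro g hg; simpa [B] using hg
    · intro g _ g' _ h
      simp only [Prod.mk.injEq] at h
      ext i
      fin_cases i
      · simp [h.1]
      · simp [h.2]
    · intro z hz
      refine ⟨⟨![z.1, z.2], ?_⟩, ?_, ?_⟩
      · have := hS z hz
        intro i j; fin_cases i <;> fin_cases j <;> simp [this, this.symm]
      · simp only [B, Finset.mem_filter, Finset.mem_univ, true_and]; exact hz
      · rfl
  rw [h1] at h
  rw [← h]
  congr 2
  ext π
  simp only [B, f, Finset.mem_filter, Finset.mem_univ, true_and]; rfl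

open Classical in
theorem card_A4 {n : ℕ} (S : Finset (Fin n × Fin n))
    (f : Fin 4 ↪ Fin n) :
    (Finset.univ.filter (fun π : Perm (Fin n) => (π (f 0), π (f 1)) ∈ S ∧ (π (f 2), π (f 3)) ∈ S)).card
      * n.descFactorial 4 ≤ S.card ^ 2 * n.factorial := by
  let B : Finset (Fin 4 ↪ Fin n) := Finset.univ.filter (fun g => (g 0, g 1) ∈ S ∧ (g 2, g 3) ∈ S)
  have h := card_emb f B
  have h1 : B.card ≤ S.card ^ 2 := by
    rw [sq, ← Finset.card_product]
    refine Finset.card_le_card_of_injOn (fun g => ((g 0, g 1), (g 2, g 3))) ?_ ?_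
    · intro g hg; simpa [B] using hg
    · intro g _ g' _ h
      simp only [Prod.mk.injEq] at h
      ext i
      fin_cases i
      · simp [h.1.1]
      · simp [h.1.2]
      · simp [h.2.1]
      · simp [h.2.2]
  calc _ = B.card * n.factorial := by
        rw [← h]
        congr 2
        ext π
        simp [B]
    _ ≤ _ := Nat.mul_le_mul_right _ h1

open Classical in
theorem second_moment {n a : ℕ} (hn : 10 ≤ n) (S : Finset (Fin n × Fin n)) (hS : ∀ z ∈ S, z.1 ≠ z.2)
    (x y : Fin a → Fin n) (hx : Function.Injective x) (hy : Function.Injective y)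
    (hxy : ∀ k l, x k ≠ y l) (μ : ℝ) (hμ : μ = a * S.card / (n * (n - 1))) (hpos : 0 < μ) :
    ((Finset.univ.filter (fun π : Perm (Fin n) => ∀ k, (π (x k), π (y k)) ∉ S)).card : ℝ)
      ≤ n.factorial * (1 / μ + 20 / n) := by
  set N : ℝ := ((n.factorial : ℕ) : ℝ) with hN
  have hNpos : 0 < N := by rw [hN]; exact_mod_cast n.factorial_pos
  have hnr : (10:ℝ) ≤ n := by exact_mod_cast hn
  have hd2 : ((n.descFactorial 2 : ℕ) : ℝ) = n * (n - 1) := by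
    obtain ⟨m, rfl⟩ := Nat.exists_eq_add_of_le hn
    simp [Nat.descFactorial]
    ring
  have hd4 : ((n.descFactorial 4 : ℕ) : ℝ) = n * (n - 1) * (n - 2) * (n - 3) := by
    simp [Nat.descFactorial]
    rw [Nat.cast_sub (by omega), Nat.cast_sub (by omega), Nat.cast_sub (by omega)]; push_cast; ring
  set s : ℝ := ((S.card : ℕ) : ℝ) with hs
  have hA : ∀ k, ((Finset.univ.filter (fun π : Perm (Fin n) => (π (x k), π (y k)) ∈ S)).card : ℝ)
      = N * (s / (n * (n - 1))) := by
    intro k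
    have h := card_A2 S hS (x k) (y k) (hxy k k)
    have h' : ((Finset.univ.filter (fun π : Perm (Fin n) => (π (x k), π (y k)) ∈ S)).card : ℝ) *
      (n.descFactorial 2 : ℕ) = s * N := by rw [hs, hN]; exact_mod_cast h
    rw [hd2] at h'
    have : (n : ℝ) * (n - 1) ≠ 0 := by nlinarith
    rw [← mul_div_assoc, eq_div_iff this, h', mul_comm]
  have hAA : ∀ k l, k ≠ l → ((Finset.univ.filter (fun π : Perm (Fin n) =>
      (π (x k), π (y k)) ∈ S ∧ (π (x l), π (y l)) ∈ S)).card : ℝ)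
      ≤ N * (s ^ 2 / (n * (n - 1) * (n - 2) * (n - 3))) := by
    intro k l hkl
    let f : Fin 4 ↪ Fin n := ⟨![x k, y k, x l, y l], by
      have h1 := hx.ne hkl
      have h2 := hy.ne hkl
      have h3 := hxy k k
      have h4 := hxy k l
      have h5 := hxy l k
      have h6 := hxy l l
      intro i j; fin_cases i <;> fin_cases j <;> simp [h1, h2, h3, h4, h5, h6, h1.symm, h2.symm, h3.symm, h4.symm, h5.symm, h6.symm]⟩
    have h := card_A4 S f
    have h' : ((Finset.univ.filter (fun π : Perm (Fin n) => (π (x k), π (y k)) ∈ S ∧ (π (x l), π (y l)) ∈ S)).card : ℝ) *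
      (n.descFactorial 4 : ℕ) ≤ s ^ 2 * N := by rw [hs, hN]; exact_mod_cast h
    rw [hd4] at h'
    have : 0 < (n : ℝ) * (n - 1) * (n - 2) * (n - 3) := by
      have h1 : (0:ℝ) < n := by linarith
      have h2 : (0:ℝ) < n - 1 := by linarith
      have h3 : (0:ℝ) < n - 2 := by linarith
      have h4 : (0:ℝ) < n - 3 := by linarith
      positivity
    rw [← mul_div_assoc, le_div_iff₀ this]
    linarith
  let I : Fin a → Perm (Fin n) → ℝ := fun k π => if (π (x k), π (y k)) ∈ S then 1 else 0
  let X : Perm (Fin n) → ℝ := fun π => ∑ k, I k π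
  have hEX : ∑ π, X π = N * μ := by
    simp only [X]
    rw [Finset.sum_comm]
    simp only [I, Finset.sum_boole, hA]
    rw [hμ]
    simp only [Finset.sum_const, Finset.card_univ, Fintype.card_fin, nsmul_eq_mul]
    ring
  have hEX2 : ∑ π, X π ^ 2 ≤ N * (μ + a ^ 2 * (s ^ 2 / (n * (n - 1) * (n - 2) * (n - 3)))) := by
    have h1 : ∀ π, X π ^ 2 = ∑ k, ∑ l, I k π * I l π := by
      intro π
      rw [sq, Finset.sum_mul_sum]
    simp only [h1]
    rw [Finset.sum_comm]
    have h2 : ∀ k, ∑ π, ∑ l, I k π * I l π ≤ N * (s / (n * (n - 1))) + a * (N * (s ^ 2 / (n * (n - 1) * (n - 2) * (n - 3)))) := by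
      intro k
      rw [Finset.sum_comm]
      rw [← Finset.add_sum_erase _ _ (Finset.mem_univ k)]
      have hnn : 0 ≤ N * (s ^ 2 / (n * (n - 1) * (n - 2) * (n - 3))) := by
        have h1 : (0:ℝ) < n := by linarith
        have h2 : (0:ℝ) < n - 1 := by linarith
        have h3 : (0:ℝ) < n - 2 := by linarith
        have h4 : (0:ℝ) < n - 3 := by linarith
        positivity
      apply add_le_add
      · rw [← hA k, ← Finset.sum_boole]
        apply le_of_eq
        apply Finset.sum_congr rfl
        intro π _
        simp only [I]; split_ifs <;> simp
      · calc _ ≤ ∑ l ∈ Finset.univ.erase k, N * (s ^ 2 / (n * (n - 1) * (n - 2) * (n - 3))) := by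
              apply Finset.sum_le_sum
              intro l hl
              refine le_trans (le_of_eq ?_) (hAA k l (Finset.ne_of_mem_erase hl).symm)
              rw [← Finset.sum_boole]
              apply Finset.sum_congr rfl
              intro π _
              simp only [I, ← ite_and, ite_mul, one_mul, zero_mul]
          _ ≤ ∑ l : Fin a, N * (s ^ 2 / (n * (n - 1) * (n - 2) * (n - 3))) := by
              apply Finset.sum_le_sum_of_subset_of_nonneg (Finset.erase_subset _ _)
              intros; exact hnn
          _ = _ := by simp
    refine (Finset.sum_le_sum (fun k _ => h2 k)).trans (le_of_eq ?_)
    rw [hμ]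
    simp only [Finset.sum_const, Finset.card_univ, Fintype.card_fin, nsmul_eq_mul]
    ring
  set bad := Finset.univ.filter (fun π : Perm (Fin n) => ∀ k, (π (x k), π (y k)) ∉ S) with hbad
  have hcheb : (bad.card : ℝ) * μ ^ 2 ≤ ∑ π, (X π - μ) ^ 2 := by
    calc (bad.card : ℝ) * μ ^ 2 = ∑ π ∈ bad, (X π - μ) ^ 2 := by
          rw [← nsmul_eq_mul, ← Finset.sum_const]
          apply Finset.sum_congr rfl
          intro π hπ
          simp only [hbad, Finset.mem_filter, Finset.mem_univ, true_and] at hπ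
          simp [X, I, hπ]
      _ ≤ _ := Finset.sum_le_sum_of_subset_of_nonneg (Finset.subset_univ _) (fun _ _ _ => sq_nonneg _)
  have hexp : ∑ π, (X π - μ) ^ 2 = ∑ π, X π ^ 2 - 2 * μ * ∑ π, X π + N * μ ^ 2 := by
    have : ∀ π, (X π - μ) ^ 2 = X π ^ 2 - 2 * μ * X π + μ ^ 2 := by intro π; ring
    simp only [this, Finset.sum_add_distrib, Finset.sum_sub_distrib, ← Finset.mul_sum]
    simp [Fintype.card_perm, hN]
  have hrat : (a:ℝ) ^ 2 * (s ^ 2 / (n * (n - 1) * (n - 2) * (n - 3))) ≤ μ ^ 2 * (1 + 20 / n) := by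
    have h1 : (0:ℝ) < n := by linarith
    have h2 : (0:ℝ) < n - 1 := by linarith
    have h3 : (0:ℝ) < n - 2 := by linarith
    have h4 : (0:ℝ) < n - 3 := by linarith
    have e : (a:ℝ) ^ 2 * (s ^ 2 / (n * (n - 1) * (n - 2) * (n - 3)))
      = μ ^ 2 * ((n * (n - 1)) / ((n - 2) * (n - 3))) := by
      rw [hμ]; field_simp
    rw [e]
    apply mul_le_mul_of_nonneg_left _ (sq_nonneg _)
    rw [div_le_iff₀ (by positivity)]
    have : (1 + 20 / (n:ℝ)) * ((n - 2) * (n - 3)) = ((n + 20) * ((n - 2) * (n - 3))) / n := by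
      field_simp
    rw [this, le_div_iff₀ h1]
    nlinarith [mul_nonneg h1.le (sub_nonneg.2 hnr)]
  have hfin : (bad.card : ℝ) * μ ^ 2 ≤ N * (1 / μ + 20 / n) * μ ^ 2 := by
    have e : N * (1 / μ + 20 / n) * μ ^ 2 = N * (μ + μ ^ 2 * (1 + 20 / n)) - N * μ ^ 2 := by
      field_simp; ring
    rw [e]
    have := mul_le_mul_of_nonneg_left hrat hNpos.le
    rw [hEX] at hexp
    nlinarith
  exact le_of_mul_le_mul_right hfin (by positivity)

def labF (L m : ℕ) (cut : ℕ → ℕ) (p : ℕ) : ℕ :=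
  if p / L < m then (if p ≤ cut (p / L) then p / L else if p / L + 1 = m then 0 else p / L + 1) else 0

theorem labF_succ (L m : ℕ) (cut : ℕ → ℕ) (hL : 2 ≤ L)
    (hcut : ∀ q < m, L * q ≤ cut q ∧ cut q + 1 < L * (q + 1)) (p : ℕ)
    (hp : ¬ (p / L < m ∧ p = cut (p / L))) : labF L m cut (p + 1) = labF L m cut p := by
  unfold labF
  have hL0 : 0 < L := by omega
  have h1 := Nat.div_add_mod p L
  have h2 := Nat.mod_lt p hL0
  generalize hq : p / L = q at *
  by_cases hlast : p % L + 1 = L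
  · have h3 : (p + 1) / L = q + 1 := by
      rw [Nat.div_eq_iff hL0]
      constructor <;> grind
    rw [h3]
    by_cases hqm : q < m
    · have hc := hcut q hqm
      have : ¬ p ≤ cut q := by grind
      by_cases hq1 : q + 1 < m
      · have hc := hcut (q+1) hq1
        have : p + 1 ≤ cut (q+1) := by grind
        grind
      · grind
    · grind
  · have h3 : (p + 1) / L = q := by
      rw [Nat.div_eq_iff hL0]
      constructor <;> grind
    rw [h3]
    grind

theorem labF_last (L n : ℕ) (cut : ℕ → ℕ) (hL : 2 ≤ L) (hn : L ≤ n)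
    (hcut : ∀ q < n / L, L * q ≤ cut q ∧ cut q + 1 < L * (q + 1)) :
    labF L (n / L) cut (n - 1) = 0 := by
  unfold labF
  have hL0 : 0 < L := by omega
  have hm : 0 < n / L := Nat.div_pos hn hL0
  have h1 := Nat.div_add_mod (n-1) L
  have h2 := Nat.mod_lt (n-1) hL0
  have h3 := Nat.div_add_mod n L
  have h4 := Nat.mod_lt n hL0
  split_ifs with h5 h6
  · exfalso
    have := hcut _ h5
    have h7 : L * ((n-1)/L + 1) ≤ L * (n / L) := Nat.mul_le_mul_left _ h5
    omega
  · rfl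
  · exfalso
    have h8 : (n-1)/L + 1 + 1 ≤ n / L := by omega
    have h7 : L * ((n-1)/L + 1 + 1) ≤ L * (n / L) := Nat.mul_le_mul_left _ h8
    grind
  · rfl

theorem labF_zero (L m : ℕ) (cut : ℕ → ℕ) : labF L m cut 0 = 0 := by
  simp [labF]

theorem labF_range (L m : ℕ) (cut : ℕ → ℕ) (p n : ℕ) (hm : m = n / L) (hp : p < n) :
    p / L ∈ ({labF L m cut p, labF L m cut p - 1, m, m - 1} : Finset ℕ) := by
  have : p / L ≤ m := by rw [hm]; exact Nat.div_le_div_right hp.le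
  unfold labF
  simp only [Finset.mem_insert, Finset.mem_singleton]
  grind

open Classical in
noncomputable def safeS (a n : ℕ) : Finset (Fin n × Fin n) :=
  Finset.univ.filter (fun z => z.1 ≠ z.2 ∧ (z.1 : ℕ) / (4 * a) = (z.2 : ℕ) / (4 * a) ∧
    (z.1 : ℕ) % (4 * a) < 2 * a ∧ (z.2 : ℕ) % (4 * a) < 2 * a)

theorem pos_lt {a n q k : ℕ} (hq : q < n / (4 * a)) (hk : k < a) :
    4 * a * q + 2 * a + 2 * k + 1 < n := by
  have h3 := Nat.div_mul_le_self n (4 * a)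
  have h7 : (q + 1) * (4 * a) ≤ n / (4 * a) * (4 * a) := Nat.mul_le_mul_right _ hq
  grind

def GoodP (a n : ℕ) (π : Perm (Fin n)) : Prop :=
  ∀ q : Fin (n / (4 * a)), ∃ k : Fin a,
    (π ⟨4 * a * q + 2 * a + 2 * k, Nat.lt_of_succ_lt (pos_lt q.2 k.2)⟩,
     π ⟨4 * a * q + 2 * a + 2 * k + 1, pos_lt q.2 k.2⟩) ∈ safeS a n

theorem rot_succ {n : ℕ} (x : Fin n) (h : (x : ℕ) + 1 < n) : ((finRotate n x : Fin n) : ℕ) = x + 1 := by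
  obtain ⟨n', rfl⟩ : ∃ n', n = n' + 1 := ⟨n - 1, by omega⟩
  apply coe_finRotate_of_ne_last
  intro h'
  rw [h'] at h
  simp at h

theorem rot_last {n : ℕ} (x : Fin n) (h : (x : ℕ) + 1 = n) : ((finRotate n x : Fin n) : ℕ) = 0 := by
  obtain ⟨n', rfl⟩ : ∃ n', n = n' + 1 := ⟨n - 1, by omega⟩
  have : x = Fin.last n' := by apply Fin.ext; simp; omega
  rw [this, finRotate_last]; rfl

theorem det_part {r n a : ℕ} (ha : 1 ≤ a) (hn : 4 * a ≤ n) (τ : Fin r → Perm (Fin n))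
    (nx : Fin r → Fin r) (hg : ∀ i, GoodP a n ((τ (nx i))⁻¹ * τ i)) :
    ∃ c : Fin r × Fin n → Fin r, ∀ (j : Fin r) (v : Fin n),
      ((SimpleGraph.fromRel
        (fun u w => ∃ i : Fin r, (τ i * finRotate n * (τ i)⁻¹) u = w ∧ c (i, u) = j)).connectedComponentMk
          v).supp.ncard ≤ 16 * a := by
  classical
  set L := 4 * a with hL
  set m := n / L with hm
  choose k hk using hg
  let cut : Fin r → ℕ → ℕ := fun i q => if h : q < m then L * q + 2 * a + 2 * (k i ⟨q, h⟩ : ℕ) else 0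
  have hcut : ∀ i, ∀ q < m, L * q + 2 * a ≤ cut i q ∧ cut i q + 1 < L * (q + 1) := by
    intro i q hq
    simp only [cut, hq, dif_pos]
    have := (k i ⟨q, hq⟩).2
    constructor
    · omega
    · rw [mul_add]; omega
  have hcut' : ∀ i, ∀ q < m, L * q ≤ cut i q ∧ cut i q + 1 < L * (q + 1) := by
    intro i q hq
    have := hcut i q hq
    omega
  let isCut : Fin r → Fin n → Prop := fun i v =>
    (((τ i)⁻¹ v : Fin n) : ℕ) / L < m ∧ (((τ i)⁻¹ v : Fin n) : ℕ) = cut i ((((τ i)⁻¹ v : Fin n) : ℕ) / L)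
  refine ⟨fun z => if isCut z.1 z.2 then nx z.1 else z.1, ?_⟩
  intro j v
  let lab : Fin n → ℕ := fun v => labF L m (cut j) (((τ j)⁻¹ v : Fin n) : ℕ)
  have hstep : ∀ u w, (∃ i : Fin r, (τ i * finRotate n * (τ i)⁻¹) u = w ∧
      (if isCut i u then nx i else i) = j) → lab u = lab w := by
    rintro u w ⟨i, hw, hc⟩
    by_cases hcu : isCut i u
    · rw [if_pos hcu] at hc
      obtain ⟨hq, he⟩ := hcu
      set x := (τ i)⁻¹ u with hx
      set q := (x : ℕ) / L with hqdef
      have hk' := hk i ⟨q, hq⟩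
      simp only [cut, hq, dif_pos] at he
      have hx1 : (⟨4 * a * q + 2 * a + 2 * (k i ⟨q, hq⟩ : ℕ), Nat.lt_of_succ_lt (pos_lt hq (k i ⟨q, hq⟩).2)⟩ : Fin n) = x := by
        apply Fin.ext; exact he.symm
      have hx2 : (⟨4 * a * q + 2 * a + 2 * (k i ⟨q, hq⟩ : ℕ) + 1, pos_lt hq (k i ⟨q, hq⟩).2⟩ : Fin n) = finRotate n x := by
        apply Fin.ext
        have hlt := pos_lt hq (k i ⟨q, hq⟩).2
        have he' : (x : ℕ) = 4 * a * q + 2 * a + 2 * (k i ⟨q, hq⟩ : ℕ) := he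
        rw [rot_succ x (by omega)]
        simp only; omega
      simp only at hk'
      rw [hx1, hx2, hc] at hk'
      have e1 : ((τ j)⁻¹ * τ i) x = (τ j)⁻¹ u := by simp [hx]
      have e2 : ((τ j)⁻¹ * τ i) (finRotate n x) = (τ j)⁻¹ w := by rw [← hw]; simp [hx]
      rw [e1, e2] at hk'
      simp only [safeS, Finset.mem_filter, Finset.mem_univ, true_and] at hk'
      obtain ⟨-, h1, h2, h3⟩ := hk'
      simp only [lab]
      generalize ((((τ j)⁻¹ u : Fin n)) : ℕ) = s at *
      generalize ((((τ j)⁻¹ w : Fin n)) : ℕ) = t at *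
      rw [← hL] at h1 h2 h3
      unfold labF
      rw [← h1]
      by_cases hsm : s / L < m
      · have := hcut j _ hsm
        have d1 := Nat.div_add_mod s L
        have d2 := Nat.div_add_mod t L
        rw [← h1] at d2
        rw [if_pos hsm, if_pos hsm, if_pos (by omega), if_pos (by omega)]
      · rw [if_neg hsm, if_neg hsm]
    · rw [if_neg hcu] at hc
      subst hc
      simp only [lab]
      have e2 : (τ i)⁻¹ w = finRotate n ((τ i)⁻¹ u) := by rw [← hw]; simp
      rw [e2]
      simp only [isCut] at hcu
      generalize (τ i)⁻¹ u = x at *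
      by_cases hxl : (x : ℕ) + 1 = n
      · rw [rot_last x hxl, labF_zero]
        have := labF_last L n (cut i) (by omega) hn (hcut' i)
        have e : (x : ℕ) = n - 1 := by omega
        rw [e]; exact this
      · have := x.2
        rw [rot_succ x (by omega)]
        exact (labF_succ L m (cut i) (by omega) (hcut' i) _ hcu).symm
  have hreach : ∀ w, w ∈ ((SimpleGraph.fromRel
        (fun u w => ∃ i : Fin r, (τ i * finRotate n * (τ i)⁻¹) u = w ∧
          (if isCut i u then nx i else i) = j)).connectedComponentMk v).supp → lab w = lab v := by
    intro w hw
    rw [SimpleGraph.ConnectedComponent.mem_supp_iff, SimpleGraph.ConnectedComponent.eq] at hw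
    obtain ⟨p⟩ := hw
    induction p with
    | nil => rfl
    | cons h _ ih =>
      rw [← ih]
      rw [SimpleGraph.fromRel_adj] at h
      rcases h.2 with h | h
      · exact hstep _ _ h
      · exact (hstep _ _ h).symm
  let T : Finset ℕ := {lab v, lab v - 1, m, m - 1}
  have hT : T.card ≤ 4 := Finset.card_le_four
  calc _ ≤ ((Finset.univ.filter (fun w => lab w = lab v) : Finset (Fin n)) : Set (Fin n)).ncard := by
        apply Set.ncard_le_ncard _ (Set.toFinite _)
        intro w hw
        simp only [Finset.coe_filter, Finset.mem_univ, true_and]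
        exact hreach w hw
    _ = (Finset.univ.filter (fun w => lab w = lab v) : Finset (Fin n)).card := Set.ncard_coe_finset _
    _ ≤ (T ×ˢ Finset.range L).card := by
        refine Finset.card_le_card_of_injOn
          (fun w => ((((τ j)⁻¹ w : Fin n) : ℕ) / L, (((τ j)⁻¹ w : Fin n) : ℕ) % L)) ?_ ?_
        · intro w hw
          simp only [Finset.coe_filter, Finset.mem_univ, true_and, Set.mem_ofPred_eq] at hw
          simp only [Finset.coe_product, Set.mem_prod, Finset.mem_coe, Finset.mem_range]
          refine ⟨?_, Nat.mod_lt _ (by omega)⟩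
          have := labF_range L m (cut j) (((τ j)⁻¹ w : Fin n) : ℕ) n hm (Fin.is_lt _)
          simp only [T]
          rw [← hw]
          exact this
        · intro w _ w' _ h
          simp only [Prod.mk.injEq] at h
          have d1 := Nat.div_add_mod (((τ j)⁻¹ w : Fin n) : ℕ) L
          have d2 := Nat.div_add_mod (((τ j)⁻¹ w' : Fin n) : ℕ) L
          rw [h.1, h.2, d2] at d1
          exact (τ j)⁻¹.injective (Fin.ext d1.symm)
    _ ≤ 4 * L := by
        rw [Finset.card_product, Finset.card_range]
        exact Nat.mul_le_mul_right _ hT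
    _ = 16 * a := by omega

theorem safeS_card {a n : ℕ} (ha : 1 ≤ a) : n / (4 * a) * (a * a) ≤ (safeS a n).card := by
  classical
  have key : ∀ q : Fin (n / (4 * a)), 4 * a * q + 4 * a ≤ n := by
    intro q
    have h3 := Nat.div_mul_le_self n (4 * a)
    have h7 : (q + 1) * (4 * a) ≤ n / (4 * a) * (4 * a) := Nat.mul_le_mul_right _ q.2
    grind
  let f : Fin (n / (4 * a)) × Fin a × Fin a → Fin n × Fin n := fun z =>
    (⟨4 * a * z.1 + z.2.1, by have := key z.1; have := z.2.1.2; omega⟩,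
     ⟨4 * a * z.1 + (a + z.2.2), by have := key z.1; have := z.2.2.2; omega⟩)
  have h : (Finset.univ : Finset (Fin (n / (4 * a)) × Fin a × Fin a)).card ≤ (safeS a n).card := by
    refine Finset.card_le_card_of_injOn f ?_ ?_
    · rintro ⟨q, u, w⟩ _
      have hu := u.2
      have hw := w.2
      simp only [safeS, f, Finset.coe_filter, Finset.mem_univ, true_and, Set.mem_ofPred_eq, ne_eq, Fin.mk.injEq]
      have e1 : (u : ℕ) / (4 * a) = 0 := Nat.div_eq_of_lt (by omega)
      have e2 : (a + w : ℕ) / (4 * a) = 0 := Nat.div_eq_of_lt (by omega)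
      refine ⟨by omega, ?_, ?_, ?_⟩
      · rw [Nat.mul_add_div (by omega), Nat.mul_add_div (by omega), e1, e2]
      · rw [Nat.mul_add_mod, Nat.mod_eq_of_lt (by omega)]; omega
      · rw [Nat.mul_add_mod, Nat.mod_eq_of_lt (by omega)]; omega
    · rintro ⟨q, u, w⟩ _ ⟨q', u', w'⟩ _ h
      simp only [f, Prod.mk.injEq, Fin.mk.injEq] at h
      obtain ⟨h1, h2⟩ := h
      have hu := u.2
      have hu' := u'.2
      have hq : (q : ℕ) = q' := by
        have := congrArg (· / (4 * a)) h1
        rw [Nat.mul_add_div (by omega), Nat.mul_add_div (by omega)] at this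
        have e1 : (u : ℕ) / (4 * a) = 0 := Nat.div_eq_of_lt (by omega)
        have e2 : (u' : ℕ) / (4 * a) = 0 := Nat.div_eq_of_lt (by omega)
        rw [e1, e2] at this
        simpa using this
      rw [hq] at h1 h2
      have hu : (u : ℕ) = u' := by omega
      have hw : (w : ℕ) = w' := by omega
      simp [Fin.ext_iff, hq, hu, hw]
  simpa using h

open Classical in
theorem bad_count {a n : ℕ} (ha : 1 ≤ a) (hn : 4 * a ≤ n) (hn10 : 10 ≤ n) :
    ((Finset.univ.filter (fun π : Perm (Fin n) => ¬ GoodP a n π)).card : ℝ)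
      ≤ n.factorial * (2 * n ^ 2 / a ^ 3 + 5 / a) := by
  have har : (1:ℝ) ≤ a := by exact_mod_cast ha
  have hnr : (10:ℝ) ≤ n := by exact_mod_cast hn10
  have hap : (0:ℝ) < a := by linarith
  have hnp : (0:ℝ) < n := by linarith
  have hNpos : (0:ℝ) < (n.factorial : ℕ) := by exact_mod_cast n.factorial_pos
  set m := n / (4 * a) with hm
  have hm1 : 1 ≤ m := Nat.div_pos hn (by omega)
  have hmu : (m : ℝ) ≤ n / (4 * a) := by
    have := Nat.div_mul_le_self n (4 * a)
    rw [le_div_iff₀ (by positivity)]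
    exact_mod_cast this
  have hml : (n : ℝ) ≤ 8 * a * m := by
    have h1 := Nat.div_add_mod n (4 * a)
    have h2 := Nat.mod_lt n (show 4 * a > 0 by omega)
    have h3 : a * 1 ≤ a * m := Nat.mul_le_mul_left _ hm1
    have : n ≤ 8 * a * m := by grind
    exact_mod_cast this
  have hs : (m : ℝ) * (a * a) ≤ (safeS a n).card := by exact_mod_cast safeS_card (n := n) ha
  set μ : ℝ := a * (safeS a n).card / (n * (n - 1)) with hμ
  have hμl : (a:ℝ) ^ 2 / (8 * n) ≤ μ := by
    rw [hμ, div_le_div_iff₀ (by positivity) (by nlinarith)]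
    have h1 : (n : ℝ) * a ≤ 8 * (safeS a n).card := by nlinarith
    have h2 : (n : ℝ) * (n - 1) ≤ n * n := by nlinarith
    have g1 : (a:ℝ) ^ 2 * (n * (n - 1)) ≤ (a:ℝ) ^ 2 * (n * n) := by gcongr
    have g2 : (a:ℝ) * n * (n * a) ≤ (a:ℝ) * n * (8 * ((safeS a n).card : ℝ)) := by gcongr
    linarith
  have hμpos : 0 < μ := lt_of_lt_of_le (by positivity) hμl
  have hμi : 1 / μ ≤ 8 * n / a ^ 2 := by
    rw [div_le_div_iff₀ hμpos (by positivity)]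
    rw [div_le_iff₀ (by positivity)] at hμl
    linarith
  have hone : ∀ q : Fin m, ((Finset.univ.filter (fun π : Perm (Fin n) => ∀ k : Fin a,
    (π ⟨4 * a * q + 2 * a + 2 * k, Nat.lt_of_succ_lt (pos_lt q.2 k.2)⟩,
     π ⟨4 * a * q + 2 * a + 2 * k + 1, pos_lt q.2 k.2⟩) ∉ safeS a n)).card : ℝ)
      ≤ n.factorial * (8 * n / a ^ 2 + 20 / n) := by
    intro q
    have h := second_moment hn10 (safeS a n) (by
        intro z hz
        simp only [safeS, Finset.mem_filter] at hz
        exact hz.2.1)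
      (fun k : Fin a => ⟨4 * a * q + 2 * a + 2 * k, Nat.lt_of_succ_lt (pos_lt q.2 k.2)⟩)
      (fun k : Fin a => ⟨4 * a * q + 2 * a + 2 * k + 1, pos_lt q.2 k.2⟩)
      (by intro k l h; simp only [Fin.mk.injEq] at h; apply Fin.ext; omega)
      (by intro k l h; simp only [Fin.mk.injEq] at h; apply Fin.ext; omega)
      (by intro k l h; simp only [Fin.mk.injEq] at h; omega) μ hμ hμpos
    refine h.trans ?_
    gcongr
  calc ((Finset.univ.filter (fun π : Perm (Fin n) => ¬ GoodP a n π)).card : ℝ)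
      ≤ ((Finset.univ.biUnion (fun q : Fin m => Finset.univ.filter (fun π : Perm (Fin n) => ∀ k : Fin a,
        (π ⟨4 * a * q + 2 * a + 2 * k, Nat.lt_of_succ_lt (pos_lt q.2 k.2)⟩,
         π ⟨4 * a * q + 2 * a + 2 * k + 1, pos_lt q.2 k.2⟩) ∉ safeS a n))).card : ℝ) := by
        norm_cast
        apply Finset.card_le_card
        intro π hπ
        simp only [Finset.mem_filter, Finset.mem_univ, true_and, GoodP, not_forall, not_exists] at hπ
        obtain ⟨q, hq⟩ := hπ
        simp only [Finset.mem_biUnion, Finset.mem_filter, Finset.mem_univ, true_and]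
        exact ⟨q, hq⟩
    _ ≤ ∑ q : Fin m, ((n.factorial : ℕ) : ℝ) * (8 * n / a ^ 2 + 20 / n) := by
        refine le_trans (Nat.cast_le.2 Finset.card_biUnion_le) ?_
        push_cast
        exact Finset.sum_le_sum (fun q _ => hone q)
    _ = n.factorial * (m * (8 * n / a ^ 2 + 20 / n)) := by
        simp only [Finset.sum_const, Finset.card_univ, Fintype.card_fin, nsmul_eq_mul]; ring
    _ ≤ n.factorial * (n / (4 * a) * (8 * n / a ^ 2 + 20 / n)) := by gcongr
    _ = _ := by congr 1; field_simp; ring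

theorem main_count (r : ℕ) (hr : 2 ≤ r) {a n : ℕ} (ha : 1 ≤ a) (hn : 4 * a ≤ n) (hn10 : 10 ≤ n)
    (p : ℝ) (hp : r * (2 * n ^ 2 / a ^ 3 + 5 / a : ℝ) ≤ 1 - p) (P : (Fin r → Perm (Fin n)) → Prop)
    (hP : ∀ σ, (∃ c : Fin r × Fin n → Fin r, ∀ (j : Fin r) (v : Fin n),
      ((SimpleGraph.fromRel
        (fun u w => ∃ i : Fin r, σ i u = w ∧ c (i, u) = j)).connectedComponentMk
          v).supp.ncard ≤ 16 * a) → P σ) :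
    p * (Nat.card {σ : Fin r → Equiv.Perm (Fin n) //
                ∀ i : Fin r, (σ i).IsCycle ∧ (σ i).support = Finset.univ} : ℝ) ≤
     (Nat.card {σ : Fin r → Equiv.Perm (Fin n) //
            (∀ i : Fin r, (σ i).IsCycle ∧ (σ i).support = Finset.univ) ∧ P σ} : ℝ) := by
  classical
  apply transfer (by omega)
  set ε : ℝ := (2 * n ^ 2 / a ^ 3 + 5 / a : ℝ) with hε
  have hnx : ∀ i : Fin r, finRotate r i ≠ i := by
    obtain ⟨k, rfl⟩ := Nat.exists_eq_add_of_le' hr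
    intro i
    rw [← Equiv.Perm.mem_support, support_finRotate]
    exact Finset.mem_univ _
  have hNpos : (0:ℝ) < (n.factorial : ℕ) := by exact_mod_cast n.factorial_pos
  let Bad := Finset.univ.filter (fun π : Perm (Fin n) => ¬ GoodP a n π)
  let BT : Fin r → Finset (Fin r → Perm (Fin n)) := fun i =>
    Finset.univ.filter (fun τ => (τ (finRotate r i))⁻¹ * τ i ∈ Bad)
  have hBT : ∀ i, ((BT i).card : ℝ) ≤ ε * (n.factorial ^ r : ℕ) := by
    intro i
    have h := card_ratio i (finRotate r i) (hnx i) Bad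
    have h' : ((BT i).card : ℝ) * (n.factorial : ℕ) = Bad.card * (n.factorial ^ r : ℕ) := by
      exact_mod_cast h
    have h2 := bad_count ha hn hn10
    have h3 : (Bad.card : ℝ) * (n.factorial ^ r : ℕ) ≤ (n.factorial * ε) * (n.factorial ^ r : ℕ) := by
      gcongr
    rw [← h'] at h3
    refine le_of_mul_le_mul_right (h3.trans (le_of_eq ?_)) hNpos
    ring
  have hcover : (Finset.univ : Finset (Fin r → Perm (Fin n))) ⊆
     (Finset.univ.filter (fun τ : Fin r → Perm (Fin n) =>
      P (fun i => τ i * finRotate n * (τ i)⁻¹))) ∪ Finset.univ.biUnion BT := by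
    intro τ _
    by_cases h : ∀ i, GoodP a n ((τ (finRotate r i))⁻¹ * τ i)
    · apply Finset.mem_union_left
      simp only [Finset.mem_filter, Finset.mem_univ, true_and]
      apply hP
      exact det_part ha hn τ (finRotate r) h
    · apply Finset.mem_union_right
      push Not at h
      obtain ⟨i, hi⟩ := h
      simp only [Finset.mem_biUnion, Finset.mem_univ, true_and, BT, Bad, Finset.mem_filter]
      exact ⟨i, hi⟩
  have hc := (Finset.card_le_card hcover).trans (Finset.card_union_le _ _)
  have hc2 : ((Finset.univ.biUnion BT).card : ℝ) ≤ r * (ε * (n.factorial ^ r : ℕ)) := by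
    refine le_trans (Nat.cast_le.2 Finset.card_biUnion_le) ?_
    push_cast
    refine (Finset.sum_le_sum (fun i _ => hBT i)).trans (le_of_eq ?_)
    simp
  simp only [Finset.card_univ, Fintype.card_pi, Fintype.card_perm, Fintype.card_fin, Finset.prod_const] at hc
  have hc' : ((n.factorial ^ r : ℕ) : ℝ) ≤ ((Finset.univ.filter (fun τ : Fin r → Perm (Fin n) =>
      P (fun i => τ i * finRotate n * (τ i)⁻¹))).card : ℝ) + ((Finset.univ.biUnion BT).card : ℝ) := by
    exact_mod_cast hc
  have h4 : r * ε * (n.factorial ^ r : ℕ) ≤ (1 - p) * (n.factorial ^ r : ℕ) :=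
    mul_le_mul_of_nonneg_right hp (Nat.cast_nonneg _)
  linarith

end HamCol

/-- Fix an integer `r ≥ 2`. There is a constant `K > 0` such that the following
holds with high probability as `n → ∞`.  Let `σ₁, …, σ_r` be independent uniformly random
`n`-cycles on `[n]` (permutations of `Fin n` that are a single cycle with full support),
inducing Hamilton cycles `H_i` with edges `{v, σ_i v}`.  Then there is a coloring
`c : Fin r × Fin n → Fin r` (where `c (i, v)` colors the edge `{v, σ_i v}` of `H_i`) such that
for every color `j`, every connected component of the graph on `[n]` whose edges are the pairs
`{v, σ_i v}` with `c (i, v) = j` has at most `K · n^0.7` vertices.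

The uniform model is expressed by counting tuples `σ : Fin r → Equiv.Perm (Fin n)` with each
`σ i` an `n`-cycle: for every `p < 1`, eventually the number of good tuples is at least `p`
times the total number of tuples. -/
theorem stmt_4 (r : ℕ) (hr : 2 ≤ r) :
    ∃ K : ℝ, 0 < K ∧
      ∀ p : ℝ, p < 1 → ∃ N : ℕ, ∀ n : ℕ, N ≤ n →
        p * (Nat.card {σ : Fin r → Equiv.Perm (Fin n) //
                ∀ i : Fin r, (σ i).IsCycle ∧ (σ i).support = Finset.univ} : ℝ) ≤
        (Nat.card {σ : Fin r → Equiv.Perm (Fin n) //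
            (∀ i : Fin r, (σ i).IsCycle ∧ (σ i).support = Finset.univ) ∧
            ∃ c : Fin r × Fin n → Fin r, ∀ (j : Fin r) (v : Fin n),
              ((((SimpleGraph.fromRel
                  (fun u w => ∃ i : Fin r, σ i u = w ∧ c (i, u) = j)).connectedComponentMk
                    v).supp.ncard : ℝ))
                ≤ K * (n : ℝ) ^ (0.7 : ℝ)} : ℝ) := by
  refine ⟨32, by norm_num, ?_⟩
  intro p hp
  have t1 : Filter.Tendsto (fun n : ℕ => (r : ℝ) * (2 * (n : ℝ) ^ (-(0.1 : ℝ)) + 5 * (n : ℝ) ^ (-(0.7 : ℝ))))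
      Filter.atTop (nhds ((r : ℝ) * (2 * 0 + 5 * 0))) := by
    have a1 := (tendsto_rpow_neg_atTop (show (0:ℝ) < 0.1 by norm_num)).comp (tendsto_natCast_atTop_atTop (R := ℝ))
    have a2 := (tendsto_rpow_neg_atTop (show (0:ℝ) < 0.7 by norm_num)).comp (tendsto_natCast_atTop_atTop (R := ℝ))
    exact ((a1.const_mul 2).add (a2.const_mul 5)).const_mul (r : ℝ)
  have t2 : Filter.Tendsto (fun n : ℕ => (n : ℝ) ^ (-(0.3 : ℝ))) Filter.atTop (nhds 0) :=
    (tendsto_rpow_neg_atTop (show (0:ℝ) < 0.3 by norm_num)).comp (tendsto_natCast_atTop_atTop (R := ℝ))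
  have e1 := t1.eventually (gt_mem_nhds (show (r : ℝ) * (2 * 0 + 5 * 0) < 1 - p by linarith))
  have e2 := t2.eventually (gt_mem_nhds (show (0:ℝ) < 1 / 8 by norm_num))
  obtain ⟨N, hN⟩ := Filter.eventually_atTop.1 (e1.and (e2.and (Filter.eventually_ge_atTop 10)))
  refine ⟨N, fun n hn => ?_⟩
  obtain ⟨h1, h2, h10⟩ := hN n hn
  have hn1 : (1:ℝ) ≤ n := by exact_mod_cast (by omega : 1 ≤ n)
  have hnp : (0:ℝ) < n := by linarith
  set y : ℝ := (n : ℝ) ^ (0.7 : ℝ) with hy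
  have hy1 : 1 ≤ y := Real.one_le_rpow hn1 (by norm_num)
  set a : ℕ := ⌈y⌉₊ with ha
  have hay : y ≤ a := Nat.le_ceil y
  have hay2 : (a : ℝ) ≤ 2 * y := by
    have := Nat.ceil_lt_add_one (show 0 ≤ y by linarith)
    rw [ha]; linarith
  have ha1 : 1 ≤ a := by exact_mod_cast hy1.trans hay
  have hyn : y = n * (n : ℝ) ^ (-(0.3 : ℝ)) := by
    rw [hy]; nth_rewrite 2 [← Real.rpow_one (n:ℝ)]
    rw [← Real.rpow_add hnp]; norm_num
  have hn4 : 4 * a ≤ n := by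
    have : (4 * a : ℝ) ≤ n := by
      have : y ≤ n * (1 / 8) := by rw [hyn]; gcongr
      linarith
    exact_mod_cast this
  apply HamCol.main_count r hr ha1 hn4 h10 p
  · refine le_trans ?_ h1.le
    have hyp : 0 < y := by linarith
    have b1 : (n : ℝ) ^ (-(0.7 : ℝ)) = 1 / y := by
      rw [hy, Real.rpow_neg hnp.le, one_div]
    have b2 : (n : ℝ) ^ (-(0.1 : ℝ)) = n ^ 2 / y ^ 3 := by
      rw [hy, ← Real.rpow_natCast, ← Real.rpow_natCast, ← Real.rpow_mul hnp.le, ← Real.rpow_sub hnp]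
      norm_num
    rw [b1, b2]
    have c1 : 2 * (n : ℝ) ^ 2 / a ^ 3 ≤ 2 * (n ^ 2 / y ^ 3) := by
      rw [← mul_div_assoc]; gcongr
    have c2 : 5 / (a : ℝ) ≤ 5 * (1 / y) := by
      rw [mul_one_div]; gcongr
    gcongr
    
  · rintro σ ⟨c, hc⟩
    refine ⟨c, fun j v => ?_⟩
    have h := hc j v
    have h' : ((((SimpleGraph.fromRel
                  (fun u w => ∃ i : Fin r, σ i u = w ∧ c (i, u) = j)).connectedComponentMk
                    v).supp.ncard : ℝ)) ≤ 16 * a := by exact_mod_cast h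
    linarith
end

section
/- For each n, partition [n] into m = ⌈n^{0.3}⌉ intervals V_1,…,V_m where V_i = { j : ⌊(i−1)n^{0.7}⌋ + 1 ≤ j ≤ ⌊i·n^{0.7}⌋ } (and V_m absorbs any remainder). Let σ be a uniformly random n-cycle on [n]. Then with high probability as n → ∞, for every vertex v ∈ [n] there exists an integer t with 1 ≤ t ≤ n^{0.4} such that σ^{t−1}(v) and σ^{t}(v) lie in the same part V_i of the partition. Consequently, w.h.p. every segment of length ⌈n^{0.4}⌉ of the cycle σ contains an edge with both endpoints in a common part. -/
/-- The index of the part of the partition `V_1, …, V_m` of `[n]` containing the vertex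
`v ∈ Fin n` (whose 1-based label is `v + 1`), where `m = ⌈n^0.3⌉`,
`V_i = { j : ⌊(i-1)·n^0.7⌋ + 1 ≤ j ≤ ⌊i·n^0.7⌋ }` for `i < m`, and `V_m` absorbs the
remainder.  Since `j` is an integer, `⌊(i-1)·n^0.7⌋ < j ≤ ⌊i·n^0.7⌋` is equivalent to
`i = ⌈j / n^0.7⌉`, capped at `m`. -/
noncomputable def partIdx (n : ℕ) (v : Fin n) : ℕ :=
  min ⌈(n : ℝ) ^ (0.3 : ℝ)⌉₊ ⌈(((v : ℕ) + 1 : ℕ) : ℝ) / (n : ℝ) ^ (0.7 : ℝ)⌉₊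

open Equiv Finset

def BadK {n : ℕ} (f : Fin n → ℕ) (k : ℕ) (τ : Perm (Fin n)) : Prop :=
  ∀ i, i < k → ∀ h : i + 1 < n, f (τ ⟨i, by omega⟩) ≠ f (τ ⟨i + 1, h⟩)

open Classical in
lemma step_aux {n : ℕ} (f : Fin n → ℕ) (c s k : ℕ) (hk : k + 1 < n)
    (hf : ∀ v, f v ≠ c → s ≤ #{u | f u = f v})
    (S : Finset (Perm (Fin n)))
    (hS : ∀ τ ∈ S, ∀ j : Fin n, k + 1 ≤ (j : ℕ) → τ * swap ⟨k + 1, hk⟩ j ∈ S)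
    (hc : ∀ τ ∈ S, f (τ ⟨k, by omega⟩) ≠ c) :
    (n - (k + 1)) * #{τ ∈ S | f (τ ⟨k, by omega⟩) ≠ f (τ ⟨k + 1, hk⟩)} ≤ (n - s) * #S := by
  set a : Fin n := ⟨k, by omega⟩ with ha
  set b : Fin n := ⟨k + 1, hk⟩ with hb
  have hJ : #(Finset.Ici b) = n - (k + 1) := by simp [hb]
  have hab : ∀ j ∈ Finset.Ici b, a ≠ b ∧ a ≠ j := by
    intro j hj
    simp only [Finset.mem_Ici, Fin.le_def, hb] at hj
    simp only [ha, hb, ne_eq, Fin.ext_iff]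
    omega
  have key : ∀ j ∈ Finset.Ici b, #{τ ∈ S | f (τ a) ≠ f (τ b)} = #{τ ∈ S | f (τ a) ≠ f (τ j)} := by
    intro j hj
    obtain ⟨h1, h2⟩ := hab j hj
    have hj' : k + 1 ≤ (j : ℕ) := by simpa [Fin.le_def, hb] using hj
    refine Finset.card_bij' (fun τ _ => τ * swap b j) (fun τ _ => τ * swap b j) ?_ ?_ ?_ ?_
    · intro τ hτ
      simp only [Finset.mem_filter] at hτ ⊢
      refine ⟨hS τ hτ.1 j hj', ?_⟩
      simpa [swap_apply_of_ne_of_ne h1 h2] using hτ.2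
    · intro τ hτ
      simp only [Finset.mem_filter] at hτ ⊢
      refine ⟨hS τ hτ.1 j hj', ?_⟩
      simpa [swap_apply_of_ne_of_ne h1 h2] using hτ.2
    · intro τ _; simp [mul_assoc]
    · intro τ _; simp [mul_assoc]
  calc (n - (k + 1)) * #{τ ∈ S | f (τ a) ≠ f (τ b)}
      = ∑ j ∈ Finset.Ici b, #{τ ∈ S | f (τ a) ≠ f (τ j)} := by
        rw [← Finset.sum_congr rfl key, Finset.sum_const, hJ, smul_eq_mul]
    _ = ∑ τ ∈ S, #{j ∈ Finset.Ici b | f (τ a) ≠ f (τ j)} := by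
        simp only [Finset.card_filter]
        exact Finset.sum_comm
    _ ≤ ∑ τ ∈ S, (n - s) := by
        refine Finset.sum_le_sum fun τ hτ => ?_
        have h1 : #{j ∈ Finset.Ici b | f (τ a) ≠ f (τ j)} ≤ #{u | ¬ f u = f (τ a)} := by
          refine Finset.card_le_card_of_injOn τ ?_ τ.injective.injOn
          intro j hj
          simp only [Finset.coe_filter, Set.mem_ofPred_eq, Finset.mem_univ, true_and] at hj ⊢
          exact fun h => hj.2 h.symm
        have h2 := Finset.card_filter_add_card_filter_not (s := (Finset.univ : Finset (Fin n))) (fun u => f u = f (τ a))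
        have h3 := hf _ (hc τ hτ)
        simp only [Finset.card_univ, Fintype.card_fin] at h2
        omega
    _ = (n - s) * #S := by simp [mul_comm]

lemma BadK.swap_mem {n : ℕ} {f : Fin n → ℕ} {k : ℕ} {τ : Perm (Fin n)} (h : BadK f k τ)
    (hk : k + 1 < n) (j : Fin n) (hj : k + 1 ≤ (j : ℕ)) :
    BadK f k (τ * swap ⟨k + 1, hk⟩ j) := by
  intro i hi h'
  have := h i hi h'
  rw [Perm.mul_apply, Perm.mul_apply, swap_apply_of_ne_of_ne, swap_apply_of_ne_of_ne]
  · exact this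
  all_goals simp only [ne_eq, Fin.ext_iff]; omega

open Classical in
lemma two_step {n : ℕ} (f : Fin n → ℕ) (c s k L : ℕ) (hk : k + 2 ≤ L) (hL : L < n)
    (hf : ∀ v, f v ≠ c → s ≤ #{u | f u = f v}) :
    (n - L) * #{τ | BadK f (k + 2) τ} ≤ (n - s) * #{τ | BadK f k τ} := by
  have h1 : k + 1 < n := by omega
  have h2 : k + 2 < n := by omega
  set a : Fin n := ⟨k, by omega⟩ with ha
  set b : Fin n := ⟨k + 1, h1⟩ with hb
  set d : Fin n := ⟨k + 2, h2⟩ with hd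
  set A : Finset (Perm (Fin n)) := {τ | BadK f k τ ∧ f (τ a) ≠ c} with hA
  set D : Finset (Perm (Fin n)) := {τ | BadK f (k+1) τ ∧ f (τ a) = c} with hD
  have e1 := step_aux f c s k h1 hf A (by
      intro τ hτ j hj
      simp only [hA, Finset.mem_filter, Finset.mem_univ, true_and] at hτ ⊢
      refine ⟨hτ.1.swap_mem h1 j hj, ?_⟩
      rw [Perm.mul_apply, swap_apply_of_ne_of_ne]
      · exact hτ.2
      all_goals simp only [ha, ne_eq, Fin.ext_iff]; omega) (by
      intro τ hτ
      simp only [hA, Finset.mem_filter, Finset.mem_univ, true_and] at hτ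
      exact hτ.2)
  have e2 := step_aux f c s (k + 1) h2 hf D (by
      intro τ hτ j hj
      simp only [hD, Finset.mem_filter, Finset.mem_univ, true_and] at hτ ⊢
      refine ⟨hτ.1.swap_mem h2 j hj, ?_⟩
      rw [Perm.mul_apply, swap_apply_of_ne_of_ne]
      · exact hτ.2
      all_goals simp only [ha, ne_eq, Fin.ext_iff]; omega) (by
      intro τ hτ
      simp only [hD, Finset.mem_filter, Finset.mem_univ, true_and] at hτ
      have := hτ.1 k (by omega) h1
      rw [← ha, hτ.2] at this
      exact this.symm)
  have hsub : ({τ | BadK f (k + 2) τ} : Finset (Perm (Fin n))) ⊆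
      {τ ∈ A | f (τ a) ≠ f (τ b)} ∪ {τ ∈ D | f (τ b) ≠ f (τ d)} := by
    intro τ hτ
    simp only [hA, hD, Finset.mem_union, Finset.mem_filter, Finset.mem_univ, true_and] at hτ ⊢
    by_cases hc : f (τ a) = c
    · exact Or.inr ⟨⟨fun i hi => hτ i (by omega), hc⟩, hτ (k+1) (by omega) h2⟩
    · exact Or.inl ⟨⟨fun i hi => hτ i (by omega), hc⟩, hτ k (by omega) h1⟩
  have hcard := (Finset.card_le_card hsub).trans (Finset.card_union_le _ _)
  have hAD : #A + #D ≤ #{τ | BadK f k τ} := by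
    rw [← Finset.card_union_of_disjoint]
    · apply Finset.card_le_card
      intro τ hτ
      simp only [hA, hD, Finset.mem_union, Finset.mem_filter, Finset.mem_univ, true_and] at hτ ⊢
      rcases hτ with h | h
      · exact h.1
      · exact fun i hi => h.1 i (by omega)
    · rw [Finset.disjoint_left]
      intro τ h h'
      simp only [hA, hD, Finset.mem_filter, Finset.mem_univ, true_and] at h h'
      exact h.2 h'.2
  calc (n - L) * #{τ | BadK f (k + 2) τ}
      ≤ (n - L) * (#{τ ∈ A | f (τ a) ≠ f (τ b)} + #{τ ∈ D | f (τ b) ≠ f (τ d)}) := by gcongr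
    _ = (n - L) * #{τ ∈ A | f (τ a) ≠ f (τ b)} + (n - L) * #{τ ∈ D | f (τ b) ≠ f (τ d)} := by ring
    _ ≤ (n - (k+1)) * #{τ ∈ A | f (τ a) ≠ f (τ b)} + (n - (k+1+1)) * #{τ ∈ D | f (τ b) ≠ f (τ d)} := by
        gcongr <;> omega
    _ ≤ (n - s) * #A + (n - s) * #D := add_le_add e1 e2
    _ = (n - s) * (#A + #D) := by ring
    _ ≤ _ := by gcongr

open Classical in
lemma iter_step {n : ℕ} (f : Fin n → ℕ) (c s L : ℕ) (hL : L < n)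
    (hf : ∀ v, f v ≠ c → s ≤ #{u | f u = f v}) (r : ℕ) (hr : 2 * r ≤ L) :
    (n - L) ^ r * #{τ | BadK f (2 * r) τ} ≤ (n - s) ^ r * n.factorial := by
  induction r with
  | zero =>
    simp only [pow_zero, one_mul]
    refine (Finset.card_le_univ _).trans ?_
    simp [Fintype.card_perm]
  | succ r ih =>
    have h := two_step f c s (2 * r) L (by omega) hL hf
    have ih := ih (by omega)
    calc (n - L) ^ (r+1) * #{τ | BadK f (2 * r + 2) τ}
        = (n - L) ^ r * ((n - L) * #{τ | BadK f (2 * r + 2) τ}) := by ring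
      _ ≤ (n - L) ^ r * ((n - s) * #{τ | BadK f (2 * r) τ}) := by gcongr
      _ = (n - s) * ((n - L) ^ r * #{τ | BadK f (2 * r) τ}) := by ring
      _ ≤ (n - s) * ((n - s) ^ r * n.factorial) := by gcongr
      _ = _ := by ring

open Classical in
lemma bad_le {n : ℕ} (f : Fin n → ℕ) (L : ℕ) (hn : 0 < n) :
    #{σ : Perm (Fin n) | (σ.IsCycle ∧ σ.support = Finset.univ) ∧
      ∃ v, ∀ i < L, f ((σ ^ i) v) ≠ f ((σ ^ (i + 1)) v)} ≤ #{τ | BadK f L τ} := by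
  have H : ∀ σ : Perm (Fin n), ((σ.IsCycle ∧ σ.support = Finset.univ) ∧
      ∃ v, ∀ i < L, f ((σ ^ i) v) ≠ f ((σ ^ (i + 1)) v)) →
      ∃ τ : Perm (Fin n), BadK f L τ ∧ ∃ v, ∀ i : ℕ, ∀ h : i < n, τ ⟨i, h⟩ = (σ ^ i) v := by
    rintro σ ⟨⟨h1, h2⟩, v, hv⟩
    have hcyc : σ.IsCycleOn (Finset.univ : Finset (Fin n)) := by
      have := h1.isCycleOn
      convert this
      ext x
      have : x ∈ σ.support := by rw [h2]; simp
      simpa using this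
    have hinj : Function.Injective (fun i : Fin n => (σ ^ (i : ℕ)) v) := by
      intro i j hij
      have := (hcyc.pow_apply_eq_pow_apply (Finset.mem_univ v)).1 hij
      simp only [Finset.card_univ, Fintype.card_fin] at this
      exact Fin.ext (Nat.ModEq.eq_of_lt_of_lt this i.2 j.2)
    refine ⟨Equiv.ofBijective _ (Finite.injective_iff_bijective.1 hinj), ?_, v, ?_⟩
    · intro i hi h
      exact hv i hi
    · intro i h; rfl
  choose! g hg using H
  refine Finset.card_le_card_of_injOn g ?_ ?_
  · intro σ hσ
    simp only [Finset.coe_filter, Set.mem_ofPred_eq, Finset.mem_univ, true_and] at hσ ⊢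
    exact (hg σ hσ).1
  · intro σ hσ σ' hσ' he
    simp only [Finset.coe_filter, Set.mem_ofPred_eq, Finset.mem_univ, true_and] at hσ hσ'
    obtain ⟨-, v, hv⟩ := hg σ hσ
    obtain ⟨-, v', hv'⟩ := hg σ' hσ'
    have hvv : v = v' := by
      have a := hv 0 hn
      have b := hv' 0 hn
      rw [he] at a
      simpa [a] using b
    subst hvv
    have hord : ∀ ρ : Perm (Fin n), ρ.IsCycle → ρ.support = Finset.univ → ρ ^ n = 1 := by
      intro ρ h1 h2
      have := h1.orderOf
      rw [h2, Finset.card_univ, Fintype.card_fin] at this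
      have h3 := pow_orderOf_eq_one ρ
      rwa [this] at h3
    have hall : ∀ i ≤ n, (σ ^ i) v = (σ' ^ i) v := by
      intro i hi
      rcases hi.lt_or_eq with h | h
      · rw [← hv i h, ← hv' i h, he]
      · rw [h, hord σ hσ.1.1 hσ.1.2, hord σ' hσ'.1.1 hσ'.1.2]
    ext1 x
    obtain ⟨⟨i, hi⟩, rfl⟩ := (g σ).surjective x
    rw [hv i hi, ← Perm.mul_apply, ← pow_succ', hall (i+1) hi, hall i hi.le, ← Perm.mul_apply, ← pow_succ']

open Classical in
lemma card_cyc (n : ℕ) (hn : 2 ≤ n) :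
    #{σ : Perm (Fin n) | σ.IsCycle ∧ σ.support = Finset.univ} = (n - 1).factorial := by
  have h := Equiv.Perm.card_of_cycleType_singleton (α := Fin n) hn (by simp)
  simp only [Fintype.card_fin, Nat.choose_self, mul_one] at h
  rw [← h]
  congr 1
  ext σ
  simp only [Finset.mem_filter, Finset.mem_univ, true_and]
  constructor
  · rintro ⟨h1, h2⟩
    rw [h1.cycleType, h2]; simp
  · intro h
    have h1 : σ.IsCycle := by rw [← Perm.card_cycleType_eq_one, h]; simp
    refine ⟨h1, ?_⟩
    rw [h1.cycleType] at h
    simp only [Multiset.singleton_inj] at h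
    rw [← Finset.card_eq_iff_eq_univ, h, Fintype.card_fin]

open Classical in
lemma part_size (n : ℕ) (v : Fin n) (hv : partIdx n v ≠ ⌈(n : ℝ) ^ (0.3 : ℝ)⌉₊) :
    ⌊(n : ℝ) ^ (0.7 : ℝ)⌋₊ ≤ #{u | partIdx n u = partIdx n v} := by
  have hn : 0 < n := lt_of_le_of_lt (Nat.zero_le _) v.2
  have hn' : (0 : ℝ) < n := by exact_mod_cast hn
  set r : ℝ := (n : ℝ) ^ (0.7 : ℝ) with hr
  set m : ℕ := ⌈(n : ℝ) ^ (0.3 : ℝ)⌉₊ with hm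
  have hr0 : 0 < r := Real.rpow_pos_of_pos hn' _
  have hrm : r * (n : ℝ) ^ (0.3 : ℝ) = n := by
    rw [hr, ← Real.rpow_add hn']; norm_num
  have hlt : partIdx n v < m := lt_of_le_of_ne (min_le_left _ _) hv
  have hpos : 0 < partIdx n v := by
    unfold partIdx
    refine lt_min ?_ ?_
    · exact Nat.ceil_pos.2 (Real.rpow_pos_of_pos hn' _)
    · exact Nat.ceil_pos.2 (by positivity)
  obtain ⟨j, hj⟩ : ∃ j, partIdx n v = j + 1 := ⟨partIdx n v - 1, by omega⟩
  rw [hj] at hlt ⊢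
  have hjr : ((j : ℝ) + 1) * r < n := by
    have : ((j + 1 : ℕ) : ℝ) < (n : ℝ) ^ (0.3 : ℝ) := Nat.lt_ceil.1 hlt
    push_cast at this
    rw [← hrm, mul_comm]
    gcongr
  have hfr : (⌊r⌋₊ : ℝ) ≤ r := Nat.floor_le hr0.le
  have hfj : (⌊(j : ℝ) * r⌋₊ : ℝ) ≤ j * r := Nat.floor_le (by positivity)
  have hfj' : (j : ℝ) * r < ⌊(j : ℝ) * r⌋₊ + 1 := Nat.lt_floor_add_one _
  have hle : ∀ k < ⌊r⌋₊, ((⌊(j : ℝ) * r⌋₊ + k + 1 : ℕ) : ℝ) ≤ ((j : ℝ) + 1) * r := by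
    intro k hk
    have : ((k + 1 : ℕ) : ℝ) ≤ ⌊r⌋₊ := by exact_mod_cast hk
    push_cast at this ⊢
    linarith
  have hlt' : ∀ k < ⌊r⌋₊, ⌊(j : ℝ) * r⌋₊ + k < n := by
    intro k hk
    have := (hle k hk).trans_lt hjr
    have : ⌊(j : ℝ) * r⌋₊ + k + 1 < n := by exact_mod_cast this
    omega
  rw [← Fintype.card_fin ⌊r⌋₊, ← Finset.card_univ]
  refine Finset.card_le_card_of_injOn (fun k => ⟨⌊(j : ℝ) * r⌋₊ + k, hlt' k k.2⟩) ?_ ?_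
  · intro k _
    simp only [Finset.coe_filter, Set.mem_ofPred_eq, Finset.mem_univ, true_and]
    unfold partIdx
    have hc : ⌈((⌊(j : ℝ) * r⌋₊ + (k : ℕ) + 1 : ℕ) : ℝ) / r⌉₊ = j + 1 := by
      rw [Nat.ceil_eq_iff (by omega)]
      constructor
      · rw [lt_div_iff₀ hr0]
        have : (0 : ℝ) ≤ (k : ℕ) := by positivity
        push_cast
        linarith
      · rw [div_le_iff₀ hr0]
        have := hle k k.2
        push_cast at this ⊢
        exact this
    simp only
    rw [hc]
    exact min_eq_right hlt.le
  · intro a _ b _ h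
    simp only [Fin.mk.injEq] at h
    exact Fin.ext (by omega)

lemma num_bound (x : ℝ) (n s L R B F : ℕ) (hx : 2 ≤ x) (hn : (n : ℝ) = x ^ 10)
    (hs : x ^ 7 - 1 ≤ s) (hsn : s ≤ n) (hL : (L : ℝ) ≤ x ^ 4) (hL' : x ^ 4 < L + 1)
    (hLn : L < n) (hR : L ≤ 2 * R + 1)
    (h : (n - L) ^ R * B ≤ (n - s) ^ R * F) :
    (B : ℝ) ≤ Real.exp (-(x / 8)) * F := by
  have hn0 : (0 : ℝ) < n := by rw [hn]; positivity
  have hLn' : (L : ℝ) < n := by exact_mod_cast hLn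
  have hsn' : (s : ℝ) ≤ n := by exact_mod_cast hsn
  have hR' : (L : ℝ) ≤ 2 * R + 1 := by exact_mod_cast hR
  have h' : ((n : ℝ) - L) ^ R * B ≤ ((n : ℝ) - s) ^ R * F := by
    have : (((n - L) ^ R * B : ℕ) : ℝ) ≤ ((n - s) ^ R * F : ℕ) := by exact_mod_cast h
    push_cast [Nat.cast_sub hLn.le, Nat.cast_sub hsn] at this
    exact this
  have hx4 : (16 : ℝ) ≤ x ^ 4 := by
    calc (16 : ℝ) = 2 ^ 4 := by norm_num
      _ ≤ x ^ 4 := by gcongr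
  have hx3 : (8 : ℝ) ≤ x ^ 3 := by
    calc (8 : ℝ) = 2 ^ 3 := by norm_num
      _ ≤ x ^ 3 := by gcongr
  have hx7 : 8 * x ^ 4 ≤ x ^ 7 := by
    calc 8 * x ^ 4 ≤ x ^ 3 * x ^ 4 := by gcongr
      _ = x ^ 7 := by ring
  have hsL : x ^ 7 / 2 ≤ (s : ℝ) - L := by linarith
  have hRx : x ^ 4 / 4 ≤ (R : ℝ) := by linarith
  set y : ℝ := ((s : ℝ) - L) / n with hy
  have hyn : y * n = s - L := by rw [hy]; field_simp
  have hy0 : 0 ≤ y := by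
    rw [hy]; apply div_nonneg _ hn0.le
    have : 0 ≤ x ^ 7 / 2 := by positivity
    linarith
  have hyx : 1 / (2 * x ^ 3) ≤ y := by
    rw [hy, le_div_iff₀ hn0, hn]
    calc 1 / (2 * x ^ 3) * x ^ 10 = x ^ 7 / 2 := by field_simp
      _ ≤ _ := hsL
  have hq : (n : ℝ) - s ≤ Real.exp (-y) * (n - L) := by
    have h1 : 1 - y ≤ Real.exp (-y) := by
      have := Real.add_one_le_exp (-y); linarith
    calc (n : ℝ) - s ≤ (1 - y) * (n - L) := by
          have : 0 ≤ y * L := by positivity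
          nlinarith
      _ ≤ _ := by
          apply mul_le_mul_of_nonneg_right h1; linarith
  have hpos : 0 < ((n : ℝ) - L) ^ R := pow_pos (by linarith) _
  have h2 : ((n : ℝ) - L) ^ R * B ≤ ((n : ℝ) - L) ^ R * (Real.exp (-y) ^ R * F) := by
    refine h'.trans ?_
    calc ((n : ℝ) - s) ^ R * F ≤ (Real.exp (-y) * (n - L)) ^ R * F := by
          apply mul_le_mul_of_nonneg_right _ (by positivity)
          exact pow_le_pow_left₀ (by linarith) hq R
      _ = _ := by rw [mul_pow]; ring
  refine (le_of_mul_le_mul_left h2 hpos).trans ?_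
  rw [← Real.exp_nat_mul]
  apply mul_le_mul_of_nonneg_right _ (by positivity)
  apply Real.exp_le_exp.2
  have : x / 8 ≤ R * y := by
    calc x / 8 = (x ^ 4 / 4) * (1 / (2 * x ^ 3)) := by field_simp; norm_num
      _ ≤ R * y := by gcongr
  linarith

/-- with the partition of `[n]` into `m = ⌈n^0.3⌉` intervals of length `n^0.7`
(the last absorbing the remainder) and `σ` a uniformly random `n`-cycle on `[n]`, with high
probability as `n → ∞`, for every vertex `v` there exists `1 ≤ t ≤ n^0.4` such that
`σ^(t-1) v` and `σ^t v` lie in the same part (equivalently, every segment of length `⌈n^0.4⌉`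
of the cycle `σ` contains an edge with both endpoints in a common part).

The uniform model is expressed by counting `n`-cycles: for every `p < 1`, eventually the
number of good `n`-cycles is at least `p` times the total number of `n`-cycles. -/
theorem stmt_5 :
    ∀ p : ℝ, p < 1 → ∃ N : ℕ, ∀ n : ℕ, N ≤ n →
      p * (Nat.card {σ : Equiv.Perm (Fin n) //
              σ.IsCycle ∧ σ.support = Finset.univ} : ℝ) ≤
      (Nat.card {σ : Equiv.Perm (Fin n) //
          (σ.IsCycle ∧ σ.support = Finset.univ) ∧
          ∀ v : Fin n, ∃ t : ℕ, 1 ≤ t ∧ (t : ℝ) ≤ (n : ℝ) ^ (0.4 : ℝ) ∧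
            partIdx n ((σ ^ (t - 1)) v) = partIdx n ((σ ^ t) v)} : ℝ) := by
  classical
  intro p hp
  have hT : Filter.Tendsto (fun n : ℕ => (n : ℝ) ^ (0.1 : ℝ)) Filter.atTop Filter.atTop :=
    (tendsto_rpow_atTop (by norm_num)).comp tendsto_natCast_atTop_atTop
  have hE : Filter.Tendsto (fun x : ℝ => 8 ^ 10 * ((x / 8) ^ 10 * Real.exp (-(x / 8))))
      Filter.atTop (nhds 0) := by
    have h1 := (Real.tendsto_pow_mul_exp_neg_atTop_nhds_zero 10).comp
      (Filter.tendsto_id.atTop_div_const (by norm_num : (0 : ℝ) < 8))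
    simpa using h1.const_mul (8 ^ 10)
  have hE' := hE.eventually (gt_mem_nhds (by linarith : (0 : ℝ) < 1 - p))
  have hev := hT.eventually (hE'.and (Filter.eventually_ge_atTop 2))
  obtain ⟨N, hN⟩ := Filter.eventually_atTop.1 hev
  refine ⟨max N 2, fun n hn => ?_⟩
  obtain ⟨hx1, hx2⟩ := hN n ((le_max_left _ _).trans hn)
  have hn2 : 2 ≤ n := (le_max_right _ _).trans hn
  have hn0 : (0 : ℝ) ≤ n := by positivity
  set x : ℝ := (n : ℝ) ^ (0.1 : ℝ) with hx
  have hx10 : (n : ℝ) = x ^ 10 := by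
    rw [hx, ← Real.rpow_natCast, ← Real.rpow_mul hn0]; norm_num
  have hx7 : (n : ℝ) ^ (0.7 : ℝ) = x ^ 7 := by
    rw [hx, ← Real.rpow_natCast, ← Real.rpow_mul hn0]; norm_num
  have hx4 : (n : ℝ) ^ (0.4 : ℝ) = x ^ 4 := by
    rw [hx, ← Real.rpow_natCast, ← Real.rpow_mul hn0]; norm_num
  have hx0 : 0 ≤ x := by linarith
  set L := ⌊(n : ℝ) ^ (0.4 : ℝ)⌋₊ with hLdef
  set s := ⌊(n : ℝ) ^ (0.7 : ℝ)⌋₊ with hsdef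
  have hL1 : (L : ℝ) ≤ x ^ 4 := by
    rw [← hx4]; exact Nat.floor_le (by positivity)
  have hL2 : x ^ 4 < L + 1 := by
    rw [← hx4]; exact Nat.lt_floor_add_one _
  have hs1 : (s : ℝ) ≤ x ^ 7 := by
    rw [← hx7]; exact Nat.floor_le (by positivity)
  have hs2 : x ^ 7 < s + 1 := by
    rw [← hx7]; exact Nat.lt_floor_add_one _
  have hsn : s ≤ n := by
    have : (s : ℝ) ≤ n := by
      rw [hx10]; exact hs1.trans (pow_le_pow_right₀ (by linarith) (by norm_num))
    exact_mod_cast this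
  have hLn : L < n := by
    have : (L : ℝ) < n := by
      rw [hx10]; exact hL1.trans_lt (pow_lt_pow_right₀ (by linarith) (by norm_num))
    exact_mod_cast this
  have hit := iter_step (partIdx n) ⌈(n : ℝ) ^ (0.3 : ℝ)⌉₊ s L hLn (part_size n) (L / 2) (by omega)
  have hnum := num_bound x n s L (L / 2) _ _ hx2 hx10 (by linarith) hsn hL1 hL2 hLn (by omega) hit
  have hbad := bad_le (partIdx n) (2 * (L / 2)) (by omega : 0 < n)
  have hC := card_cyc n hn2
  rw [Nat.card_eq_fintype_card, Nat.card_eq_fintype_card, Fintype.card_subtype,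
    Fintype.card_subtype]
  set C : Finset (Perm (Fin n)) := {σ | σ.IsCycle ∧ σ.support = Finset.univ} with hCdef
  set G : Finset (Perm (Fin n)) := {σ | (σ.IsCycle ∧ σ.support = Finset.univ) ∧
          ∀ v : Fin n, ∃ t : ℕ, 1 ≤ t ∧ (t : ℝ) ≤ (n : ℝ) ^ (0.4 : ℝ) ∧
            partIdx n ((σ ^ (t - 1)) v) = partIdx n ((σ ^ t) v)} with hGdef
  set B : Finset (Perm (Fin n)) := {σ : Perm (Fin n) | (σ.IsCycle ∧ σ.support = Finset.univ) ∧
      ∃ v, ∀ i < 2 * (L / 2), partIdx n ((σ ^ i) v) ≠ partIdx n ((σ ^ (i + 1)) v)} with hBdef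
  have hsub : C ⊆ G ∪ B := by
    intro σ hσ
    simp only [hCdef, hGdef, hBdef, Finset.mem_union, Finset.mem_filter, Finset.mem_univ,
      true_and] at hσ ⊢
    by_cases hb : ∃ v, ∀ i < 2 * (L / 2), partIdx n ((σ ^ i) v) ≠ partIdx n ((σ ^ (i + 1)) v)
    · exact Or.inr ⟨hσ, hb⟩
    · refine Or.inl ⟨hσ, fun v => ?_⟩
      push Not at hb
      obtain ⟨i, hi, he⟩ := hb v
      refine ⟨i + 1, by omega, ?_, by rw [Nat.add_sub_cancel]; exact he⟩
      have : i + 1 ≤ L := by omega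
      exact (Nat.le_floor_iff (by positivity)).1 this
  have hcard : (#C : ℝ) ≤ #G + #B := by
    exact_mod_cast (Finset.card_le_card hsub).trans (Finset.card_union_le _ _)
  have hB : (#B : ℝ) ≤ Real.exp (-(x / 8)) * n.factorial :=
    le_trans (by exact_mod_cast hbad) hnum
  have hfac : (n.factorial : ℝ) = x ^ 10 * #C := by
    rw [hC, ← hx10]
    exact_mod_cast (Nat.mul_factorial_pred (by omega : n ≠ 0)).symm
  have hB2 : (#B : ℝ) ≤ (1 - p) * #C := by
    refine hB.trans ?_
    rw [hfac]
    calc Real.exp (-(x / 8)) * (x ^ 10 * #C)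
        = (8 ^ 10 * ((x / 8) ^ 10 * Real.exp (-(x / 8)))) * #C := by ring
      _ ≤ (1 - p) * #C := mul_le_mul_of_nonneg_right hx1.le (Nat.cast_nonneg _)
  linarith
end
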